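/- There exists a universal constant c > 0 such that for every N ≥ 1, every admissible system with K = N, every ε ∈ (0,1) and every interval I ⊆ (−1+ε, 1), E[𝒵²_{N,N}(g, I)] ≤ (cN/ε)·log(max_{1≤k≤N} d_k)·sup_{r∈I} ∏_{k=1}^N (ξ_k'(1)²(1−r²)/(ξ_k(1)² − ξ_k(r)²))^{1/2}. -/

import Mathlib

open MeasureTheory ProbabilityTheory
open scoped ENNReal

noncomputable section

/-- Index triples `(k, p, i)` with `k ∈ {1,…,K}`, `2 ≤ p ≤ d k`, `i ∈ {0,…,N}^p`. -/
abbrev GIdx (N K : ℕ) (d : Fin K → ℕ) : Type :=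
  (k : Fin K) × (p : {p : Fin (d k + 1) // 2 ≤ (p : ℕ)}) × (Fin (p.1 : ℕ) → Fin (N + 1))

/-- The product of standard Gaussian measures over the index set of triples. -/
abbrev GaussP (N K : ℕ) (d : Fin K → ℕ) : Measure (GIdx N K d → ℝ) :=
  Measure.pi fun _ => gaussianReal 0 1

/-- The random polynomial `f_k(g, x) = ∑_{p=2}^{d k} a_{p,k} ∑_i g_{k,p,i} x_{i₁} ⋯ x_{i_p}`. -/
def rf (N K : ℕ) (d : Fin K → ℕ) (a : Fin K → ℕ → ℝ) (k : Fin K)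
    (g : GIdx N K d → ℝ) (x : Fin (N + 1) → ℝ) : ℝ :=
  ∑ p : {p : Fin (d k + 1) // 2 ≤ (p : ℕ)},
    a k (p.1 : ℕ) * ∑ i : Fin (p.1 : ℕ) → Fin (N + 1), g ⟨k, p, i⟩ * ∏ j, x (i j)

/-- `ξ(t) = ∑_{p=2}^d a_p² t^p`. -/
def xi (d : ℕ) (a : ℕ → ℝ) (t : ℝ) : ℝ := ∑ p ∈ Finset.Icc 2 d, a p ^ 2 * t ^ p

/-- `ξ'`, the derivative of `ξ`. -/
def xi' (d : ℕ) (a : ℕ → ℝ) : ℝ → ℝ := deriv (xi d a)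

/-- `Vol(S^{d-1}) = 2 π^{d/2} / Γ(d/2)`. -/
def sphereVol (d : ℝ) : ℝ := 2 * Real.pi ^ (d / 2) / Real.Gamma (d / 2)

/-- `m_{N,K} = Vol(S^{N-K}) ∏_{k=1}^K √(ξ_k'(1)/ξ_k(1))`. -/
def mNK (N K : ℕ) (d : Fin K → ℕ) (a : Fin K → ℕ → ℝ) : ℝ :=
  sphereVol ((N : ℝ) - K + 1) * ∏ k, Real.sqrt (xi' (d k) (a k) 1 / xi (d k) (a k) 1)

/-- The zero set of the system on the unit sphere. -/
def zeroSet (N K : ℕ) (d : Fin K → ℕ) (a : Fin K → ℕ → ℝ) (g : GIdx N K d → ℝ) :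
    Set (EuclideanSpace ℝ (Fin (N + 1))) :=
  {x | ‖x‖ = 1 ∧ ∀ k, rf N K d a k g (fun i => x i) = 0}

/-- `𝒵_{N,K}(g)`: `(N-K)`-dimensional Hausdorff measure of the zero set. -/
def Znk (N K : ℕ) (d : Fin K → ℕ) (a : Fin K → ℕ → ℝ) (g : GIdx N K d → ℝ) : ℝ≥0∞ :=
  μH[(N : ℝ) - K] (zeroSet N K d a g)


/-- The product `ℝ^{N+1} × ℝ^{N+1}` with the `L²` (Euclidean) product metric. -/
abbrev PairSpace (N : ℕ) : Type :=
  WithLp 2 (EuclideanSpace ℝ (Fin (N + 1)) × EuclideanSpace ℝ (Fin (N + 1)))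

instance (N : ℕ) : MeasurableSpace (PairSpace N) := borel _
instance (N : ℕ) : BorelSpace (PairSpace N) := ⟨rfl⟩

/-- The set of pairs of zeros `(x, y)` on the unit sphere with `⟨x,y⟩ ∈ I`. -/
def zeroPairSet (N K : ℕ) (d : Fin K → ℕ) (a : Fin K → ℕ → ℝ) (g : GIdx N K d → ℝ)
    (I : Set ℝ) : Set (PairSpace N) :=
  {z | ‖(WithLp.equiv 2 _ z).1‖ = 1 ∧ ‖(WithLp.equiv 2 _ z).2‖ = 1 ∧
       (∑ i, (WithLp.equiv 2 _ z).1 i * (WithLp.equiv 2 _ z).2 i) ∈ I ∧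
       ∀ k, rf N K d a k g (fun i => (WithLp.equiv 2 _ z).1 i) = 0 ∧
            rf N K d a k g (fun i => (WithLp.equiv 2 _ z).2 i) = 0}

/-- `𝒵²_{N,K}(g, I)`: the `2(N-K)`-dimensional Hausdorff measure of the set of pairs of
zeros on the sphere whose inner product lies in `I`. -/
def Znk2 (N K : ℕ) (d : Fin K → ℕ) (a : Fin K → ℕ → ℝ) (g : GIdx N K d → ℝ)
    (I : Set ℝ) : ℝ≥0∞ :=
  μH[2 * ((N : ℝ) - K)] (zeroPairSet N K d a g I)

lemma area_cell {E : Type*} [NormedAddCommGroup E] [NormedSpace ℝ E] [FiniteDimensional ℝ E]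
    [MeasurableSpace E] [BorelSpace E] (μ : Measure E) [μ.IsAddHaarMeasure]
    {A : Set E} (hA : MeasurableSet A) {T : E → E} {T' : E → E →L[ℝ] E} (hTm : Measurable T)
    (hT : ∀ x ∈ A, HasFDerivAt T (T' x) x) {ρ : E → ℝ≥0∞} (hρ : Measurable ρ)
    (hρt : ∀ y, ρ y ≠ ⊤) :
    ∃ B : Set E, MeasurableSet B ∧ T '' A ⊆ B ∧
      ∫⁻ y in B, ρ y ∂μ ≤ 2 * ∫⁻ x in A, ρ (T x) * ENNReal.ofReal |(T' x).det| ∂μ := by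
  classical
  set V : ℤ → Set E := fun k => ρ ⁻¹' Set.Ico ((2 : ℝ≥0∞) ^ k) ((2 : ℝ≥0∞) ^ (k + 1)) with hV
  have hVm : ∀ k, MeasurableSet (V k) := fun k => hρ measurableSet_Ico
  set Ak : ℤ → Set E := fun k => A ∩ T ⁻¹' V k with hAk
  have hAkm : ∀ k, MeasurableSet (Ak k) := fun k => hA.inter (hTm (hVm k))
  have hmono : Monotone (fun k : ℤ => (2 : ℝ≥0∞) ^ k) :=
    fun i j hij => ENNReal.zpow_le_of_le (by norm_num) hij
  have hdisj : Pairwise (Function.onFun Disjoint Ak) := by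
    intro i j hij
    have := hmono.pairwise_disjoint_on_Ico_succ hij
    rw [Function.onFun, Set.disjoint_left] at *
    rintro x ⟨_, hi⟩ ⟨_, hj⟩
    exact this (a := ρ (T x)) (by simpa [hV] using hi) (by simpa [hV] using hj)
  set Bk : ℤ → Set E := fun k => toMeasurable μ (T '' Ak k) ∩ V k with hBk
  have hBkm : ∀ k, MeasurableSet (Bk k) := fun k => (measurableSet_toMeasurable _ _).inter (hVm k)
  refine ⟨ρ ⁻¹' {0} ∪ ⋃ k, Bk k, (hρ (measurableSet_singleton 0)).union
    (MeasurableSet.iUnion hBkm), ?_, ?_⟩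
  · rintro _ ⟨x, hx, rfl⟩
    by_cases h0 : ρ (T x) = 0
    · exact Or.inl h0
    · obtain ⟨k, hk⟩ := ENNReal.exists_mem_Ico_zpow h0 (hρt _) (y := 2) (by norm_num) (by norm_num)
      refine Or.inr (Set.mem_iUnion.2 ⟨k, subset_toMeasurable _ _ ⟨x, ⟨hx, hk⟩, rfl⟩, hk⟩)
  · have h0 : ∫⁻ y in ρ ⁻¹' {0}, ρ y ∂μ = 0 := by
      rw [setLIntegral_congr_fun (g := fun _ => 0) (hρ (measurableSet_singleton 0))
        (fun y hy => hy)]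
      simp
    have hk : ∀ k, ∫⁻ y in Bk k, ρ y ∂μ ≤
        2 * ∫⁻ x in Ak k, ρ (T x) * ENNReal.ofReal |(T' x).det| ∂μ := by
      intro k
      have hz : (2 : ℝ≥0∞) ^ (k + 1) = 2 * 2 ^ k := by
        rw [ENNReal.zpow_add (by norm_num) (by norm_num), zpow_one, mul_comm]
      have hfin : (2 : ℝ≥0∞) ^ k ≠ ⊤ := by
        have := ENNReal.zpow_lt_top (a := 2) (by norm_num) (by norm_num) k
        exact this.ne
      calc ∫⁻ y in Bk k, ρ y ∂μ ≤ ∫⁻ y in Bk k, (2 : ℝ≥0∞) ^ (k + 1) ∂μ :=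
            setLIntegral_mono measurable_const (fun y hy => hy.2.2.le)
        _ = 2 ^ (k + 1) * μ (Bk k) := by simp
        _ ≤ 2 ^ (k + 1) * μ (T '' Ak k) := by
            refine mul_le_mul_right ?_ _
            calc μ (Bk k) ≤ μ (toMeasurable μ (T '' Ak k)) := measure_mono Set.inter_subset_left
              _ = _ := measure_toMeasurable _
        _ ≤ 2 ^ (k + 1) * ∫⁻ x in Ak k, ENNReal.ofReal |(T' x).det| ∂μ := by
            gcongr
            exact addHaar_image_le_lintegral_abs_det_fderiv μ (hAkm k)
              (fun x hx => (hT x hx.1).hasFDerivWithinAt)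
        _ = 2 * ∫⁻ x in Ak k, 2 ^ k * ENNReal.ofReal |(T' x).det| ∂μ := by
            rw [lintegral_const_mul' _ _ hfin, hz, mul_assoc]
        _ ≤ _ := by
            gcongr 2 * ?_
            refine setLIntegral_mono' (hAkm k) (fun x hx => ?_)
            gcongr
            exact hx.2.1
    calc _ ≤ ∫⁻ y in ρ ⁻¹' {0}, ρ y ∂μ + ∫⁻ y in ⋃ k, Bk k, ρ y ∂μ := lintegral_union_le _ _ _
      _ = ∫⁻ y in ⋃ k, Bk k, ρ y ∂μ := by rw [h0, zero_add]
      _ ≤ ∑' k, ∫⁻ y in Bk k, ρ y ∂μ := lintegral_iUnion_le _ _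
      _ ≤ ∑' k, 2 * ∫⁻ x in Ak k, ρ (T x) * ENNReal.ofReal |(T' x).det| ∂μ :=
          ENNReal.tsum_le_tsum hk
      _ = 2 * ∫⁻ x in ⋃ k, Ak k, ρ (T x) * ENNReal.ofReal |(T' x).det| ∂μ := by
          rw [ENNReal.tsum_mul_left, lintegral_iUnion hAkm hdisj]
      _ ≤ _ := by
          gcongr
          exact Set.iUnion_subset fun k => Set.inter_subset_left

lemma area_count {E : Type*} [NormedAddCommGroup E] [NormedSpace ℝ E] [FiniteDimensional ℝ E]
    [MeasurableSpace E] [BorelSpace E] (μ : Measure E) [μ.IsAddHaarMeasure]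
    {S : Set E} (hS : MeasurableSet S) {T : E → E} {T' : E → E →L[ℝ] E} (hTm : Measurable T)
    (hT : ∀ x ∈ S, HasFDerivAt T (T' x) x) {ρ : E → ℝ≥0∞} (hρ : Measurable ρ)
    (hρt : ∀ y, ρ y ≠ ⊤) :
    ∫⁻ y, ρ y * ((S ∩ T ⁻¹' {y}).encard : ℝ≥0∞) ∂μ ≤
      2 * ∫⁻ x in S, ρ (T x) * ENNReal.ofReal |(T' x).det| ∂μ := by
  classical
  have : SecondCountableTopology E := by
    have := FiniteDimensional.proper ℝ E
    infer_instance
  set q : (n : ℕ) → E → (Fin n → Bool) := fun n x i => MeasurableSpace.mapNatBool E x i with hq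
  have hqm : ∀ n, Measurable (q n) := fun n => measurable_pi_iff.2 fun i =>
    measurable_pi_iff.1 (MeasurableSpace.measurable_mapNatBool E) (i : ℕ)
  set C : (n : ℕ) → (Fin n → Bool) → Set E := fun n c => S ∩ q n ⁻¹' {c} with hC
  have hCm : ∀ n c, MeasurableSet (C n c) := fun n c => hS.inter (hqm n (measurableSet_singleton c))
  have key : ∀ n c, ∃ B : Set E, MeasurableSet B ∧ T '' (C n c) ⊆ B ∧
      ∫⁻ y in B, ρ y ∂μ ≤ 2 * ∫⁻ x in C n c, ρ (T x) * ENNReal.ofReal |(T' x).det| ∂μ :=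
    fun n c => area_cell μ (hCm n c) hTm (fun x hx => hT x hx.1) hρ hρt
  choose B hBm hBs hBi using key
  set φ : ℕ → E → ℝ≥0∞ := fun n y => ∑ c, (B n c).indicator ρ y with hφ
  have hφm : ∀ n, Measurable (φ n) := fun n =>
    Finset.measurable_fun_sum _ fun c _ => hρ.indicator (hBm n c)
  have hφi : ∀ n, ∫⁻ y, φ n y ∂μ ≤ 2 * ∫⁻ x in S, ρ (T x) * ENNReal.ofReal |(T' x).det| ∂μ := by
    intro n
    rw [hφ]
    simp only
    rw [lintegral_finsetSum _ (fun c _ => hρ.indicator (hBm n c))]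
    calc _ = ∑ c, ∫⁻ y in B n c, ρ y ∂μ := by
          refine Finset.sum_congr rfl fun c _ => lintegral_indicator (hBm n c) _
      _ ≤ ∑ c, 2 * ∫⁻ x in C n c, ρ (T x) * ENNReal.ofReal |(T' x).det| ∂μ :=
          Finset.sum_le_sum fun c _ => hBi n c
      _ = 2 * ∫⁻ x in ⋃ c, C n c, ρ (T x) * ENNReal.ofReal |(T' x).det| ∂μ := by
          rw [← Finset.mul_sum, lintegral_iUnion (hCm n), tsum_fintype]
          intro i j hij
          rw [Function.onFun, Set.disjoint_left]
          rintro x ⟨_, hi⟩ ⟨_, hj⟩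
          exact hij (hi.symm.trans hj)
      _ ≤ _ := by
          gcongr
          exact Set.iUnion_subset fun k => Set.inter_subset_left
  have hle : ∀ y, ρ y * ((S ∩ T ⁻¹' {y}).encard : ℝ≥0∞) ≤
      Filter.liminf (fun n => φ n y) Filter.atTop := by
    intro y
    -- finite subsets
    have hfin : ∀ F : Finset E, (F : Set E) ⊆ S ∩ T ⁻¹' {y} →
        ρ y * (F.card : ℝ≥0∞) ≤ Filter.liminf (fun n => φ n y) Filter.atTop := by
      intro F hF
      have hev : ∀ᶠ n in Filter.atTop, Set.InjOn (q n) (F : Set E) := by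
        have : ∀ p ∈ F ×ˢ F, ∀ᶠ n in Filter.atTop, (q n p.1 = q n p.2 → p.1 = p.2) := by
          rintro ⟨x, x'⟩ -
          by_cases hxx : x = x'
          · exact Filter.Eventually.of_forall fun n _ => hxx
          · have : MeasurableSpace.mapNatBool E x ≠ MeasurableSpace.mapNatBool E x' :=
              fun h => hxx (MeasurableSpace.injective_mapNatBool E h)
            obtain ⟨m, hm⟩ := Function.ne_iff.1 this
            filter_upwards [Filter.eventually_gt_atTop m] with n hn h
            exact absurd (congrFun h ⟨m, hn⟩) hm
        have := (Filter.eventually_all_finset (F ×ˢ F)).2 this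
        filter_upwards [this] with n hn x hx x' hx' h
        exact hn (x, x') (Finset.mem_product.2 ⟨hx, hx'⟩) h
      refine Filter.le_liminf_of_le (by isBoundedDefault) ?_
      filter_upwards [hev] with n hn
      calc ρ y * (F.card : ℝ≥0∞) = ∑ c ∈ F.image (q n), ρ y := by
            rw [Finset.sum_const, Finset.card_image_of_injOn hn, nsmul_eq_mul, mul_comm]
        _ ≤ ∑ c ∈ F.image (q n), (B n c).indicator ρ y := by
            refine Finset.sum_le_sum fun c hc => ?_
            obtain ⟨x, hx, rfl⟩ := Finset.mem_image.1 hc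
            have hx' := hF hx
            rw [Set.indicator_of_mem]
            exact hBs n _ ⟨x, ⟨hx'.1, rfl⟩, hx'.2⟩
        _ ≤ φ n y := Finset.sum_le_sum_of_subset (Finset.subset_univ _)
    by_cases hf : (S ∩ T ⁻¹' {y}).Finite
    · have := hfin hf.toFinset (by simp)
      rw [hf.encard_eq_coe_toFinset_card]
      simpa using this
    · have hinf : (S ∩ T ⁻¹' {y}).Infinite := hf
      by_cases h0 : ρ y = 0
      · simp [h0]
      · have : Filter.liminf (fun n => φ n y) Filter.atTop = ⊤ := by
          refine ENNReal.eq_top_of_forall_nnreal_le fun r => ?_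
          obtain ⟨m, hm⟩ := ENNReal.exists_nat_mul_gt h0 (b := r) (by simp)
          obtain ⟨F, hF, hc⟩ := hinf.exists_subset_card_eq m
          have := hfin F hF
          rw [hc, mul_comm] at this
          exact hm.le.trans this
        rw [this]; exact le_top
  calc _ ≤ ∫⁻ y, Filter.liminf (fun n => φ n y) Filter.atTop ∂μ := lintegral_mono hle
    _ ≤ Filter.liminf (fun n => ∫⁻ y, φ n y ∂μ) Filter.atTop := lintegral_liminf_le hφm
    _ ≤ Filter.liminf (fun _ : ℕ => 2 * ∫⁻ x in S, ρ (T x) * ENNReal.ofReal |(T' x).det| ∂μ) Filter.atTop :=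
        Filter.liminf_le_liminf (Filter.Eventually.of_forall hφi)
    _ = _ := by simp

section
open scoped Matrix
set_option linter.all false

lemma det_lower {M M' : Type*} [AddCommGroup M] [Module ℝ M] [FiniteDimensional ℝ M]
    [AddCommGroup M'] [Module ℝ M'] [FiniteDimensional ℝ M']
    (f : M →ₗ[ℝ] M) (c : M →ₗ[ℝ] M') (h : M' →ₗ[ℝ] M') :
    LinearMap.det ((f ∘ₗ LinearMap.fst ℝ M M').prod
      (c ∘ₗ LinearMap.fst ℝ M M' + h ∘ₗ LinearMap.snd ℝ M M')) =
      LinearMap.det f * LinearMap.det h := by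
  classical
  let b := Module.Free.chooseBasis ℝ M
  let b' := Module.Free.chooseBasis ℝ M'
  rw [← LinearMap.det_toMatrix (b.prod b'), ← LinearMap.det_toMatrix b,
    ← LinearMap.det_toMatrix b']
  rw [← Matrix.det_fromBlocks_zero₁₂ _ (LinearMap.toMatrix b b' c)]
  congr 1
  ext (i | i) (j | j) <;> simp [LinearMap.toMatrix_apply]

lemma det_upper {M M' : Type*} [AddCommGroup M] [Module ℝ M] [FiniteDimensional ℝ M]
    [AddCommGroup M'] [Module ℝ M'] [FiniteDimensional ℝ M']
    (f : M →ₗ[ℝ] M) (c : M' →ₗ[ℝ] M) (h : M' →ₗ[ℝ] M') :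
    LinearMap.det ((f ∘ₗ LinearMap.fst ℝ M M' + c ∘ₗ LinearMap.snd ℝ M M').prod
      (h ∘ₗ LinearMap.snd ℝ M M')) =
      LinearMap.det f * LinearMap.det h := by
  classical
  let b := Module.Free.chooseBasis ℝ M
  let b' := Module.Free.chooseBasis ℝ M'
  rw [← LinearMap.det_toMatrix (b.prod b'), ← LinearMap.det_toMatrix b,
    ← LinearMap.det_toMatrix b']
  rw [← Matrix.det_fromBlocks_zero₂₁ _ (LinearMap.toMatrix b' b c)]
  congr 1
  ext (i | i) (j | j) <;> simp [LinearMap.toMatrix_apply]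

variable {ι J : Type*} [Fintype ι] [Fintype J] [DecidableEq ι] [DecidableEq J]

/-- the projected vector -/
def krP (o : J → (ι → ℝ)) (g : ι → ℝ) : ι → ℝ := g - ∑ j, (g ⬝ᵥ o j) • o j

/-- the square system matrix -/
def krM (o' : J → (J → ℝ) →L[ℝ] (ι → ℝ)) (n' : J → (J → ℝ) →L[ℝ] ℝ) (w : ι → ℝ) :
    Matrix J J ℝ :=
  Matrix.of fun j i => w ⬝ᵥ o' j (Pi.single i 1) + n' j (Pi.single i 1)

/-- derivative of `(g,z) ↦ g ⬝ᵥ o z` -/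
def krh (o : ι → ℝ) (o' : (J → ℝ) →L[ℝ] (ι → ℝ)) (g : ι → ℝ) : ((ι → ℝ) × (J → ℝ)) →L[ℝ] ℝ :=
  ∑ i, (g i • ((ContinuousLinearMap.proj i).comp (o'.comp (ContinuousLinearMap.snd ℝ _ _))) +
    o i • ((ContinuousLinearMap.proj i).comp (ContinuousLinearMap.fst ℝ _ _)))

lemma krh_apply (o : ι → ℝ) (o' : (J → ℝ) →L[ℝ] (ι → ℝ)) (g : ι → ℝ) (v) :
    krh o o' g v = v.1 ⬝ᵥ o + g ⬝ᵥ o' v.2 := by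
  simp only [krh, dotProduct, ContinuousLinearMap.sum_apply, Finset.sum_add_distrib,
    ContinuousLinearMap.add_apply, ContinuousLinearMap.smul_apply]
  rw [add_comm]
  congr 1
  refine Finset.sum_congr rfl fun i _ => ?_
  simp [mul_comm]

lemma hasFDerivAt_krh {o : (J → ℝ) → (ι → ℝ)} {o' : (J → ℝ) →L[ℝ] (ι → ℝ)} {z : J → ℝ}
    (ho : HasFDerivAt o o' z) (g : ι → ℝ) :
    HasFDerivAt (fun p : (ι → ℝ) × (J → ℝ) => p.1 ⬝ᵥ o p.2) (krh (o z) o' g) (g, z) := by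
  simp only [dotProduct, krh]
  refine HasFDerivAt.fun_sum fun i _ => ?_
  have h1 : HasFDerivAt (fun p : (ι → ℝ) × (J → ℝ) => p.1 i)
    ((ContinuousLinearMap.proj i).comp (ContinuousLinearMap.fst ℝ (ι → ℝ) (J → ℝ))) (g, z) :=
    ((ContinuousLinearMap.proj (R := ℝ) (φ := fun _ : ι => ℝ) i).comp
      (ContinuousLinearMap.fst ℝ (ι → ℝ) (J → ℝ))).hasFDerivAt
  have h2 : HasFDerivAt (fun p : (ι → ℝ) × (J → ℝ) => o p.2 i)
    ((ContinuousLinearMap.proj i).comp (o'.comp (ContinuousLinearMap.snd ℝ (ι → ℝ) (J → ℝ)))) (g, z) := by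
    have h3 : HasFDerivAt (fun p : (ι → ℝ) × (J → ℝ) => o p.2)
      (o'.comp (ContinuousLinearMap.snd ℝ (ι → ℝ) (J → ℝ))) (g, z) :=
      HasFDerivAt.comp (g, z) (f := Prod.snd) ho hasFDerivAt_snd
    exact (hasFDerivAt_pi'.1 h3) i
  exact h1.mul h2

/-- the derivative of the Kac-Rice map -/
def krT' (o : J → ι → ℝ) (o' : J → (J → ℝ) →L[ℝ] (ι → ℝ)) (n' : J → (J → ℝ) →L[ℝ] ℝ)
    (g : ι → ℝ) : ((ι → ℝ) × (J → ℝ)) →L[ℝ] ((ι → ℝ) × (J → ℝ)) :=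
  ContinuousLinearMap.prod
    (ContinuousLinearMap.fst ℝ _ _ - ∑ j, ((g ⬝ᵥ o j) • ((o' j).comp (ContinuousLinearMap.snd ℝ _ _))
      + (krh (o j) (o' j) g).smulRight (o j)))
    (ContinuousLinearMap.pi fun j => krh (o j) (o' j) g + (n' j).comp (ContinuousLinearMap.snd ℝ _ _))

/-- the Kac-Rice map -/
def krT (o : J → (J → ℝ) → (ι → ℝ)) (n : J → (J → ℝ) → ℝ) (p : (ι → ℝ) × (J → ℝ)) :
    (ι → ℝ) × (J → ℝ) :=
  (krP (fun j => o j p.2) p.1, fun j => p.1 ⬝ᵥ o j p.2 + n j p.2)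

lemma hasFDerivAt_krT {o : J → (J → ℝ) → (ι → ℝ)} {n : J → (J → ℝ) → ℝ}
    {o' : J → (J → ℝ) →L[ℝ] (ι → ℝ)} {n' : J → (J → ℝ) →L[ℝ] ℝ} {z : J → ℝ}
    (ho : ∀ j, HasFDerivAt (o j) (o' j) z) (hn : ∀ j, HasFDerivAt (n j) (n' j) z) (g : ι → ℝ) :
    HasFDerivAt (krT o n) (krT' (fun j => o j z) o' n' g) (g, z) := by
  unfold krT krT' krP
  have hs : ∀ j, HasFDerivAt (fun p : (ι → ℝ) × (J → ℝ) => o j p.2)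
      ((o' j).comp (ContinuousLinearMap.snd ℝ (ι → ℝ) (J → ℝ))) (g, z) := fun j =>
      HasFDerivAt.comp (g, z) (f := Prod.snd) (ho j) hasFDerivAt_snd
  have hns : ∀ j, HasFDerivAt (fun p : (ι → ℝ) × (J → ℝ) => n j p.2)
      ((n' j).comp (ContinuousLinearMap.snd ℝ (ι → ℝ) (J → ℝ))) (g, z) := fun j =>
      HasFDerivAt.comp (g, z) (f := Prod.snd) (hn j) hasFDerivAt_snd
  refine HasFDerivAt.prodMk ?_ ?_
  · refine HasFDerivAt.fun_sub hasFDerivAt_fst ?_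
    refine HasFDerivAt.fun_sum fun j _ => ?_
    exact (hasFDerivAt_krh (ho j) g).smul (hs j)
  · rw [hasFDerivAt_pi]
    intro j
    exact (hasFDerivAt_krh (ho j) g).add (hns j)

lemma det_krT' {o : J → ι → ℝ} {o' : J → (J → ℝ) →L[ℝ] (ι → ℝ)} {n' : J → (J → ℝ) →L[ℝ] ℝ}
    {κ : J → ℝ} (horth : ∀ i j, o i ⬝ᵥ o j = if i = j then κ i else 0)
    (hskew : ∀ i j ζ, o' i ζ ⬝ᵥ o j = - (o i ⬝ᵥ o' j ζ))
    (hκ : ∀ j, κ j = 0 ∨ (κ j = 1 ∧ n' j = 0)) (g : ι → ℝ) :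
    (krT' o o' n' g).det = (krM o' n' (krP o g)).det := by
  have ho0 : ∀ j, (κ j = 1 ∧ n' j = 0) ∨ o j = 0 := fun j => by
    rcases hκ j with h | h
    · right
      have := horth j j
      simp only [if_true, h] at this
      exact dotProduct_self_eq_zero.1 this
    · exact Or.inl h
  let Λc : (J → ℝ) →ₗ[ℝ] (ι → ℝ) := Fintype.linearCombination ℝ o
  let Λ : ((ι → ℝ) × (J → ℝ)) →ₗ[ℝ] ((ι → ℝ) × (J → ℝ)) :=
    (LinearMap.id ∘ₗ LinearMap.fst ℝ _ _ + Λc ∘ₗ LinearMap.snd ℝ _ _).prod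
      (LinearMap.id ∘ₗ LinearMap.snd ℝ _ _)
  let Λc' : (J → ℝ) →ₗ[ℝ] (ι → ℝ) := ∑ j, (g ⬝ᵥ o j) • (o' j : (J → ℝ) →ₗ[ℝ] (ι → ℝ))
  let Λ' : ((ι → ℝ) × (J → ℝ)) →ₗ[ℝ] ((ι → ℝ) × (J → ℝ)) :=
    (LinearMap.id ∘ₗ LinearMap.fst ℝ _ _ + Λc' ∘ₗ LinearMap.snd ℝ _ _).prod
      (LinearMap.id ∘ₗ LinearMap.snd ℝ _ _)
  have hΛ : LinearMap.det Λ = 1 := by rw [det_upper]; simp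
  have hΛ' : LinearMap.det Λ' = 1 := by rw [det_upper]; simp
  let c : (ι → ℝ) →ₗ[ℝ] (J → ℝ) := Matrix.mulVecLin (Matrix.of o)
  have hcomp : Λ ∘ₗ (krT' o o' n' g : _ →ₗ[ℝ] _) ∘ₗ Λ' =
    (LinearMap.id ∘ₗ LinearMap.fst ℝ _ _).prod (c ∘ₗ LinearMap.fst ℝ _ _ +
      Matrix.toLin' (krM o' n' (krP o g)) ∘ₗ LinearMap.snd ℝ _ _) := by
    have hL : ∀ p : (ι → ℝ) × (J → ℝ), Λ p = (p.1 + ∑ j, p.2 j • o j, p.2) := fun p => by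
      simp [Λ, Λc, Fintype.linearCombination_apply]
    have hL' : ∀ p : (ι → ℝ) × (J → ℝ), Λ' p = (p.1 + ∑ j, (g ⬝ᵥ o j) • o' j p.2, p.2) := fun p => by
      simp [Λ', Λc']
    have hT : ∀ p : (ι → ℝ) × (J → ℝ), krT' o o' n' g p = 
       (p.1 - ∑ j, ((g ⬝ᵥ o j) • o' j p.2 + (p.1 ⬝ᵥ o j + g ⬝ᵥ o' j p.2) • o j),
        fun j => p.1 ⬝ᵥ o j + g ⬝ᵥ o' j p.2 + n' j p.2) := fun p => by
      unfold krT'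
      ext i
      · simp [krh_apply]
      · simp [krh_apply]
    have hM : ∀ ζ, Matrix.toLin' (krM o' n' (krP o g)) ζ = 
        fun j => (krP o g) ⬝ᵥ o' j ζ + n' j ζ := fun ζ => by
      have : ∀ j, ∃ φ : (J → ℝ) →ₗ[ℝ] ℝ, ∀ ζ, φ ζ = (krP o g) ⬝ᵥ o' j ζ + n' j ζ := fun j =>
        ⟨((dotProductBilin ℝ ℝ : (ι → ℝ) →ₗ[ℝ] (ι → ℝ) →ₗ[ℝ] ℝ) (krP o g)) ∘ₗ (o' j : (J → ℝ) →ₗ[ℝ] (ι → ℝ)) + (n' j : (J → ℝ) →ₗ[ℝ] ℝ), fun ζ => by simp⟩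
      choose φ hφ using this
      ext j
      rw [← hφ, Matrix.toLin'_apply, Matrix.mulVec, dotProduct]
      have : ζ = ∑ i, ζ i • (Pi.single i 1 : J → ℝ) := pi_eq_sum_univ' ζ
      conv_rhs => rw [this, map_sum]
      refine Finset.sum_congr rfl fun i _ => ?_
      rw [map_smul, hφ, smul_eq_mul, mul_comm]
      rfl
    refine LinearMap.ext fun p => ?_
    rw [LinearMap.comp_apply, LinearMap.comp_apply, hL']
    rw [ContinuousLinearMap.coe_coe, hT, hL]
    have h2 : ∀ j, (p.1 + ∑ i, (g ⬝ᵥ o i) • o' i p.2) ⬝ᵥ o j + g ⬝ᵥ o' j p.2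
       = o j ⬝ᵥ p.1 + (krP o g) ⬝ᵥ o' j p.2 := fun j => by
      simp only [krP, add_dotProduct, sub_dotProduct, sum_dotProduct, smul_dotProduct, hskew,
        smul_eq_mul, mul_neg, Finset.sum_neg_distrib]
      rw [dotProduct_comm p.1]
      ring
    refine Prod.ext ?_ ?_
    · simp only
      have : ∀ j, n' j p.2 • o j = 0 := fun j => by
        rcases ho0 j with h | h
        · simp [h.2]
        · simp [h]
      simp only [add_smul _ (n' _ _), this, add_zero]
      rw [Finset.sum_add_distrib]
      abel
    · ext j
      simp only [h2]
      have := congrFun (hM p.2) j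
      simp only [LinearMap.prod_apply, Function.prod, LinearMap.add_apply, LinearMap.comp_apply,
        Pi.add_apply, LinearMap.snd_apply, this]
      simp only [c, Matrix.mulVecLin_apply, Matrix.mulVec, LinearMap.fst_apply]
      change _ = o j ⬝ᵥ p.1 + _
      ring
  have := congrArg LinearMap.det hcomp
  rw [LinearMap.det_comp, LinearMap.det_comp, hΛ, hΛ', det_lower, LinearMap.det_id,
    LinearMap.det_toLin'] at this
  rw [ContinuousLinearMap.det]
  linarith

end

section
open scoped Matrix
set_option linter.all false

lemma kac_rice {ι J : Type*} [Fintype ι] [Fintype J] [DecidableEq ι] [DecidableEq J]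
    {o : J → (J → ℝ) → (ι → ℝ)} {n : J → (J → ℝ) → ℝ}
    {o' : (J → ℝ) → J → (J → ℝ) →L[ℝ] (ι → ℝ)} {n' : (J → ℝ) → J → (J → ℝ) →L[ℝ] ℝ}
    {κ : J → ℝ} {S : Set (J → ℝ)} (hS : MeasurableSet S)
    (hom : ∀ j, Measurable (o j)) (hnm : ∀ j, Measurable (n j))
    (ho : ∀ z ∈ S, ∀ j, HasFDerivAt (o j) (o' z j) z)
    (hn : ∀ z ∈ S, ∀ j, HasFDerivAt (n j) (n' z j) z)
    (horth : ∀ z ∈ S, ∀ i j, o i z ⬝ᵥ o j z = if i = j then κ i else 0)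
    (hskew : ∀ z ∈ S, ∀ i j ζ, o' z i ζ ⬝ᵥ o j z = - (o i z ⬝ᵥ o' z j ζ))
    (hκ : ∀ j, κ j = 0 ∨ (κ j = 1 ∧ (∀ z, n j z = 0) ∧ ∀ z, n' z j = 0))
    {ρG : (ι → ℝ) → ℝ≥0∞} (hρG : Measurable ρG) (hρGt : ∀ g, ρG g ≠ ⊤)
    {ρJ : (J → ℝ) → ℝ≥0∞} (hρJ : Measurable ρJ) (hρJt : ∀ g, ρJ g ≠ ⊤)
    (c : (ι → ℝ) → ℝ≥0∞)
    (hc : ∀ g h, ρJ h ≠ 0 → c g ≤ ({z ∈ S | ∀ j, g ⬝ᵥ o j z = 0 ∧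
      (κ j = 0 → n j z = h j)}.encard : ℝ≥0∞)) :
    (∫⁻ h, ρJ h) * ∫⁻ g, ρG g * c g ≤ 2 * ∫⁻ z in S, ∫⁻ g,
      ρG (krP (fun j => o j z) g) * ρJ (fun j => g ⬝ᵥ o j z + n j z) *
        ENNReal.ofReal |(krM (o' z) (n' z) (krP (fun j => o j z) g)).det| := by
  have hTm : Measurable (krT o n) := by
    have h1 : ∀ j, Measurable fun p : (ι → ℝ) × (J → ℝ) => o j p.2 :=
      fun j => (hom j).comp measurable_snd
    have h2 : ∀ j, Measurable fun p : (ι → ℝ) × (J → ℝ) => p.1 ⬝ᵥ o j p.2 := fun j => by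
      unfold dotProduct
      refine Finset.measurable_fun_sum _ fun i _ => ?_
      exact ((measurable_pi_apply i).comp measurable_fst).mul
        ((measurable_pi_apply i).comp (h1 j))
    unfold krT krP
    refine Measurable.prodMk ?_ ?_
    · refine measurable_fst.sub (Finset.measurable_fun_sum _ fun j _ => (h2 j).smul (h1 j))
    · exact measurable_pi_iff.2 fun j => (h2 j).add ((hnm j).comp measurable_snd)
  set S2 : Set ((ι → ℝ) × (J → ℝ)) := Set.univ ×ˢ S with hS2
  have hS2m : MeasurableSet S2 := MeasurableSet.univ.prod hS
  set T' : ((ι → ℝ) × (J → ℝ)) → ((ι → ℝ) × (J → ℝ)) →L[ℝ] ((ι → ℝ) × (J → ℝ)) :=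
    fun p => krT' (fun j => o j p.2) (o' p.2) (n' p.2) p.1 with hT'
  have hT : ∀ p ∈ S2, HasFDerivAt (krT o n) (T' p) p := by
    rintro ⟨g, z⟩ ⟨-, hz⟩
    exact hasFDerivAt_krT (ho z hz) (hn z hz) g
  set ρ : ((ι → ℝ) × (J → ℝ)) → ℝ≥0∞ := fun p => ρG p.1 * ρJ p.2 with hρdef
  have hρ : Measurable ρ := (hρG.comp measurable_fst).mul (hρJ.comp measurable_snd)
  have hρt : ∀ p, ρ p ≠ ⊤ := fun p => ENNReal.mul_ne_top (hρGt _) (hρJt _)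
  have hHaar : (volume : Measure ((ι → ℝ) × (J → ℝ))).IsAddHaarMeasure := by
    rw [Measure.volume_eq_prod]
    exact Measure.prod.instIsAddHaarMeasure volume volume
  have hmain := area_count (volume : Measure ((ι → ℝ) × (J → ℝ))) hS2m hTm hT hρ hρt
  have hL : (∫⁻ h, ρJ h) * ∫⁻ g, ρG g * c g ≤
      ∫⁻ y, ρ y * ((S2 ∩ krT o n ⁻¹' {y}).encard : ℝ≥0∞) := by
    obtain ⟨c', hc'm, hc'le, hc'eq⟩ := exists_measurable_le_lintegral_eq volume (fun g => ρG g * c g)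
    rw [hc'eq, mul_comm, ← lintegral_prod_mul hc'm.aemeasurable hρJ.aemeasurable]
    rw [← Measure.volume_eq_prod]
    refine lintegral_mono ?_
    rintro ⟨g, h⟩
    by_cases hh : ρJ h = 0
    · simp [hh]
    · calc c' g * ρJ h ≤ ρG g * c g * ρJ h := by gcongr; exact hc'le g
        _ = ρ (g, h) * c g := by rw [hρdef]; ring
        _ ≤ _ := by
          refine mul_le_mul_right ?_ _
          refine (hc g h hh).trans ?_
          norm_cast
          set F : (J → ℝ) → (ι → ℝ) × (J → ℝ) := fun z => (g + ∑ j, (κ j * h j) • o j z, z) with hF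
          have hinj : Function.Injective F := fun z z' hzz => congrArg Prod.snd hzz
          rw [← hinj.encard_image]
          refine Set.encard_le_encard ?_
          rintro _ ⟨z, ⟨hz, hz0⟩, rfl⟩
          refine ⟨⟨trivial, hz⟩, ?_⟩
          have hd : ∀ j, (g + ∑ i, (κ i * h i) • o i z) ⬝ᵥ o j z = κ j * h j := fun j => by
            rw [add_dotProduct, (hz0 j).1, sum_dotProduct]
            simp only [smul_dotProduct, horth z hz, smul_eq_mul, mul_ite, mul_zero, zero_add]
            rw [Finset.sum_ite_eq' Finset.univ j]
            rcases hκ j with hk | ⟨hk, _⟩ <;> simp [hk]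
          simp only [Set.mem_preimage, Set.mem_singleton_iff, hF, krT, krP, hd]
          refine Prod.ext ?_ ?_
          · simp
          · ext j
            rcases hκ j with hk | ⟨hk, hk2, _⟩
            · simp [hk, (hz0 j).2 hk]
            · simp [hk, hk2]
  refine hL.trans (hmain.trans ?_)
  refine mul_le_mul_right ?_ _
  have hres : (volume : Measure ((ι → ℝ) × (J → ℝ))).restrict S2 =
      (volume : Measure (ι → ℝ)).prod ((volume : Measure (J → ℝ)).restrict S) := by
    rw [Measure.volume_eq_prod, hS2, ← Measure.prod_restrict, Measure.restrict_univ]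
  have hdm : AEMeasurable (fun x => ENNReal.ofReal |(T' x).det|)
      ((volume : Measure ((ι → ℝ) × (J → ℝ))).restrict S2) :=
    aemeasurable_ofReal_abs_det_fderivWithin volume hS2m
      (fun x hx => (hT x hx).hasFDerivWithinAt)
  have hm : AEMeasurable (fun x => ρ (krT o n x) * ENNReal.ofReal |(T' x).det|)
      ((volume : Measure ((ι → ℝ) × (J → ℝ))).restrict S2) :=
    ((hρ.comp hTm).aemeasurable).mul hdm
  rw [hres] at hm ⊢
  rw [lintegral_prod_symm _ hm]
  refine setLIntegral_mono' hS fun z hz => lintegral_mono fun g => ?_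
  simp only [hρdef, hT', krT]
  rw [det_krT' (horth z hz) (hskew z hz)]
  intro j
  rcases hκ j with hk | ⟨hk, _, hk2⟩
  · exact Or.inl hk
  · exact Or.inr ⟨hk, hk2 z⟩

end

section
open scoped Matrix
set_option linter.all false

lemma lintegral_pi_prod {ι : Type*} [Fintype ι] (f : ι → ℝ → ℝ) (hf : ∀ i x, 0 ≤ f i x)
    (hi : ∀ i, Integrable (f i)) :
    ∫⁻ x : ι → ℝ, ∏ i, ENNReal.ofReal (f i (x i)) = ∏ i, ∫⁻ x, ENNReal.ofReal (f i x) := by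
  have h1 : ∀ x : ι → ℝ, ∏ i, ENNReal.ofReal (f i (x i)) = ENNReal.ofReal (∏ i, f i (x i)) :=
    fun x => (ENNReal.ofReal_prod_of_nonneg fun i _ => hf i _).symm
  simp_rw [h1]
  have hI : Integrable (fun x : ι → ℝ => ∏ i, f i (x i)) := by
    rw [volume_pi]; exact Integrable.fintype_prod hi
  rw [← ofReal_integral_eq_lintegral_ofReal hI
    (Filter.Eventually.of_forall fun x => Finset.prod_nonneg fun i _ => hf i _)]
  rw [integral_fintype_prod_volume_eq_prod f]
  rw [ENNReal.ofReal_prod_of_nonneg fun i _ => integral_nonneg (hf i)]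
  refine Finset.prod_congr rfl fun i _ => ?_
  rw [ofReal_integral_eq_lintegral_ofReal (hi i) (Filter.Eventually.of_forall (hf i))]

/-- Gaussian density on a finite product. -/
def gPdf (ι : Type*) [Fintype ι] (g : ι → ℝ) : ℝ≥0∞ := ∏ i, gaussianPDF 0 1 (g i)

lemma measurable_gPdf (ι : Type*) [Fintype ι] : Measurable (gPdf ι) := by
  unfold gPdf
  exact Finset.measurable_fun_prod _ fun i _ =>
    (measurable_gaussianPDF 0 1).comp (measurable_pi_apply i)

lemma pi_gauss {ι : Type*} [Fintype ι] :
    (Measure.pi fun _ : ι => gaussianReal 0 1) = (volume : Measure (ι → ℝ)).withDensity (gPdf ι) := by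
  refine Measure.pi_eq fun s hs => ?_
  rw [withDensity_apply _ (MeasurableSet.univ_pi hs),
    ← lintegral_indicator (MeasurableSet.univ_pi hs)]
  have h1 : ∀ x : ι → ℝ, (Set.univ.pi s).indicator (gPdf ι) x
      = ∏ i, ENNReal.ofReal ((s i).indicator (gaussianPDFReal 0 1) (x i)) := by
    intro x
    by_cases hx : x ∈ Set.univ.pi s
    · rw [Set.indicator_of_mem hx]
      refine Finset.prod_congr rfl fun i _ => ?_
      rw [Set.indicator_of_mem (hx i trivial)]; rfl
    · rw [Set.indicator_of_notMem hx]
      simp only [Set.mem_pi, Set.mem_univ, true_implies, not_forall] at hx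
      obtain ⟨i, hi⟩ := hx
      symm
      refine Finset.prod_eq_zero (Finset.mem_univ i) ?_
      rw [Set.indicator_of_notMem hi, ENNReal.ofReal_zero]
  simp_rw [h1]
  rw [lintegral_pi_prod]
  · refine Finset.prod_congr rfl fun i _ => ?_
    rw [gaussianReal_apply _ one_ne_zero, ← lintegral_indicator (hs i)]
    refine lintegral_congr fun x => ?_
    by_cases hx : x ∈ s i
    · simp [hx, gaussianPDF]
    · simp [hx]
  · intro i x
    exact Set.indicator_nonneg (fun _ _ => gaussianPDFReal_nonneg 0 1 _) _
  · intro i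
    exact (integrable_gaussianPDFReal 0 1).indicator (hs i)

lemma gPdf_eq {ι : Type*} [Fintype ι] (g : ι → ℝ) :
    gPdf ι g = ENNReal.ofReal (((Real.sqrt (2 * Real.pi))⁻¹) ^ (Fintype.card ι) *
      Real.exp (-(g ⬝ᵥ g) / 2)) := by
  unfold gPdf gaussianPDF
  rw [← ENNReal.ofReal_prod_of_nonneg fun i _ => gaussianPDFReal_nonneg 0 1 _]
  congr 1
  unfold gaussianPDFReal
  rw [Finset.prod_mul_distrib, Finset.prod_const, ← Real.exp_sum]
  simp only [NNReal.coe_one, mul_one, sub_zero, Finset.card_univ]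
  congr 2
  rw [← Finset.sum_div, Finset.sum_neg_distrib]
  simp only [dotProduct, pow_two]

/-- second moments -/
lemma gauss_mom {ι : Type*} [Fintype ι] (c c' : ι → ℝ) :
    Integrable (fun g : ι → ℝ => (g ⬝ᵥ c) * (g ⬝ᵥ c')) (Measure.pi fun _ => gaussianReal 0 1) ∧
    ∫ g : ι → ℝ, (g ⬝ᵥ c) * (g ⬝ᵥ c') ∂(Measure.pi fun _ => gaussianReal 0 1) = c ⬝ᵥ c' := by
  classical
  set μ := (Measure.pi fun _ : ι => gaussianReal 0 1)
  have hm : ∀ i, MemLp (fun g : ι → ℝ => g i) 2 μ := fun i => by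
    have := memLp_id_gaussianReal (μ := 0) (v := 1) 2
    exact this.comp_measurePreserving (measurePreserving_eval (fun _ : ι => gaussianReal 0 1) i)
  have hI : ∀ i j, Integrable (fun g : ι → ℝ => g i * g j) μ := fun i j =>
    (hm i).integrable_mul (hm j)
  have hE : ∀ i j, ∫ g : ι → ℝ, g i * g j ∂μ = if i = j then 1 else 0 := by
    intro i j
    have hmean : ∀ i, ∫ g : ι → ℝ, g i ∂μ = 0 := fun i => by
      have := integral_eval (μ := fun _ : ι => gaussianReal 0 1) (i := i)
      rw [this]; exact integral_id_gaussianReal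
    split_ifs with h
    · subst h
      have hv : ∫ x, x * x ∂(gaussianReal 0 1) = 1 := by
        have h1 := variance_id_gaussianReal (μ := 0) (v := 1)
        rw [variance_eq_sub (memLp_id_gaussianReal 2)] at h1
        simp only [id, integral_id_gaussianReal] at h1
        simpa [pow_two] using h1
      have := integral_comp_eval (μ := fun _ : ι => gaussianReal 0 1) (i := i)
        (f := fun x : ℝ => x * x) (by fun_prop)
      rw [← hv, ← this]
    · have hind : iIndepFun (fun i (g : ι → ℝ) => g i) μ :=
        iIndepFun_pi (μ := fun _ : ι => gaussianReal 0 1) (X := fun _ x => x) (fun _ => aemeasurable_id)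
      have := (hind.indepFun h).integral_fun_mul_eq_mul_integral
        (hm i).aestronglyMeasurable (hm j).aestronglyMeasurable
      rw [this, hmean, zero_mul]
  have hexp : (fun g : ι → ℝ => (g ⬝ᵥ c) * (g ⬝ᵥ c')) =
      fun g => ∑ i, ∑ j, (c i * c' j) * (g i * g j) := by
    funext g
    simp only [dotProduct, Finset.sum_mul_sum]
    refine Finset.sum_congr rfl fun i _ => Finset.sum_congr rfl fun j _ => by ring
  rw [hexp]
  constructor
  · exact integrable_finset_sum _ fun i _ => integrable_finset_sum _ fun j _ => (hI i j).const_mul _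
  · rw [integral_finset_sum _ fun i _ => integrable_finset_sum _ fun j _ => (hI i j).const_mul _]
    simp_rw [dotProduct]
    refine Finset.sum_congr rfl fun i _ => ?_
    rw [integral_finset_sum _ fun j _ => (hI i j).const_mul _]
    simp_rw [integral_const_mul, hE]
    simp

lemma gauss_block {κ : Type*} [Fintype κ] {X : κ → Type*} [∀ k, Fintype (X k)]
    (f : ∀ k, (X k → ℝ) → ℝ)
    (hf : ∀ k, Integrable (f k) (Measure.pi fun _ : X k => gaussianReal 0 1)) :
    Integrable (fun g : (Σ k, X k) → ℝ => ∏ k, f k (fun x => g ⟨k, x⟩))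
      (Measure.pi fun _ => gaussianReal 0 1) ∧
    ∫ g : (Σ k, X k) → ℝ, ∏ k, f k (fun x => g ⟨k, x⟩) ∂(Measure.pi fun _ => gaussianReal 0 1)
      = ∏ k, ∫ h, f k h ∂(Measure.pi fun _ : X k => gaussianReal 0 1) := by
  have hmp : MeasurePreserving (MeasurableEquiv.piCurry (fun (k : κ) (_ : X k) => ℝ))
      (Measure.pi fun _ : (Σ k, X k) => gaussianReal 0 1)
      (Measure.pi fun k => Measure.pi fun _ : X k => gaussianReal 0 1) := by
    refine ⟨MeasurableEquiv.measurable _, ?_⟩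
    have := Measure.infinitePi_map_piCurry (fun (k : κ) (_ : X k) => gaussianReal 0 1)
    simpa only [Measure.infinitePi_eq_pi] using this
  have hI : Integrable (fun g : (∀ k, X k → ℝ) => ∏ k, f k (g k))
      (Measure.pi fun k => Measure.pi fun _ : X k => gaussianReal 0 1) :=
    Integrable.fintype_prod_dep hf
  constructor
  · exact hmp.integrable_comp_of_integrable hI
  · rw [← integral_fintype_prod_eq_prod]
    exact hmp.integral_comp' (g := fun g : (∀ k, X k → ℝ) => ∏ k, f k (g k))

lemma gauss_det_sq {N : ℕ} {X : Fin N → Type*} [∀ k, Fintype (X k)]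
    (c : Fin N → Fin N → (Σ k, X k) → ℝ) (v : Fin N → Fin N → ℝ)
    (hsupp : ∀ k i q, q.1 ≠ k → c k i q = 0)
    (hcov : ∀ k i j, c k i ⬝ᵥ c k j = if i = j then v k i else 0) :
    ∫⁻ g : (Σ k, X k) → ℝ, ENNReal.ofReal ((Matrix.of fun k i => g ⬝ᵥ c k i).det ^ 2)
      ∂(Measure.pi fun _ => gaussianReal 0 1) =
      ENNReal.ofReal (∑ σ : Equiv.Perm (Fin N), ∏ k, v k (σ k)) := by
  classical
  have hdot : ∀ (g : (Σ k, X k) → ℝ) k i, g ⬝ᵥ c k i =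
      (fun x => g ⟨k, x⟩) ⬝ᵥ (fun x => c k i ⟨k, x⟩) := by
    intro g k i
    simp only [dotProduct]
    rw [Fintype.sum_sigma]
    rw [Finset.sum_eq_single k]
    · intro b _ hb
      exact Finset.sum_eq_zero fun x _ => by rw [hsupp k i ⟨b, x⟩ hb, mul_zero]
    · simp
  have hterm : ∀ σ τ : Equiv.Perm (Fin N),
      Integrable (fun g : (Σ k, X k) → ℝ => ∏ k, ((g ⬝ᵥ c k (σ k)) * (g ⬝ᵥ c k (τ k))))
        (Measure.pi fun _ => gaussianReal 0 1) ∧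
      ∫ g : (Σ k, X k) → ℝ, ∏ k, ((g ⬝ᵥ c k (σ k)) * (g ⬝ᵥ c k (τ k)))
        ∂(Measure.pi fun _ => gaussianReal 0 1) = if σ = τ then ∏ k, v k (σ k) else 0 := by
    intro σ τ
    simp_rw [hdot]
    have hb := gauss_block (X := X) (fun k h => (h ⬝ᵥ (fun x => c k (σ k) ⟨k, x⟩)) *
      (h ⬝ᵥ (fun x => c k (τ k) ⟨k, x⟩))) (fun k => (gauss_mom _ _).1)
    refine ⟨hb.1, ?_⟩
    rw [hb.2]
    have : ∀ k, ∫ h, (h ⬝ᵥ (fun x => c k (σ k) ⟨k, x⟩)) *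
      (h ⬝ᵥ (fun x => c k (τ k) ⟨k, x⟩)) ∂(Measure.pi fun _ : X k => gaussianReal 0 1)
        = if σ k = τ k then v k (σ k) else 0 := by
      intro k
      rw [(gauss_mom _ _).2, ← hcov, hdot]
    simp_rw [this]
    split_ifs with h
    · subst h; simp
    · have : ∃ k, σ k ≠ τ k := by
        by_contra! hh; exact h (Equiv.ext hh)
      obtain ⟨k, hk⟩ := this
      exact Finset.prod_eq_zero (Finset.mem_univ k) (if_neg hk)
  have hexp : (fun g : (Σ k, X k) → ℝ => (Matrix.of fun k i => g ⬝ᵥ c k i).det ^ 2) =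
      fun g => ∑ σ : Equiv.Perm (Fin N), ∑ τ : Equiv.Perm (Fin N),
        (((Equiv.Perm.sign σ : ℤ) : ℝ) * ((Equiv.Perm.sign τ : ℤ) : ℝ)) *
          ∏ k, ((g ⬝ᵥ c k (σ k)) * (g ⬝ᵥ c k (τ k))) := by
    funext g
    rw [← Matrix.det_transpose, Matrix.det_apply', pow_two, Finset.sum_mul_sum]
    refine Finset.sum_congr rfl fun σ _ => Finset.sum_congr rfl fun τ _ => ?_
    simp only [Matrix.transpose_apply, Matrix.of_apply, Finset.prod_mul_distrib]
    ring
  have hI : Integrable (fun g : (Σ k, X k) → ℝ => (Matrix.of fun k i => g ⬝ᵥ c k i).det ^ 2)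
      (Measure.pi fun _ => gaussianReal 0 1) := by
    rw [hexp]
    exact integrable_finset_sum _ fun σ _ => integrable_finset_sum _ fun τ _ =>
      (hterm σ τ).1.const_mul _
  rw [← ofReal_integral_eq_lintegral_ofReal hI (Filter.Eventually.of_forall fun g => sq_nonneg _)]
  congr 1
  rw [hexp, integral_finset_sum _ fun σ _ => integrable_finset_sum _ fun τ _ =>
      (hterm σ τ).1.const_mul _]
  refine Finset.sum_congr rfl fun σ _ => ?_
  rw [integral_finset_sum _ fun τ _ => (hterm σ τ).1.const_mul _]
  simp_rw [integral_const_mul, (hterm σ _).2]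
  simp only [mul_ite, mul_zero, Finset.sum_ite_eq, Finset.mem_univ, if_true]
  have : ((Equiv.Perm.sign σ : ℤ) : ℝ) * ((Equiv.Perm.sign σ : ℤ) : ℝ) = 1 := by
    rw [← Int.cast_mul, ← Units.val_mul, Int.units_mul_self]; simp
  rw [this, one_mul]

/-- permutation sum -/
lemma perm_sum {N : ℕ} (hN : 1 ≤ N) (i0 : Fin N) (x q : Fin N → ℝ) (hx : ∀ k, 0 < x k) :
    ∑ σ : Equiv.Perm (Fin N), ∏ k, (if σ k = i0 then q k else x k) =
      ((N - 1).factorial : ℝ) * ((∑ k, q k / x k) * ∏ k, x k) := by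
  classical
  have h1 : ∀ σ : Equiv.Perm (Fin N), ∏ k, (if σ k = i0 then q k else x k) =
      q (σ.symm i0) / x (σ.symm i0) * ∏ k, x k := by
    intro σ
    rw [← Finset.mul_prod_erase Finset.univ _ (Finset.mem_univ (σ.symm i0)),
      ← Finset.mul_prod_erase Finset.univ x (Finset.mem_univ (σ.symm i0))]
    rw [Finset.prod_congr rfl (g := x)]
    · have := (hx (σ.symm i0)).ne'
      simp only [Equiv.apply_symm_apply, if_true]
      field_simp
    · intro k hk
      have hk' := Finset.ne_of_mem_erase hk
      rw [if_neg]
      intro h; exact hk' (by rw [← h]; simp)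
  simp_rw [h1]
  rw [← Finset.sum_mul, ← mul_assoc]
  congr 1
  have h2 : ∑ σ : Equiv.Perm (Fin N), q (σ.symm i0) / x (σ.symm i0)
      = ∑ σ : Equiv.Perm (Fin N), q (σ i0) / x (σ i0) :=
    Equiv.sum_comp (Equiv.inv (Equiv.Perm (Fin N))) (fun σ => q (σ i0) / x (σ i0))
  rw [h2]
  obtain ⟨n, rfl⟩ : ∃ n, N = n + 1 := ⟨N - 1, by omega⟩
  set f : Fin (n+1) → ℝ := fun k => q k / x k with hf
  have h3 : ∀ j, ∑ σ : Equiv.Perm (Fin (n+1)), f (σ j) = ∑ σ : Equiv.Perm (Fin (n+1)), f (σ i0) := by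
    intro j
    rw [← Equiv.sum_comp (Equiv.mulRight (Equiv.swap i0 j)) (fun σ : Equiv.Perm (Fin (n+1)) => f (σ j))]
    simp
  have h4 : ((n : ℝ) + 1) * ∑ σ : Equiv.Perm (Fin (n+1)), f (σ i0) =
      ((n : ℝ) + 1) * (n.factorial * ∑ k, f k) := by
    have h5 : ∑ j, ∑ σ : Equiv.Perm (Fin (n+1)), f (σ j) =
        ((n : ℝ) + 1) * ∑ σ : Equiv.Perm (Fin (n+1)), f (σ i0) := by
      simp_rw [h3]; simp
    rw [← h5, Finset.sum_comm]
    simp_rw [fun σ : Equiv.Perm (Fin (n+1)) => Equiv.sum_comp σ f]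
    simp [Fintype.card_perm, Nat.factorial_succ]
    ring
  have := mul_left_cancel₀ (by positivity) h4
  simpa [hf] using this
end

section
open scoped Matrix
set_option linter.all false

/-- Feature vector of the field. -/
def Fv (N : ℕ) (d : Fin N → ℕ) (a : Fin N → ℕ → ℝ) (k : Fin N) (x : Fin (N + 1) → ℝ) :
    GIdx N N d → ℝ :=
  fun q => if q.1 = k then a q.1 (q.2.1.1 : ℕ) * ∏ j, x (q.2.2 j) else 0

variable {N : ℕ} {d : Fin N → ℕ} {a : Fin N → ℕ → ℝ}

lemma rf_eq_dot (k : Fin N) (g : GIdx N N d → ℝ) (x : Fin (N + 1) → ℝ) :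
    rf N N d a k g x = g ⬝ᵥ Fv N d a k x := by
  unfold rf Fv dotProduct
  rw [Fintype.sum_sigma, Finset.sum_eq_single k]
  · rw [Fintype.sum_sigma]
    refine Finset.sum_congr rfl fun p _ => ?_
    rw [Finset.mul_sum]
    refine Finset.sum_congr rfl fun i _ => ?_
    simp; ring
  · intro b _ hb
    exact Finset.sum_eq_zero fun x _ => by simp [hb]
  · simp

lemma sum_Icc_sub (d : ℕ) (f : ℕ → ℝ) :
    ∑ p : {p : Fin (d + 1) // 2 ≤ (p : ℕ)}, f (p.1 : ℕ) = ∑ p ∈ Finset.Icc 2 d, f p := by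
  refine Finset.sum_bij (fun p _ => (p.1 : ℕ)) ?_ ?_ ?_ ?_
  · intro p _
    rw [Finset.mem_Icc]
    exact ⟨p.2, Nat.lt_succ_iff.1 p.1.2⟩
  · intro p _ q _ h
    exact Subtype.ext (Fin.ext h)
  · intro b hb
    rw [Finset.mem_Icc] at hb
    exact ⟨⟨⟨b, by omega⟩, hb.1⟩, Finset.mem_univ _, rfl⟩
  · intros; rfl

lemma Fv_dot (k l : Fin N) (x y : Fin (N + 1) → ℝ) :
    Fv N d a k x ⬝ᵥ Fv N d a l y = if k = l then xi (d k) (a k) (x ⬝ᵥ y) else 0 := by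
  split_ifs with h
  · subst h
    unfold Fv dotProduct
    rw [Fintype.sum_sigma, Finset.sum_eq_single k]
    · rw [Fintype.sum_sigma]
      unfold xi
      rw [← sum_Icc_sub]
      refine Finset.sum_congr rfl fun p _ => ?_
      rw [← Fin.prod_const (p.1 : ℕ) (∑ i, x i * y i), Finset.prod_univ_sum]
      rw [Finset.mul_sum]
      simp only [Fintype.piFinset_univ]
      refine Finset.sum_congr rfl fun i _ => ?_
      simp only [if_true, Finset.prod_mul_distrib]
      ring
    · intro b _ hb
      exact Finset.sum_eq_zero fun x _ => by simp [hb]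
    · simp
  · unfold Fv dotProduct
    refine Finset.sum_eq_zero fun q _ => ?_
    dsimp only
    by_cases h1 : q.1 = k
    · rw [if_neg (fun h2 => h (h1.symm.trans h2)), mul_zero]
    · rw [if_neg h1, zero_mul]

lemma contDiff_Fv (k : Fin N) : ContDiff ℝ 2 (Fv N d a k) := by
  rw [contDiff_pi]
  intro q
  unfold Fv
  split_ifs
  · refine contDiff_const.mul (contDiff_prod fun j _ => ?_)
    exact contDiff_apply ℝ ℝ _
  · exact contDiff_const

lemma diff_Fv (k : Fin N) (x) : DifferentiableAt ℝ (Fv N d a k) x :=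
  (contDiff_Fv k).differentiable (by norm_num) x

/-- second derivative of xi -/
lemma contDiff_xi (d : ℕ) (a : ℕ → ℝ) : ContDiff ℝ 2 (xi d a) := by
  unfold xi
  fun_prop

lemma xi_hasDerivAt (d : ℕ) (a : ℕ → ℝ) (t : ℝ) : HasDerivAt (xi d a) (xi' d a t) t :=
  ((contDiff_xi d a).differentiable (by norm_num) t).hasDerivAt

lemma xi'_hasDerivAt (d : ℕ) (a : ℕ → ℝ) (t : ℝ) :
    HasDerivAt (xi' d a) (deriv (xi' d a) t) t := by
  have : ContDiff ℝ 1 (xi' d a) := by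
    have h := contDiff_xi d a
    have h2 : ContDiff ℝ (1+1) (xi d a) := by simpa [one_add_one_eq_two] using h
    exact (contDiff_succ_iff_deriv.1 h2).2.2
  exact (this.differentiable (by norm_num) t).hasDerivAt

lemma HasFDerivAt.dotP {E ι : Type*} [Fintype ι] [NormedAddCommGroup E] [NormedSpace ℝ E]
    {f g : E → ι → ℝ} {f' g' : E →L[ℝ] (ι → ℝ)} {x : E} (hf : HasFDerivAt f f' x)
    (hg : HasFDerivAt g g' x) :
    ∃ D : E →L[ℝ] ℝ, HasFDerivAt (fun x => f x ⬝ᵥ g x) D x ∧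
      ∀ v, D v = f' v ⬝ᵥ g x + f x ⬝ᵥ g' v := by
  have h := HasFDerivAt.fun_sum (u := Finset.univ) (A := fun i x => f x i * g x i)
    (fun i _ => ((hasFDerivAt_pi'.1 hf) i).mul ((hasFDerivAt_pi'.1 hg) i))
  refine ⟨_, h, fun v => ?_⟩
  simp [dotProduct, Finset.sum_add_distrib, mul_comm]
  rw [add_comm]

lemma DF_dot (k l : Fin N) (x y v : Fin (N + 1) → ℝ) :
    fderiv ℝ (Fv N d a k) x v ⬝ᵥ Fv N d a l y =
      if k = l then xi' (d k) (a k) (x ⬝ᵥ y) * (v ⬝ᵥ y) else 0 := by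
  obtain ⟨D, hD, hDv⟩ := ((diff_Fv (d := d) (a := a) k x).hasFDerivAt).dotP
    (hasFDerivAt_const (Fv N d a l y) x)
  simp_rw [Fv_dot] at hD
  have h0 := hDv v
  simp only [ContinuousLinearMap.zero_apply, dotProduct_zero, add_zero] at h0
  rw [← h0]
  split_ifs with h
  · obtain ⟨E, hE, hEv⟩ := (hasFDerivAt_id (𝕜 := ℝ) x).dotP (hasFDerivAt_const y x)
    simp only [if_pos h] at hD
    have h2 := (xi_hasDerivAt (d k) (a k) (x ⬝ᵥ y)).comp_hasFDerivAt x hE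
    rw [hD.unique h2]
    simp [hEv]
  · simp only [if_neg h] at hD
    rw [hD.unique (hasFDerivAt_const _ _)]; rfl

lemma DF_DF_dot (k l : Fin N) (x y v w : Fin (N + 1) → ℝ) :
    fderiv ℝ (Fv N d a k) x v ⬝ᵥ fderiv ℝ (Fv N d a l) y w =
      if k = l then deriv (xi' (d k) (a k)) (x ⬝ᵥ y) * (x ⬝ᵥ w) * (v ⬝ᵥ y)
        + xi' (d k) (a k) (x ⬝ᵥ y) * (v ⬝ᵥ w) else 0 := by
  obtain ⟨D, hD, hDv⟩ := (hasFDerivAt_const (fderiv ℝ (Fv N d a k) x v) y).dotP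
    ((diff_Fv (d := d) (a := a) l y).hasFDerivAt)
  simp_rw [DF_dot] at hD
  have h0 := hDv w
  simp only [ContinuousLinearMap.zero_apply, zero_dotProduct, zero_add] at h0
  rw [← h0]
  split_ifs with h
  · obtain ⟨E, hE, hEv⟩ := (hasFDerivAt_const x y).dotP (hasFDerivAt_id (𝕜 := ℝ) y)
    obtain ⟨E2, hE2, hEv2⟩ := (hasFDerivAt_const v y).dotP (hasFDerivAt_id (𝕜 := ℝ) y)
    simp only [if_pos h] at hD
    have h2 := ((xi'_hasDerivAt (d k) (a k) (x ⬝ᵥ y)).comp_hasFDerivAt y hE).mul hE2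
    rw [hD.unique h2]
    simp [hEv, hEv2]; ring
  · simp only [if_neg h] at hD
    rw [hD.unique (hasFDerivAt_const _ _)]; rfl

lemma DF_supp (k : Fin N) (x v : Fin (N + 1) → ℝ) (q : GIdx N N d) (hq : q.1 ≠ k) :
    fderiv ℝ (Fv N d a k) x v q = 0 := by
  have h := (hasFDerivAt_pi'.1 (diff_Fv (d := d) (a := a) k x).hasFDerivAt) q
  have h2 : (fun x => Fv N d a k x q) = fun _ => 0 := by
    funext x; simp [Fv, hq]
  rw [h2] at h
  have := h.unique (hasFDerivAt_const _ _)
  exact congrArg (fun D : _ →L[ℝ] ℝ => D v) this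

/-- Euclidean length. -/
def nrm {n : ℕ} (x : Fin n → ℝ) : ℝ := Real.sqrt (x ⬝ᵥ x)
/-- Normalisation. -/
def hat {n : ℕ} (x : Fin n → ℝ) : Fin n → ℝ := (nrm x)⁻¹ • x

lemma dot_self_pos {n : ℕ} {x : Fin n → ℝ} (hx : x ≠ 0) : 0 < x ⬝ᵥ x := by
  have h0 : 0 ≤ x ⬝ᵥ x := Finset.sum_nonneg fun i _ => mul_self_nonneg _
  exact lt_of_le_of_ne h0 fun h => hx (dotProduct_self_eq_zero.1 h.symm)

lemma dot_self_nonneg {n : ℕ} (x : Fin n → ℝ) : 0 ≤ x ⬝ᵥ x := 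
  Finset.sum_nonneg fun i _ => mul_self_nonneg _

lemma nrm_pos {n : ℕ} {x : Fin n → ℝ} (hx : x ≠ 0) : 0 < nrm x := Real.sqrt_pos.2 (dot_self_pos hx)

lemma nrm_sq {n : ℕ} (x : Fin n → ℝ) : nrm x ^ 2 = x ⬝ᵥ x := Real.sq_sqrt (dot_self_nonneg x)

lemma hat_dot {n : ℕ} {x : Fin n → ℝ} (hx : x ≠ 0) : hat x ⬝ᵥ hat x = 1 := by
  unfold hat
  rw [smul_dotProduct, dotProduct_smul, ← nrm_sq]
  have := (nrm_pos hx).ne'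
  simp only [smul_eq_mul]; field_simp

lemma measurable_nrm {n : ℕ} : Measurable (nrm : (Fin n → ℝ) → ℝ) := by
  unfold nrm dotProduct; fun_prop

lemma measurable_hat {n : ℕ} : Measurable (hat : (Fin n → ℝ) → (Fin n → ℝ)) := by
  unfold hat
  exact (measurable_nrm.inv).smul measurable_id

lemma hat_deriv {n : ℕ} {x : Fin n → ℝ} (hx : x ≠ 0) :
    ∃ D : (Fin n → ℝ) →L[ℝ] (Fin n → ℝ), HasFDerivAt hat D x ∧
      ∀ v, D v = (nrm x)⁻¹ • (v - (hat x ⬝ᵥ v) • hat x) := by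
  obtain ⟨E, hE, hEv⟩ := (hasFDerivAt_id (𝕜 := ℝ) x).dotP (hasFDerivAt_id (𝕜 := ℝ) x)
  have h1 := (hE.sqrt (dot_self_pos hx).ne')
  have h2 := (hasDerivAt_inv (nrm_pos hx).ne').comp_hasFDerivAt x h1
  have h3 := h2.smul (hasFDerivAt_id (𝕜 := ℝ) x)
  refine ⟨_, h3, fun v => ?_⟩
  have hp := (nrm_pos hx).ne'
  ext i
  simp [hEv, hat, Function.comp]
  rw [show √(x ⬝ᵥ x) = nrm x from rfl]
  rw [dotProduct_comm v x]
  field_simp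
  ring

/-- the normalised field -/
def Gv (N : ℕ) (d : Fin N → ℕ) (a : Fin N → ℕ → ℝ) (k : Fin N) (x : Fin (N + 1) → ℝ) :
    GIdx N N d → ℝ := Fv N d a k (hat x)

lemma diff_hat {n : ℕ} {x : Fin n → ℝ} (hx : x ≠ 0) : DifferentiableAt ℝ hat x := by
  obtain ⟨D, hD, _⟩ := hat_deriv hx
  exact hD.differentiableAt

lemma diff_Gv (k : Fin N) {x : Fin (N + 1) → ℝ} (hx : x ≠ 0) :
    DifferentiableAt ℝ (Gv N d a k) x := 
  (diff_Fv k (hat x)).comp x (diff_hat hx)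

lemma fderiv_Gv (k : Fin N) {x : Fin (N + 1) → ℝ} (hx : x ≠ 0) (v) :
    fderiv ℝ (Gv N d a k) x v = (nrm x)⁻¹ • 
      fderiv ℝ (Fv N d a k) (hat x) (v - (hat x ⬝ᵥ v) • hat x) := by
  obtain ⟨D, hD, hDv⟩ := hat_deriv hx
  have := ((diff_Fv (d := d) (a := a) k (hat x)).hasFDerivAt).comp x hD
  have h2 : fderiv ℝ (Gv N d a k) x = _ := this.fderiv
  rw [h2]
  simp [hDv]

lemma measurable_Gv (k : Fin N) : Measurable (Gv N d a k) :=
  (contDiff_Fv k).continuous.measurable.comp measurable_hat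
end

section
open scoped Matrix
set_option linter.all false

lemma basis_exists {N : ℕ} (hN : 1 ≤ N) (x y : Fin (N + 1) → ℝ) (hx : x ⬝ᵥ x = 1)
    (hy : y ⬝ᵥ y = 1) (hr : (x ⬝ᵥ y) ^ 2 < 1) :
    ∃ b : Fin (N + 1) → Fin (N + 1) → ℝ, (∀ i j, b i ⬝ᵥ b j = if i = j then 1 else 0) ∧
      b 0 = x ∧ (∀ j : Fin N, (b j.succ ⬝ᵥ y) ^ 2 = if j = ⟨0, hN⟩ then 1 - (x ⬝ᵥ y) ^ 2 else 0) := by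
  classical
  set r := x ⬝ᵥ y with hrdef
  set s := Real.sqrt (1 - r ^ 2) with hs
  have hs0 : 0 < s := Real.sqrt_pos.2 (by linarith)
  have hs2 : s ^ 2 = 1 - r ^ 2 := Real.sq_sqrt (by linarith)
  set y1 : Fin (N + 1) → ℝ := s⁻¹ • (y - r • x) with hy1
  set i1 : Fin (N + 1) := (⟨0, hN⟩ : Fin N).succ with hi1
  have hi10 : i1 ≠ 0 := Fin.succ_ne_zero _
  have hxy1 : x ⬝ᵥ y1 = 0 := by
    rw [hy1, dotProduct_smul, dotProduct_sub, dotProduct_smul, hx, ← hrdef]; simp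
  have hyy1 : y1 ⬝ᵥ y1 = 1 := by
    have : y1 ⬝ᵥ y1 = s⁻¹ * (s⁻¹ * (1 - r ^ 2)) := by
      rw [hy1]
      simp only [dotProduct_smul, smul_dotProduct, dotProduct_sub, sub_dotProduct, hx, hy,
        ← hrdef, dotProduct_comm y x, smul_eq_mul]
      ring
    rw [this, ← hs2]; field_simp
  have hyx : y = r • x + s • y1 := by
    rw [hy1, smul_smul, mul_inv_cancel₀ hs0.ne']; simp
  set v : Fin (N + 1) → EuclideanSpace ℝ (Fin (N + 1)) :=
    fun i => if i = 0 then WithLp.toLp 2 x else WithLp.toLp 2 y1 with hv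
  have hinner : ∀ u w : EuclideanSpace ℝ (Fin (N + 1)), inner ℝ u w = u.ofLp ⬝ᵥ w.ofLp := by
    intro u w
    rw [EuclideanSpace.inner_eq_star_dotProduct, dotProduct_comm]; simp
  have hon : Orthonormal ℝ (({0, i1} : Set (Fin (N + 1))).restrict v) := by
    rw [orthonormal_iff_ite]
    rintro ⟨i, hi⟩ ⟨j, hj⟩
    simp only [Set.mem_insert_iff, Set.mem_singleton_iff] at hi hj
    change inner ℝ (v i) (v j) = _
    rw [hinner]
    simp only [Subtype.mk.injEq]
    rcases hi with h | h <;> rcases hj with h' | h' <;> rw [h, h'] <;>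
      simp [hv, hx, hyy1, hxy1, dotProduct_comm y1 x, hi10, hi10.symm]
  obtain ⟨b, hb⟩ := hon.exists_orthonormalBasis_extension_of_card_eq (by simp)
  have hb0 : b 0 = WithLp.toLp 2 x := by rw [hb 0 (by simp)]; simp [hv]
  have hb1 : b i1 = WithLp.toLp 2 y1 := by rw [hb i1 (by simp)]; simp [hv, hi10]
  have hbo : ∀ i j, (b i).ofLp ⬝ᵥ (b j).ofLp = if i = j then 1 else 0 := fun i j => by
    rw [← hinner]; exact orthonormal_iff_ite.1 b.orthonormal i j
  refine ⟨fun i => (b i).ofLp, hbo, by simp only [hb0], fun j => ?_⟩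
  have hx' : x = (b 0).ofLp := by rw [hb0]
  have hy' : y1 = (b i1).ofLp := by rw [hb1]
  dsimp only
  conv_lhs => rw [hyx, hx', hy']
  rw [dotProduct_add, dotProduct_smul, dotProduct_smul, hbo, hbo, if_neg (Fin.succ_ne_zero _)]
  by_cases h : j = ⟨0, hN⟩
  · rw [if_pos h, if_pos (by rw [h])]; simp [hs2]
  · rw [if_neg h, if_neg (by rw [hi1]; exact fun h2 => h (Fin.succ_injective _ h2))]; simp

/-- variance ratio in the special direction -/
def lam (d : ℕ) (a : ℕ → ℝ) (r : ℝ) : ℝ :=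
  1 - xi' d a r ^ 2 * (1 - r ^ 2) * xi d a 1 / ((xi d a 1 ^ 2 - xi d a r ^ 2) * xi' d a 1)

variable {N : ℕ} {d : Fin N → ℕ} {a : Fin N → ℕ → ℝ}

lemma secmom (hN : 1 ≤ N) (x y : Fin (N + 1) → ℝ) (hx : x ⬝ᵥ x = 1)
    (hy : y ⬝ᵥ y = 1) (hr : (x ⬝ᵥ y) ^ 2 < 1) (h1 : ∀ k, 0 < xi' (d k) (a k) 1)
    (P : (GIdx N N d → ℝ) → (GIdx N N d → ℝ))
    (hPs : ∀ k u, (∀ q : GIdx N N d, q.1 ≠ k → u q = 0) → ∀ q : GIdx N N d, q.1 ≠ k → P u q = 0)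
    (hP : ∀ k u u', (∀ q : GIdx N N d, q.1 ≠ k → u q = 0) →
      (∀ q : GIdx N N d, q.1 ≠ k → u' q = 0) → P u ⬝ᵥ P u' = u ⬝ᵥ u' -
        (xi (d k) (a k) 1 * ((u ⬝ᵥ Fv N d a k x) * (u' ⬝ᵥ Fv N d a k x) +
            (u ⬝ᵥ Fv N d a k y) * (u' ⬝ᵥ Fv N d a k y)) -
          xi (d k) (a k) (x ⬝ᵥ y) * ((u ⬝ᵥ Fv N d a k x) * (u' ⬝ᵥ Fv N d a k y) +
            (u ⬝ᵥ Fv N d a k y) * (u' ⬝ᵥ Fv N d a k x))) /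
          (xi (d k) (a k) 1 ^ 2 - xi (d k) (a k) (x ⬝ᵥ y) ^ 2)) :
    ∃ b : Fin (N + 1) → Fin (N + 1) → ℝ, (∀ i j, b i ⬝ᵥ b j = if i = j then 1 else 0) ∧
      b 0 = x ∧
      ∫⁻ g, ENNReal.ofReal ((Matrix.of fun k (i : Fin N) =>
          g ⬝ᵥ P (fderiv ℝ (Fv N d a k) x (b i.succ))).det ^ 2) ∂(GaussP N N d) =
        ENNReal.ofReal (((N - 1).factorial : ℝ) *
          ((∑ k, lam (d k) (a k) (x ⬝ᵥ y)) * ∏ k, xi' (d k) (a k) 1)) := by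
  obtain ⟨b, hb, hb0, hby⟩ := basis_exists hN x y hx hy hr
  refine ⟨b, hb, hb0, ?_⟩
  set i0 : Fin N := ⟨0, hN⟩
  rw [gauss_det_sq (X := fun k => (p : {p : Fin (d k + 1) // 2 ≤ (p : ℕ)}) × (Fin (p.1 : ℕ) → Fin (N + 1)))
    (fun k i => P (fderiv ℝ (Fv N d a k) x (b i.succ)))
    (fun k i => if i = i0 then lam (d k) (a k) (x ⬝ᵥ y) * xi' (d k) (a k) 1 else xi' (d k) (a k) 1)]
  · congr 1
    rw [perm_sum hN i0 (fun k => xi' (d k) (a k) 1) _ h1]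
    congr 2
    refine Finset.sum_congr rfl fun k _ => ?_
    rw [mul_div_cancel_right₀ _ (h1 k).ne']
  · intro k i q hq
    exact hPs k _ (fun q hq => DF_supp k x _ q hq) q hq
  · intro k i j
    rw [hP k _ _ (fun q hq => DF_supp k x _ q hq) (fun q hq => DF_supp k x _ q hq)]
    have hbx : ∀ i : Fin N, b i.succ ⬝ᵥ x = 0 := fun i => by
      rw [← hb0, hb, if_neg (Fin.succ_ne_zero _)]
    simp only [DF_DF_dot, DF_dot, if_true, hbx, hb, hx, mul_zero, zero_mul, zero_add, add_zero,
      sub_zero]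
    have hsj : (i.succ = j.succ) ↔ i = j := (Fin.succ_injective _).eq_iff
    simp only [hsj]
    by_cases hij : i = j
    · subst hij
      simp only [if_true]
      have := hby i
      by_cases hi : i = i0
      · rw [if_pos hi] at this
        rw [if_pos hi]
        have h2 := (h1 k).ne'
        unfold lam
        rw [show ∀ A B C : ℝ, A * (B * C * (B * C)) = A * (B ^ 2 * C ^ 2) by intros; ring, this]
        rw [sub_mul, div_mul_eq_mul_div, mul_div_mul_right _ _ h2]
        ring
      · rw [if_neg hi] at this
        rw [if_neg hi]
        have h3 : b i.succ ⬝ᵥ y = 0 := by simpa using this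
        rw [h3]; simp
    · rw [if_neg hij, if_neg hij]
      have h3 : b i.succ ⬝ᵥ y = 0 ∨ b j.succ ⬝ᵥ y = 0 := by
        by_cases hi : i = i0
        · right
          have := hby j
          rw [if_neg (fun h => hij (hi.trans h.symm))] at this
          simpa using this
        · left
          have := hby i
          rw [if_neg hi] at this
          simpa using this
      rcases h3 with h3 | h3 <;> rw [h3] <;> simp

lemma detA (x : Fin (N + 1) → ℝ) (hx : x ≠ 0) (w : GIdx N N d → ℝ)
    (b : Fin (N + 1) → Fin (N + 1) → ℝ) (hb : ∀ i j, b i ⬝ᵥ b j = if i = j then 1 else 0)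
    (hb0 : b 0 = hat x) :
    |(Matrix.of (Fin.cons x (fun k i => w ⬝ᵥ fderiv ℝ (Gv N d a k) x (Pi.single i 1)) :
      Fin (N + 1) → Fin (N + 1) → ℝ)).det| =
    nrm x * ((nrm x)⁻¹ ^ N * |(Matrix.of fun k (i : Fin N) =>
          w ⬝ᵥ (fderiv ℝ (Fv N d a k) (hat x) (b i.succ))).det|) := by
  set A := (Matrix.of (Fin.cons x (fun k i => w ⬝ᵥ fderiv ℝ (Gv N d a k) x (Pi.single i 1)) :
      Fin (N + 1) → Fin (N + 1) → ℝ)) with hA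
  have hp := nrm_pos hx
  set B : Matrix (Fin (N + 1)) (Fin (N + 1)) ℝ := Matrix.of b with hB
  have hBB : B * Bᵀ = 1 := by
    ext i j
    rw [Matrix.mul_apply, Matrix.one_apply, ← hb i j]; rfl
  have hdB : |Bᵀ.det| = 1 := by
    have h := congrArg Matrix.det hBB
    rw [Matrix.det_mul, Matrix.det_one, Matrix.det_transpose] at h
    rw [Matrix.det_transpose]
    have : |B.det| * |B.det| = 1 := by rw [← abs_mul, h, abs_one]
    nlinarith [abs_nonneg B.det]
  have h1 : |A.det| = |(A * Bᵀ).det| := by rw [Matrix.det_mul, abs_mul, hdB, mul_one]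
  have hlin : ∀ k (v : Fin (N + 1) → ℝ), ∑ i, (w ⬝ᵥ fderiv ℝ (Gv N d a k) x (Pi.single i 1)) * v i
      = w ⬝ᵥ fderiv ℝ (Gv N d a k) x v := by
    intro k v
    have hv : v = ∑ i, v i • (Pi.single i (1:ℝ) : Fin (N + 1) → ℝ) := by
      ext j; simp [Finset.sum_apply, Pi.single_apply]
    conv_rhs => rw [hv, map_sum]
    rw [dotProduct_sum]
    refine Finset.sum_congr rfl fun i _ => ?_
    rw [map_smul, dotProduct_smul, smul_eq_mul, mul_comm]
  have hx' : x = nrm x • b 0 := by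
    rw [hb0, hat, smul_smul, mul_inv_cancel₀ hp.ne', one_smul]
  have h00 : ∀ i, (A * Bᵀ) 0 i = if i = 0 then nrm x else 0 := by
    intro i
    have : (A * Bᵀ) 0 i = x ⬝ᵥ b i := by
      rw [Matrix.mul_apply]; rfl
    rw [this]
    conv_lhs => rw [hx']
    rw [smul_dotProduct, hb]
    by_cases h : i = 0
    · simp [h]
    · simp [h, Ne.symm h]
  have hk : ∀ (k i : Fin N), (A * Bᵀ) k.succ i.succ =
      (nrm x)⁻¹ * (w ⬝ᵥ (fderiv ℝ (Fv N d a k) (hat x) (b i.succ))) := by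
    intro k i
    have : (A * Bᵀ) k.succ i.succ = w ⬝ᵥ fderiv ℝ (Gv N d a k) x (b i.succ) := by
      rw [Matrix.mul_apply, ← hlin]; rfl
    rw [this, fderiv_Gv k hx, ← hb0, hb, if_neg (Fin.succ_ne_zero _).symm]
    simp
  rw [h1, Matrix.det_succ_row_zero, Fin.sum_univ_succ]
  simp only [h00, Fin.succ_ne_zero, if_true, if_false, mul_zero, zero_mul, Finset.sum_const_zero,
    add_zero, Fin.val_zero, pow_zero, one_mul]
  rw [abs_mul, abs_of_pos hp]
  congr 1
  have : ((A * Bᵀ).submatrix Fin.succ (Fin.succAbove 0)) = (nrm x)⁻¹ • (Matrix.of fun k (i : Fin N) =>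
          w ⬝ᵥ (fderiv ℝ (Fv N d a k) (hat x) (b i.succ))) := by
    ext k i
    simp [hk]
  rw [this, Matrix.det_smul, abs_mul, abs_pow, abs_of_pos (inv_pos.2 hp)]
  simp
end

section
open scoped Matrix
set_option linter.all false

lemma xi_one_pos {d : ℕ} {a : ℕ → ℝ} (ha : ∃ p ∈ Finset.Icc 2 d, a p ≠ 0) : 0 < xi d a 1 := by
  obtain ⟨p, hp, h⟩ := ha
  unfold xi
  refine Finset.sum_pos' (fun i _ => by positivity) ⟨p, hp, by positivity⟩

lemma xi'_eq (d : ℕ) (a : ℕ → ℝ) (t : ℝ) :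
    xi' d a t = ∑ p ∈ Finset.Icc 2 d, a p ^ 2 * (p * t ^ (p - 1)) := by
  have : HasDerivAt (xi d a) (∑ p ∈ Finset.Icc 2 d, a p ^ 2 * (p * t ^ (p - 1))) t := by
    unfold xi
    refine HasDerivAt.fun_sum fun p _ => ?_
    exact (hasDerivAt_pow p t).const_mul _
  exact this.deriv

lemma xi'_one_pos {d : ℕ} {a : ℕ → ℝ} (ha : ∃ p ∈ Finset.Icc 2 d, a p ≠ 0) : 0 < xi' d a 1 := by
  obtain ⟨p, hp, h⟩ := ha
  rw [xi'_eq]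
  have : 0 < (p : ℝ) := by
    have := (Finset.mem_Icc.1 hp).1
    exact_mod_cast (by omega : 0 < p)
  refine Finset.sum_pos' (fun i _ => by positivity) ⟨p, hp, by positivity⟩

lemma xi_abs_le {d : ℕ} {a : ℕ → ℝ} {r : ℝ} (hr : r ^ 2 ≤ 1) : |xi d a r| ≤ r ^ 2 * xi d a 1 := by
  unfold xi
  refine (Finset.abs_sum_le_sum_abs _ _).trans ?_
  rw [Finset.mul_sum]
  refine Finset.sum_le_sum fun p hp => ?_
  have hp2 := (Finset.mem_Icc.1 hp).1
  rw [abs_mul, abs_of_nonneg (sq_nonneg (a p)), abs_pow, one_pow, mul_one, mul_comm]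
  refine mul_le_mul_of_nonneg_right ?_ (sq_nonneg _)
  rw [← sq_abs r]
  have : |r| ≤ 1 := by
    rw [← sq_abs] at hr
    nlinarith [abs_nonneg r]
  exact pow_le_pow_of_le_one (abs_nonneg _) this hp2

lemma xi_sq_le {d : ℕ} {a : ℕ → ℝ} {r : ℝ} (hr : r ^ 2 ≤ 1) :
    xi d a 1 ^ 2 * (1 - r ^ 2) ≤ xi d a 1 ^ 2 - xi d a r ^ 2 := by
  have h := xi_abs_le (d := d) (a := a) hr
  have h2 : xi d a r ^ 2 ≤ (r ^ 2 * xi d a 1) ^ 2 := by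
    rw [← sq_abs (xi d a r)]
    exact pow_le_pow_left₀ (abs_nonneg _) h 2
  nlinarith [mul_nonneg (sq_nonneg (xi d a 1)) (mul_nonneg (sq_nonneg r) (by linarith : 0 ≤ 1 - r ^ 2))]

lemma xi_sq_lt {d : ℕ} {a : ℕ → ℝ} (ha : ∃ p ∈ Finset.Icc 2 d, a p ≠ 0) {r : ℝ} (hr : r ^ 2 < 1) :
    0 < xi d a 1 ^ 2 - xi d a r ^ 2 := by
  have := xi_sq_le (d := d) (a := a) hr.le
  have h2 : 0 < xi d a 1 ^ 2 * (1 - r ^ 2) := mul_pos (pow_pos (xi_one_pos ha) 2) (by linarith)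
  linarith

section krp
variable {ι J : Type*} [Fintype ι] [Fintype J] [DecidableEq J]

lemma krP_dot (o : J → ι → ℝ) (κ : J → ℝ)
    (horth : ∀ i j, o i ⬝ᵥ o j = if i = j then κ i else 0)
    (hκ : ∀ j, κ j = 1 ∨ o j = 0) (u u' : ι → ℝ) :
    krP o u ⬝ᵥ krP o u' = u ⬝ᵥ u' - ∑ j, (u ⬝ᵥ o j) * (u' ⬝ᵥ o j) := by
  unfold krP
  simp only [sub_dotProduct, dotProduct_sub, dotProduct_sum, sum_dotProduct, dotProduct_smul,
    smul_dotProduct, smul_eq_mul, horth]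
  have : ∑ j, u' ⬝ᵥ o j * ∑ x, u ⬝ᵥ o x * (if x = j then κ x else 0) = ∑ j, (u ⬝ᵥ o j) * (u' ⬝ᵥ o j) := by
    refine Finset.sum_congr rfl fun j _ => ?_
    simp only [mul_ite, mul_zero, Finset.sum_ite_eq', Finset.mem_univ, if_true]
    rcases hκ j with h | h
    · rw [h]; ring
    · rw [h]; simp
  have h2 : ∑ j, u' ⬝ᵥ o j * u ⬝ᵥ o j = ∑ j, (u ⬝ᵥ o j) * (u' ⬝ᵥ o j) :=
    Finset.sum_congr rfl fun j _ => mul_comm _ _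
  have h3 : ∑ j, u ⬝ᵥ o j * o j ⬝ᵥ u' = ∑ j, (u ⬝ᵥ o j) * (u' ⬝ᵥ o j) :=
    Finset.sum_congr rfl fun j _ => by rw [dotProduct_comm (o j)]
  simp only [mul_sub, Finset.sum_sub_distrib]
  rw [this, h2, h3]; ring

lemma krP_adj (o : J → ι → ℝ) (g u : ι → ℝ) : krP o g ⬝ᵥ u = g ⬝ᵥ krP o u := by
  unfold krP
  simp only [sub_dotProduct, dotProduct_sub, dotProduct_sum, sum_dotProduct, dotProduct_smul,
    smul_dotProduct, smul_eq_mul]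
  congr 1
  exact Finset.sum_congr rfl fun j _ => by rw [dotProduct_comm (o j) u, mul_comm]

lemma krP_orth (o : J → ι → ℝ) (κ : J → ℝ)
    (horth : ∀ i j, o i ⬝ᵥ o j = if i = j then κ i else 0)
    (hκ : ∀ j, κ j = 1 ∨ o j = 0) (g : ι → ℝ) (j : J) : krP o g ⬝ᵥ o j = 0 := by
  rcases hκ j with h | h
  · unfold krP
    simp only [sub_dotProduct, sum_dotProduct, smul_dotProduct, smul_eq_mul, horth]
    simp [h]
  · rw [h]; simp

lemma smul_deriv {E : Type*} [NormedAddCommGroup E] [NormedSpace ℝ E] {s τ : E → ℝ}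
    {G H : E → ι → ℝ} {z : E} (hs : DifferentiableAt ℝ s z) (hτ : DifferentiableAt ℝ τ z)
    (hG : DifferentiableAt ℝ G z) (hH : DifferentiableAt ℝ H z) (w : ι → ℝ)
    (hwG : w ⬝ᵥ G z = 0) (hwH : w ⬝ᵥ H z = 0) (ζ : E) :
    w ⬝ᵥ fderiv ℝ (fun z => s z • (G z - τ z • H z)) z ζ =
      s z * (w ⬝ᵥ fderiv ℝ G z ζ - τ z * (w ⬝ᵥ fderiv ℝ H z ζ)) := by
  have h := hs.hasFDerivAt.smul (hG.hasFDerivAt.sub (hτ.hasFDerivAt.smul hH.hasFDerivAt))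
  have h2 : fderiv ℝ (fun z => s z • (G z - τ z • H z)) z = _ := h.fderiv
  rw [h2]
  simp only [ContinuousLinearMap.add_apply, ContinuousLinearMap.smul_apply,
    ContinuousLinearMap.sub_apply, ContinuousLinearMap.smulRight_apply, dotProduct_add,
    dotProduct_smul, dotProduct_sub, smul_eq_mul, hwG, hwH, Pi.smul_apply', Pi.sub_apply]
  ring
end krp
end

section
open scoped Matrix
set_option linter.all false

/-- index type of pairs of points -/
abbrev JJ (N : ℕ) : Type := Fin (N + 1) ⊕ Fin (N + 1)

/-- first point -/
def zx {N : ℕ} (z : JJ N → ℝ) : Fin (N + 1) → ℝ := fun i => z (Sum.inl i)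
/-- second point -/
def zy {N : ℕ} (z : JJ N → ℝ) : Fin (N + 1) → ℝ := fun i => z (Sum.inr i)
/-- correlation -/
def rr {N : ℕ} (z : JJ N → ℝ) : ℝ := hat (zx z) ⬝ᵥ hat (zy z)

/-- conditional variance -/
def sg (d : ℕ) (a : ℕ → ℝ) (r : ℝ) : ℝ := xi d a 1 - xi d a r ^ 2 / xi d a 1

/-- `o`, first half -/
def oX (N : ℕ) (d : Fin N → ℕ) (a : Fin N → ℕ → ℝ) (k : Fin N) (z : JJ N → ℝ) : GIdx N N d → ℝ :=
  (Real.sqrt (xi (d k) (a k) 1))⁻¹ • Gv N d a k (zx z)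
/-- `o`, second half -/
def oY (N : ℕ) (d : Fin N → ℕ) (a : Fin N → ℕ → ℝ) (k : Fin N) (z : JJ N → ℝ) : GIdx N N d → ℝ :=
  (Real.sqrt (sg (d k) (a k) (rr z)))⁻¹ •
    (Gv N d a k (zy z) - (xi (d k) (a k) (rr z) / xi (d k) (a k) 1) • Gv N d a k (zx z))

/-- the orthonormal system -/
def oo (N : ℕ) (d : Fin N → ℕ) (a : Fin N → ℕ → ℝ) : JJ N → (JJ N → ℝ) → GIdx N N d → ℝ :=
  Sum.elim (Fin.cons (fun _ => 0) (oX N d a)) (Fin.cons (fun _ => 0) (oY N d a))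

/-- the norm constraints -/
def nn (N : ℕ) : JJ N → (JJ N → ℝ) → ℝ :=
  Sum.elim (Fin.cons (fun z => (zx z ⬝ᵥ zx z) / 2) (fun _ _ => 0))
    (Fin.cons (fun z => (zy z ⬝ᵥ zy z) / 2) (fun _ _ => 0))

/-- indicator of field coordinates -/
def kk (N : ℕ) : JJ N → ℝ := Sum.elim (Fin.cons 0 (fun _ => 1)) (Fin.cons 0 (fun _ => 1))

/-- good configurations -/
def UU (N : ℕ) : Set (JJ N → ℝ) := {z | zx z ≠ 0 ∧ zy z ≠ 0 ∧ rr z ^ 2 < 1}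

variable {N : ℕ} {d : Fin N → ℕ} {a : Fin N → ℕ → ℝ}

lemma zx_clm : ∃ L : (JJ N → ℝ) →L[ℝ] (Fin (N + 1) → ℝ), ∀ z, L z = zx z :=
  ⟨ContinuousLinearMap.pi fun i => ContinuousLinearMap.proj (Sum.inl i), fun z => rfl⟩
lemma zy_clm : ∃ L : (JJ N → ℝ) →L[ℝ] (Fin (N + 1) → ℝ), ∀ z, L z = zy z :=
  ⟨ContinuousLinearMap.pi fun i => ContinuousLinearMap.proj (Sum.inr i), fun z => rfl⟩

lemma fderiv_comp_zx {E : Type*} [NormedAddCommGroup E] [NormedSpace ℝ E]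
    {f : (Fin (N + 1) → ℝ) → E} {z : JJ N → ℝ} (hf : DifferentiableAt ℝ f (zx z)) :
    DifferentiableAt ℝ (fun z => f (zx z)) z ∧
      ∀ ζ, fderiv ℝ (fun z => f (zx z)) z ζ = fderiv ℝ f (zx z) (zx ζ) := by
  obtain ⟨L, hL⟩ := zx_clm (N := N)
  have h0 : (zx : (JJ N → ℝ) → _) = L := by funext z; exact (hL z).symm
  rw [← hL] at hf
  have h := hf.hasFDerivAt.comp z L.hasFDerivAt
  have h2 : (f ∘ L) = fun z => f (zx z) := by funext z; simp [hL]
  rw [h2] at h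
  refine ⟨h.differentiableAt, fun ζ => ?_⟩
  rw [h.fderiv]; simp [hL]

lemma fderiv_comp_zy {E : Type*} [NormedAddCommGroup E] [NormedSpace ℝ E]
    {f : (Fin (N + 1) → ℝ) → E} {z : JJ N → ℝ} (hf : DifferentiableAt ℝ f (zy z)) :
    DifferentiableAt ℝ (fun z => f (zy z)) z ∧
      ∀ ζ, fderiv ℝ (fun z => f (zy z)) z ζ = fderiv ℝ f (zy z) (zy ζ) := by
  obtain ⟨L, hL⟩ := zy_clm (N := N)
  have h0 : (zy : (JJ N → ℝ) → _) = L := by funext z; exact (hL z).symm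
  rw [← hL] at hf
  have h := hf.hasFDerivAt.comp z L.hasFDerivAt
  have h2 : (f ∘ L) = fun z => f (zy z) := by funext z; simp [hL]
  rw [h2] at h
  refine ⟨h.differentiableAt, fun ζ => ?_⟩
  rw [h.fderiv]; simp [hL]

lemma diff_rr {z : JJ N → ℝ} (hx : zx z ≠ 0) (hy : zy z ≠ 0) : DifferentiableAt ℝ rr z := by
  obtain ⟨D, hD, _⟩ := ((fderiv_comp_zx (diff_hat hx)).1.hasFDerivAt).dotP
    (fderiv_comp_zy (diff_hat hy)).1.hasFDerivAt
  exact hD.differentiableAt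

lemma continuous_zx : Continuous (zx : (JJ N → ℝ) → _) := by unfold zx; fun_prop
lemma continuous_zy : Continuous (zy : (JJ N → ℝ) → _) := by unfold zy; fun_prop

lemma isOpen_UU : IsOpen (UU N) := by
  rw [isOpen_iff_mem_nhds]
  rintro z ⟨hx, hy, hr⟩
  have h1 := continuous_zx.continuousAt.eventually_ne hx
  have h2 := continuous_zy.continuousAt.eventually_ne hy
  have h3 := ((diff_rr hx hy).continuousAt.pow 2).eventually_lt_const hr
  filter_upwards [h1, h2, h3] with z a b c using ⟨a, b, c⟩

lemma sg_pos (ha : ∀ k, ∃ p ∈ Finset.Icc 2 (d k), a k p ≠ 0) (k : Fin N) {r : ℝ} (hr : r ^ 2 < 1) :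
    0 < sg (d k) (a k) r := by
  have h1 := xi_one_pos (ha k)
  have h2 := xi_sq_lt (ha k) hr
  unfold sg
  have : xi (d k) (a k) 1 - xi (d k) (a k) r ^ 2 / xi (d k) (a k) 1 =
    (xi (d k) (a k) 1 ^ 2 - xi (d k) (a k) r ^ 2) / xi (d k) (a k) 1 := by field_simp
  rw [this]; positivity

lemma Gv_dot (k l : Fin N) (x y : Fin (N + 1) → ℝ) :
    Gv N d a k x ⬝ᵥ Gv N d a l y = if k = l then xi (d k) (a k) (hat x ⬝ᵥ hat y) else 0 := Fv_dot k l _ _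

lemma oo_orth (ha : ∀ k, ∃ p ∈ Finset.Icc 2 (d k), a k p ≠ 0) {z : JJ N → ℝ} (hz : z ∈ UU N) :
    ∀ i j, oo N d a i z ⬝ᵥ oo N d a j z = if i = j then kk N i else 0 := by
  obtain ⟨hx, hy, hr⟩ := hz
  have hXX : ∀ k l, oX N d a k z ⬝ᵥ oX N d a l z = if k = l then 1 else 0 := by
    intro k l
    unfold oX
    rw [smul_dotProduct, dotProduct_smul, Gv_dot, hat_dot hx]
    split_ifs with h
    · subst h
      have h1 := xi_one_pos (ha k)
      have h2 := Real.mul_self_sqrt h1.le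
      have h3 := (Real.sqrt_pos.2 h1).ne'
      simp only [smul_eq_mul]
      field_simp
      nlinarith
    · simp
  have hXY : ∀ k l, oX N d a k z ⬝ᵥ oY N d a l z = 0 := by
    intro k l
    unfold oX oY
    rw [smul_dotProduct, dotProduct_smul, dotProduct_sub, dotProduct_smul, Gv_dot, Gv_dot, hat_dot hx]
    split_ifs with h
    · subst h
      have h1 := (xi_one_pos (ha k)).ne'
      rw [show hat (zx z) ⬝ᵥ hat (zy z) = rr z from rfl]
      simp only [smul_eq_mul]
      rw [div_mul_cancel₀ _ h1]; simp
    · simp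
  have hYY : ∀ k l, oY N d a k z ⬝ᵥ oY N d a l z = if k = l then 1 else 0 := by
    intro k l
    unfold oY
    simp only [smul_dotProduct, dotProduct_smul, dotProduct_sub, sub_dotProduct, Gv_dot, hat_dot hx, hat_dot hy]
    rw [dotProduct_comm (hat (zy z)), show hat (zx z) ⬝ᵥ hat (zy z) = rr z from rfl]
    split_ifs with h
    · subst h
      have h1 := (xi_one_pos (ha k)).ne'
      have h4 := sg_pos ha k hr
      have h2 := Real.mul_self_sqrt h4.le
      have h3 := (Real.sqrt_pos.2 h4).ne'
      simp only [smul_eq_mul]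
      have : xi (d k) (a k) 1 - xi (d k) (a k) (rr z) / xi (d k) (a k) 1 * xi (d k) (a k) (rr z) -
         xi (d k) (a k) (rr z) / xi (d k) (a k) 1 * (xi (d k) (a k) (rr z) - 
          xi (d k) (a k) (rr z) / xi (d k) (a k) 1 * xi (d k) (a k) 1) = sg (d k) (a k) (rr z) := by
        unfold sg; field_simp; ring
      rw [show ∀ s A B c : ℝ, s * (s * A - c * (s * B)) = s * s * (A - c * B) by intros; ring, this]
      field_simp
      nlinarith
    · simp
  rintro (i | i) (j | j) <;> refine Fin.cases ?_ (fun k => ?_) i <;> refine Fin.cases ?_ (fun l => ?_) j <;>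
    simp [oo, kk, hXX, hXY, hYY, dotProduct_comm (oY N d a _ z) (oX N d a _ z), Fin.succ_ne_zero,
      (Fin.succ_ne_zero _).symm]

lemma diff_oX {z : JJ N → ℝ} (hz : z ∈ UU N) (k : Fin N) : DifferentiableAt ℝ (oX N d a k) z := by
  unfold oX
  exact ((fderiv_comp_zx (diff_Gv k hz.1)).1.hasFDerivAt.const_smul (Real.sqrt (xi (d k) (a k) 1))⁻¹).differentiableAt

lemma diff_sgz (ha : ∀ k, ∃ p ∈ Finset.Icc 2 (d k), a k p ≠ 0) {z : JJ N → ℝ} (hz : z ∈ UU N)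
    (k : Fin N) : DifferentiableAt ℝ (fun z : JJ N → ℝ => (Real.sqrt (sg (d k) (a k) (rr z)))⁻¹) z ∧
      DifferentiableAt ℝ (fun z : JJ N → ℝ => xi (d k) (a k) (rr z) / xi (d k) (a k) 1) z := by
  have h1 : DifferentiableAt ℝ (fun z : JJ N → ℝ => xi (d k) (a k) (rr z)) z :=
    ((xi_hasDerivAt (d k) (a k) (rr z)).differentiableAt).comp z (diff_rr hz.1 hz.2.1)
  have h4 := sg_pos ha k hz.2.2
  constructor
  · refine DifferentiableAt.inv (DifferentiableAt.sqrt ?_ h4.ne') (Real.sqrt_pos.2 h4).ne'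
    unfold sg
    exact (differentiableAt_const _).sub (by simpa only [div_eq_mul_inv] using (h1.fun_pow 2).mul_const (xi (d k) (a k) 1)⁻¹)
  · simpa only [div_eq_mul_inv] using h1.mul_const (xi (d k) (a k) 1)⁻¹

lemma diff_oY (ha : ∀ k, ∃ p ∈ Finset.Icc 2 (d k), a k p ≠ 0) {z : JJ N → ℝ} (hz : z ∈ UU N)
    (k : Fin N) : DifferentiableAt ℝ (oY N d a k) z := by
  unfold oY
  obtain ⟨h1, h2⟩ := diff_sgz ha hz k
  exact h1.smul ((fderiv_comp_zy (diff_Gv k hz.2.1)).1.sub (h2.smul (fderiv_comp_zx (diff_Gv k hz.1)).1))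

lemma diff_oo (ha : ∀ k, ∃ p ∈ Finset.Icc 2 (d k), a k p ≠ 0) {z : JJ N → ℝ} (hz : z ∈ UU N)
    (j : JJ N) : DifferentiableAt ℝ (oo N d a j) z := by
  rcases j with j | j <;> refine Fin.cases ?_ (fun k => ?_) j
  · exact differentiableAt_const _
  · exact diff_oX hz k
  · exact differentiableAt_const _
  · exact diff_oY ha hz k

lemma oo_skew (ha : ∀ k, ∃ p ∈ Finset.Icc 2 (d k), a k p ≠ 0) {z : JJ N → ℝ} (hz : z ∈ UU N)
    (i j ζ) : fderiv ℝ (oo N d a i) z ζ ⬝ᵥ oo N d a j z =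
      -(oo N d a i z ⬝ᵥ fderiv ℝ (oo N d a j) z ζ) := by
  obtain ⟨D, hD, hDv⟩ := (diff_oo ha hz i).hasFDerivAt.dotP (diff_oo ha hz j).hasFDerivAt
  have h0 : (fun z => oo N d a i z ⬝ᵥ oo N d a j z) =ᶠ[nhds z] fun _ => if i = j then kk N i else 0 := by
    filter_upwards [isOpen_UU.mem_nhds hz] with z hz using oo_orth ha hz i j
  have h1 := hD.unique ((hasFDerivAt_const _ _).congr_of_eventuallyEq h0)
  have h2 := hDv ζ
  rw [h1] at h2
  simp only [ContinuousLinearMap.zero_apply] at h2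
  linarith

lemma diff_nn (z : JJ N → ℝ) (j : JJ N) : DifferentiableAt ℝ (nn N j) z := by
  obtain ⟨D, hD, _⟩ := (hasFDerivAt_id (𝕜 := ℝ) (zx z)).dotP (hasFDerivAt_id (𝕜 := ℝ) (zx z))
  obtain ⟨E, hE, _⟩ := (hasFDerivAt_id (𝕜 := ℝ) (zy z)).dotP (hasFDerivAt_id (𝕜 := ℝ) (zy z))
  rcases j with j | j <;> refine Fin.cases ?_ (fun k => ?_) j
  · exact (by unfold zx dotProduct; fun_prop : DifferentiableAt ℝ (fun z => (zx z ⬝ᵥ zx z) / 2) z)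
  · exact differentiableAt_const _
  · exact (by unfold zy dotProduct; fun_prop : DifferentiableAt ℝ (fun z => (zy z ⬝ᵥ zy z) / 2) z)
  · exact differentiableAt_const _

lemma fderiv_nn (z ζ : JJ N → ℝ) : fderiv ℝ (nn N (Sum.inl 0)) z ζ = zx z ⬝ᵥ zx ζ ∧
    fderiv ℝ (nn N (Sum.inr 0)) z ζ = zy z ⬝ᵥ zy ζ ∧
    (∀ k : Fin N, fderiv ℝ (nn N (Sum.inl k.succ)) z = 0) ∧
    (∀ k : Fin N, fderiv ℝ (nn N (Sum.inr k.succ)) z = 0) := by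
  obtain ⟨D, hD, hDv⟩ := (hasFDerivAt_id (𝕜 := ℝ) (zx z)).dotP (hasFDerivAt_id (𝕜 := ℝ) (zx z))
  obtain ⟨E, hE, hEv⟩ := (hasFDerivAt_id (𝕜 := ℝ) (zy z)).dotP (hasFDerivAt_id (𝕜 := ℝ) (zy z))
  refine ⟨?_, ?_, fun k => ?_, fun k => ?_⟩
  · have hD2 := hD.const_mul (1/2)
    have h := (fderiv_comp_zx (z := z) hD2.differentiableAt).2 ζ
    rw [hD2.fderiv] at h
    have : nn N (Sum.inl 0) = fun z => 1/2 * (id (zx z) ⬝ᵥ id (zx z)) := by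
      funext z; simp [nn]; ring
    rw [this, h]
    simp [hDv, dotProduct_comm (zx ζ)]; ring
  · have hD2 := hE.const_mul (1/2)
    have h := (fderiv_comp_zy (z := z) hD2.differentiableAt).2 ζ
    rw [hD2.fderiv] at h
    have : nn N (Sum.inr 0) = fun z => 1/2 * (id (zy z) ⬝ᵥ id (zy z)) := by
      funext z; simp [nn]; ring
    rw [this, h]
    simp [hEv, dotProduct_comm (zy ζ)]; ring
  · have : nn N (Sum.inl k.succ) = fun z => 0 := by funext z; simp [nn]
    rw [this]; exact fderiv_const_apply 0
  · have : nn N (Sum.inr k.succ) = fun z => 0 := by funext z; simp [nn]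
    rw [this]; exact fderiv_const_apply 0
end

section
open scoped Matrix
set_option linter.all false

variable {N : ℕ} {d : Fin N → ℕ} {a : Fin N → ℕ → ℝ}

/-- the first-kind matrix -/
def Amat (N : ℕ) (d : Fin N → ℕ) (a : Fin N → ℕ → ℝ) (w : GIdx N N d → ℝ) (x : Fin (N + 1) → ℝ) :
    Matrix (Fin (N + 1)) (Fin (N + 1)) ℝ :=
  Matrix.of (Fin.cons x (fun k i => w ⬝ᵥ fderiv ℝ (Gv N d a k) x (Pi.single i 1)) :
      Fin (N + 1) → Fin (N + 1) → ℝ)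

lemma kk_oo (z : JJ N → ℝ) (j : JJ N) : kk N j = 1 ∨ oo N d a j z = 0 := by
  rcases j with j | j <;> refine Fin.cases ?_ (fun k => ?_) j <;> simp [kk, oo]

lemma w_Gv (ha : ∀ k, ∃ p ∈ Finset.Icc 2 (d k), a k p ≠ 0) {z : JJ N → ℝ} (hz : z ∈ UU N)
    (w : GIdx N N d → ℝ) (hw : ∀ j, w ⬝ᵥ oo N d a j z = 0) (k : Fin N) :
    w ⬝ᵥ Gv N d a k (zx z) = 0 ∧ w ⬝ᵥ Gv N d a k (zy z) = 0 := by
  have h1 : w ⬝ᵥ oX N d a k z = 0 := hw (Sum.inl k.succ)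
  have h2 : w ⬝ᵥ oY N d a k z = 0 := hw (Sum.inr k.succ)
  unfold oX at h1
  unfold oY at h2
  have p1 := (Real.sqrt_pos.2 (xi_one_pos (ha k))).ne'
  have p2 := (Real.sqrt_pos.2 (sg_pos ha k hz.2.2)).ne'
  rw [dotProduct_smul, smul_eq_mul, mul_eq_zero] at h1 h2
  have h1' := h1.resolve_left (inv_ne_zero p1)
  have h2' := h2.resolve_left (inv_ne_zero p2)
  rw [dotProduct_sub, dotProduct_smul, h1'] at h2'
  exact ⟨h1', by simpa using h2'⟩

lemma det_krM (ha : ∀ k, ∃ p ∈ Finset.Icc 2 (d k), a k p ≠ 0) {z : JJ N → ℝ} (hz : z ∈ UU N)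
    (w : GIdx N N d → ℝ) (hw : ∀ j, w ⬝ᵥ oo N d a j z = 0) :
    |(krM (fun j => fderiv ℝ (oo N d a j) z) (fun j => fderiv ℝ (nn N j) z) w).det| =
      (∏ k, (Real.sqrt (xi (d k) (a k) 1 ^ 2 - xi (d k) (a k) (rr z) ^ 2))⁻¹) *
        (|(Amat N d a w (zx z)).det| * |(Amat N d a w (zy z)).det|) := by
  have hzxl : ∀ i, zx (Pi.single (Sum.inl i) 1 : JJ N → ℝ) = Pi.single i 1 := by
    intro i; ext j; simp [zx, Pi.single_apply]
  have hzyl : ∀ i, zy (Pi.single (Sum.inl i) 1 : JJ N → ℝ) = 0 := by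
    intro i; ext j; simp [zy, Pi.single_apply]
  have hzxr : ∀ i, zx (Pi.single (Sum.inr i) 1 : JJ N → ℝ) = 0 := by
    intro i; ext j; simp [zx, Pi.single_apply]
  have hzyr : ∀ i, zy (Pi.single (Sum.inr i) 1 : JJ N → ℝ) = Pi.single i 1 := by
    intro i; ext j; simp [zy, Pi.single_apply]
  have hG := w_Gv ha hz w hw
  have hdX : ∀ k ζ, w ⬝ᵥ fderiv ℝ (oX N d a k) z ζ = (Real.sqrt (xi (d k) (a k) 1))⁻¹ *
      (w ⬝ᵥ fderiv ℝ (Gv N d a k) (zx z) (zx ζ)) := by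
    intro k ζ
    have h := (fderiv_comp_zx (diff_Gv (d := d) (a := a) k hz.1)).1.hasFDerivAt.const_smul
      (Real.sqrt (xi (d k) (a k) 1))⁻¹
    have h2 : fderiv ℝ (oX N d a k) z = _ := h.fderiv
    rw [h2]
    simp only [ContinuousLinearMap.smul_apply, dotProduct_smul, smul_eq_mul,
      (fderiv_comp_zx (diff_Gv (d := d) (a := a) k hz.1)).2]
  have hdY : ∀ k ζ, w ⬝ᵥ fderiv ℝ (oY N d a k) z ζ = (Real.sqrt (sg (d k) (a k) (rr z)))⁻¹ *
      ((w ⬝ᵥ fderiv ℝ (Gv N d a k) (zy z) (zy ζ)) - (xi (d k) (a k) (rr z) / xi (d k) (a k) 1) * 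
        (w ⬝ᵥ fderiv ℝ (Gv N d a k) (zx z) (zx ζ))) := by
    intro k ζ
    have h := smul_deriv (diff_sgz ha hz k).1 (diff_sgz ha hz k).2
      (fderiv_comp_zy (diff_Gv (d := d) (a := a) k hz.2.1)).1
      (fderiv_comp_zx (diff_Gv (d := d) (a := a) k hz.1)).1 w (hG k).2 (hG k).1 ζ
    rw [(fderiv_comp_zy (diff_Gv (d := d) (a := a) k hz.2.1)).2,
      (fderiv_comp_zx (diff_Gv (d := d) (a := a) k hz.1)).2] at h
    exact h
  have ho0 : fderiv ℝ (oo N d a (Sum.inl 0)) z = 0 := by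
    have : oo N d a (Sum.inl 0) = fun _ => 0 := rfl
    rw [this]; exact fderiv_const_apply 0
  have ho0' : fderiv ℝ (oo N d a (Sum.inr 0)) z = 0 := by
    have : oo N d a (Sum.inr 0) = fun _ => 0 := rfl
    rw [this]; exact fderiv_const_apply 0
  have hX : ∀ k : Fin N, oo N d a (Sum.inl k.succ) = oX N d a k := fun k => rfl
  have hY : ∀ k : Fin N, oo N d a (Sum.inr k.succ) = oY N d a k := fun k => rfl
  set vx : Fin (N + 1) → ℝ := Fin.cons 1 (fun k => (Real.sqrt (xi (d k) (a k) 1))⁻¹) with hvx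
  set vy : Fin (N + 1) → ℝ := Fin.cons 1 (fun k => (Real.sqrt (sg (d k) (a k) (rr z)))⁻¹) with hvy
  have hfn := fun ζ => fderiv_nn (N := N) z ζ
  set M := krM (fun j => fderiv ℝ (oo N d a j) z) (fun j => fderiv ℝ (nn N j) z) w with hM
  have hMe : ∀ j i, M j i = w ⬝ᵥ fderiv ℝ (oo N d a j) z (Pi.single i 1) +
      fderiv ℝ (nn N j) z (Pi.single i 1) := fun j i => rfl
  have hblock : M = Matrix.fromBlocks (Matrix.of fun i j => vx i * Amat N d a w (zx z) i j) 0
      M.toBlocks₂₁ (Matrix.of fun i j => vy i * Amat N d a w (zy z) i j) := by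
    conv_lhs => rw [← Matrix.fromBlocks_toBlocks M]
    congr 1
    · ext i j
      rw [Matrix.toBlocks₁₁, Matrix.of_apply, hMe]
      refine Fin.cases ?_ (fun k => ?_) i
      · rw [ho0, (hfn _).1, hzxl]; simp [hvx, Amat]
      · rw [hX, hdX, (hfn 0).2.2.1, hzxl]; simp [hvx, Amat]
    · ext i j
      rw [Matrix.toBlocks₁₂, Matrix.of_apply, hMe]
      refine Fin.cases ?_ (fun k => ?_) i
      · rw [ho0, (hfn _).1, hzxr]; simp
      · rw [hX, hdX, (hfn 0).2.2.1, hzxr]; simp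
    · ext i j
      rw [Matrix.toBlocks₂₂, Matrix.of_apply, hMe]
      refine Fin.cases ?_ (fun k => ?_) i
      · rw [ho0', (hfn _).2.1, hzyr]; simp [hvy, Amat]
      · rw [hY, hdY, (hfn 0).2.2.2, hzyr, hzxr]; simp [hvy, Amat]
  rw [hblock, Matrix.det_fromBlocks_zero₁₂, Matrix.det_mul_column, Matrix.det_mul_column]
  rw [Fin.prod_univ_succ, Fin.prod_univ_succ]
  simp only [hvx, hvy, Fin.cons_zero, Fin.cons_succ, one_mul]
  have hprod : (∏ k, (Real.sqrt (xi (d k) (a k) 1 ^ 2 - xi (d k) (a k) (rr z) ^ 2))⁻¹) =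
      (∏ k, (Real.sqrt (xi (d k) (a k) 1))⁻¹) * ∏ k, (Real.sqrt (sg (d k) (a k) (rr z)))⁻¹ := by
    rw [← Finset.prod_mul_distrib]
    refine Finset.prod_congr rfl fun k _ => ?_
    rw [← mul_inv, ← Real.sqrt_mul (xi_one_pos (ha k)).le]
    congr 2
    unfold sg
    have := (xi_one_pos (ha k)).ne'
    field_simp
  have p1 : 0 ≤ ∏ k, (Real.sqrt (xi (d k) (a k) 1))⁻¹ := Finset.prod_nonneg fun k _ => by positivity
  have p2 : 0 ≤ ∏ k, (Real.sqrt (sg (d k) (a k) (rr z)))⁻¹ := Finset.prod_nonneg fun k _ => by positivity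
  rw [hprod, abs_mul, abs_mul, abs_mul, abs_of_nonneg p1, abs_of_nonneg p2]
  ring

lemma oo_supp (z : JJ N → ℝ) (k : Fin N) (q : GIdx N N d) (hq : q.1 ≠ k) :
    oX N d a k z q = 0 ∧ oY N d a k z q = 0 := by
  simp [oX, oY, Gv, Fv, hq]

lemma dot_supp {k l : Fin N} (hkl : k ≠ l) {u v : GIdx N N d → ℝ} (hu : ∀ q : GIdx N N d, q.1 ≠ k → u q = 0)
    (hv : ∀ q : GIdx N N d, q.1 ≠ l → v q = 0) : u ⬝ᵥ v = 0 := by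
  unfold dotProduct
  refine Finset.sum_eq_zero fun q _ => ?_
  by_cases h : q.1 = k
  · rw [hv q (fun h2 => hkl (h.symm.trans h2)), mul_zero]
  · rw [hu q h, zero_mul]

lemma krP_supp (z : JJ N → ℝ) (k : Fin N) (u : GIdx N N d → ℝ)
    (hu : ∀ q : GIdx N N d, q.1 ≠ k → u q = 0) (q : GIdx N N d) (hq : q.1 ≠ k) :
    krP (fun j => oo N d a j z) u q = 0 := by
  unfold krP
  rw [Pi.sub_apply, hu q hq, Finset.sum_apply, zero_sub, neg_eq_zero]
  refine Finset.sum_eq_zero fun j _ => ?_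
  rw [Pi.smul_apply, smul_eq_mul, mul_eq_zero]
  rcases j with j | j <;> refine Fin.cases ?_ (fun l => ?_) j
  · right; rfl
  · by_cases hl : l = k
    · right; exact (oo_supp z l q (hl ▸ hq)).1
    · left; exact dot_supp (Ne.symm hl) hu (fun q hq => (oo_supp z l q hq).1)
  · right; rfl
  · by_cases hl : l = k
    · right; exact (oo_supp z l q (hl ▸ hq)).2
    · left; exact dot_supp (Ne.symm hl) hu (fun q hq => (oo_supp z l q hq).2)

lemma krP_cov (ha : ∀ k, ∃ p ∈ Finset.Icc 2 (d k), a k p ≠ 0) {z : JJ N → ℝ} (hz : z ∈ UU N)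
    (k : Fin N) (u u' : GIdx N N d → ℝ) (hu : ∀ q : GIdx N N d, q.1 ≠ k → u q = 0)
    (hu' : ∀ q : GIdx N N d, q.1 ≠ k → u' q = 0) :
    krP (fun j => oo N d a j z) u ⬝ᵥ krP (fun j => oo N d a j z) u' = u ⬝ᵥ u' -
        (xi (d k) (a k) 1 * ((u ⬝ᵥ Fv N d a k (hat (zx z))) * (u' ⬝ᵥ Fv N d a k (hat (zx z))) +
            (u ⬝ᵥ Fv N d a k (hat (zy z))) * (u' ⬝ᵥ Fv N d a k (hat (zy z)))) -
          xi (d k) (a k) (rr z) * ((u ⬝ᵥ Fv N d a k (hat (zx z))) * (u' ⬝ᵥ Fv N d a k (hat (zy z))) +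
            (u ⬝ᵥ Fv N d a k (hat (zy z))) * (u' ⬝ᵥ Fv N d a k (hat (zx z))))) /
          (xi (d k) (a k) 1 ^ 2 - xi (d k) (a k) (rr z) ^ 2) := by
  rw [krP_dot _ (kk N) (oo_orth ha hz) (kk_oo z)]
  congr 1
  rw [Fintype.sum_sum_type, Fin.sum_univ_succ, Fin.sum_univ_succ (n := N)]
  have h0 : oo N d a (Sum.inl 0) z = 0 := rfl
  have h0' : oo N d a (Sum.inr 0) z = 0 := rfl
  have hX : ∀ k : Fin N, oo N d a (Sum.inl k.succ) z = oX N d a k z := fun k => rfl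
  have hY : ∀ k : Fin N, oo N d a (Sum.inr k.succ) z = oY N d a k z := fun k => rfl
  simp only [h0, h0', hX, hY, dotProduct_zero, mul_zero, zero_add]
  rw [Finset.sum_eq_single k, Finset.sum_eq_single k]
  · have s1 := xi_one_pos (ha k)
    have s2 := sg_pos ha k hz.2.2
    have s3 := xi_sq_lt (ha k) hz.2.2
    unfold oX oY
    simp only [dotProduct_smul, dotProduct_sub, smul_eq_mul]
    rw [mul_mul_mul_comm, ← mul_inv, Real.mul_self_sqrt s1.le, mul_mul_mul_comm, ← mul_inv,
      Real.mul_self_sqrt s2.le]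
    have e : (sg (d k) (a k) (rr z))⁻¹ = xi (d k) (a k) 1 / (xi (d k) (a k) 1 ^ 2 - xi (d k) (a k) (rr z) ^ 2) := by
      rw [inv_eq_one_div, div_eq_div_iff s2.ne' s3.ne']
      unfold sg; field_simp
    rw [e]
    unfold Gv
    have s1' := s1.ne'
    have s3' := s3.ne'
    field_simp
    ring
  · intro l _ hl
    rw [dot_supp (Ne.symm hl) hu (fun q hq => (oo_supp z l q hq).2), zero_mul]
  · simp
  · intro l _ hl
    rw [dot_supp (Ne.symm hl) hu (fun q hq => (oo_supp z l q hq).1), zero_mul]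
  · simp

lemma moment_bound (hN : 1 ≤ N) (ha : ∀ k, ∃ p ∈ Finset.Icc 2 (d k), a k p ≠ 0) {z : JJ N → ℝ}
    (hz : z ∈ UU N) :
    ∫⁻ g, ENNReal.ofReal |(krM (fun j => fderiv ℝ (oo N d a j) z) (fun j => fderiv ℝ (nn N j) z)
        (krP (fun j => oo N d a j z) g)).det| ∂(GaussP N N d) ≤
      ENNReal.ofReal ((∏ k, (Real.sqrt (xi (d k) (a k) 1 ^ 2 - xi (d k) (a k) (rr z) ^ 2))⁻¹) *
        ((nrm (zx z) * (nrm (zx z))⁻¹ ^ N) * (nrm (zy z) * (nrm (zy z))⁻¹ ^ N))) *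
      ENNReal.ofReal (((N - 1).factorial : ℝ) *
          ((∑ k, lam (d k) (a k) (rr z)) * ∏ k, xi' (d k) (a k) 1)) := by
  have hx := hz.1
  have hy := hz.2.1
  obtain ⟨b, hb, hb0, hbI⟩ := secmom (d := d) (a := a) hN (hat (zx z)) (hat (zy z)) (hat_dot hx)
    (hat_dot hy) hz.2.2 (fun k => xi'_one_pos (ha k)) (krP (fun j => oo N d a j z))
    (krP_supp z) (krP_cov ha hz)
  obtain ⟨c, hc, hc0, hcI⟩ := secmom (d := d) (a := a) hN (hat (zy z)) (hat (zx z)) (hat_dot hy)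
    (hat_dot hx) (by rw [dotProduct_comm]; exact hz.2.2) (fun k => xi'_one_pos (ha k))
    (krP (fun j => oo N d a j z))
    (krP_supp z) (fun k u u' hu hu' => by
      rw [krP_cov ha hz k u u' hu hu', dotProduct_comm (hat (zy z)) (hat (zx z))]
      change _ = u ⬝ᵥ u' - (_ - xi (d k) (a k) (rr z) * _) / (_ - xi (d k) (a k) (rr z) ^ 2)
      congr 2; ring)
  rw [dotProduct_comm] at hcI
  rw [show hat (zx z) ⬝ᵥ hat (zy z) = rr z from rfl] at hbI hcI
  set Q := ENNReal.ofReal (((N - 1).factorial : ℝ) *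
          ((∑ k, lam (d k) (a k) (rr z)) * ∏ k, xi' (d k) (a k) 1)) with hQ
  set mx := fun g : GIdx N N d → ℝ => (Matrix.of fun k (i : Fin N) =>
          g ⬝ᵥ krP (fun j => oo N d a j z) (fderiv ℝ (Fv N d a k) (hat (zx z)) (b i.succ))).det with hmx
  set my := fun g : GIdx N N d → ℝ => (Matrix.of fun k (i : Fin N) =>
          g ⬝ᵥ krP (fun j => oo N d a j z) (fderiv ℝ (Fv N d a k) (hat (zy z)) (c i.succ))).det with hmy
  set C := (∏ k, (Real.sqrt (xi (d k) (a k) 1 ^ 2 - xi (d k) (a k) (rr z) ^ 2))⁻¹) *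
        ((nrm (zx z) * (nrm (zx z))⁻¹ ^ N) * (nrm (zy z) * (nrm (zy z))⁻¹ ^ N)) with hC
  have hC0 : 0 ≤ C := by
    have := nrm_pos hx
    have := nrm_pos hy
    refine mul_nonneg (Finset.prod_nonneg fun k _ => by positivity) (by positivity)
  have hpt : ∀ g, ENNReal.ofReal |(krM (fun j => fderiv ℝ (oo N d a j) z) (fun j => fderiv ℝ (nn N j) z)
        (krP (fun j => oo N d a j z) g)).det| ≤
        ENNReal.ofReal (C / 2) * (ENNReal.ofReal (mx g ^ 2) + ENNReal.ofReal (my g ^ 2)) := by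
    intro g
    rw [det_krM ha hz _ (krP_orth _ (kk N) (oo_orth ha hz) (kk_oo z) g)]
    unfold Amat
    rw [detA (zx z) hx _ b hb hb0, detA (zy z) hy _ c hc hc0]
    simp only [krP_adj]
    rw [← ENNReal.ofReal_add (sq_nonneg _) (sq_nonneg _), ← ENNReal.ofReal_mul (by positivity)]
    apply ENNReal.ofReal_le_ofReal
    change _ * (nrm (zx z) * ((nrm (zx z))⁻¹ ^ N * |mx g|) * (nrm (zy z) * ((nrm (zy z))⁻¹ ^ N * |my g|))) ≤ _
    have e : (∏ k, (Real.sqrt (xi (d k) (a k) 1 ^ 2 - xi (d k) (a k) (rr z) ^ 2))⁻¹) * (nrm (zx z) * ((nrm (zx z))⁻¹ ^ N * |mx g|) * (nrm (zy z) * ((nrm (zy z))⁻¹ ^ N * |my g|))) = C * (|mx g| * |my g|) := by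
      rw [hC]; ring
    rw [e, div_mul_eq_mul_div, mul_div_assoc]
    refine mul_le_mul_of_nonneg_left ?_ hC0
    rw [← sq_abs (mx g), ← sq_abs (my g)]
    nlinarith [sq_nonneg (|mx g| - |my g|)]
  refine (lintegral_mono hpt).trans ?_
  have hmm : ∀ (c : Fin N → Fin N → GIdx N N d → ℝ), Measurable fun g : GIdx N N d → ℝ =>
      ENNReal.ofReal ((Matrix.of fun k i => g ⬝ᵥ c k i).det ^ 2) := by
    intro c
    refine ENNReal.measurable_ofReal.comp ((Continuous.matrix_det ?_).pow 2).measurable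
    refine continuous_matrix fun i j => ?_
    simp only [Matrix.of_apply]
    unfold dotProduct; fun_prop
  have hmX : Measurable fun g => ENNReal.ofReal (mx g ^ 2) := hmm _
  have hmY : Measurable fun g => ENNReal.ofReal (my g ^ 2) := hmm _
  have hbI' : ∫⁻ g, ENNReal.ofReal (mx g ^ 2) ∂(GaussP N N d) = Q := hbI
  have hcI' : ∫⁻ g, ENNReal.ofReal (my g ^ 2) ∂(GaussP N N d) = Q := hcI
  have hmXY : Measurable fun g => ENNReal.ofReal (mx g ^ 2) + ENNReal.ofReal (my g ^ 2) := hmX.add hmY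
  rw [lintegral_const_mul _ hmXY, lintegral_add_left hmX, hbI', hcI']
  rw [← two_mul, ← mul_assoc]
  gcongr
  rw [show (2 : ℝ≥0∞) = ENNReal.ofReal 2 by simp, ← ENNReal.ofReal_mul (by positivity)]
  apply ENNReal.ofReal_le_ofReal
  linarith
end

section
open scoped Matrix
set_option linter.all false
variable {N : ℕ} {d : Fin N → ℕ} {a : Fin N → ℕ → ℝ}

/-- radial weight -/
def ww (N : ℕ) : ℝ → ℝ := (Set.Ioi (0 : ℝ)).indicator (gammaPDFReal (((N : ℝ) + 1) / 2) 1)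

lemma ww_nonneg (x : ℝ) : 0 ≤ ww N x :=
  Set.indicator_nonneg (fun x _ => gammaPDFReal_nonneg (by positivity) one_pos x) x

lemma measurable_ww : Measurable (ww N) := (measurable_gammaPDFReal _ _).indicator measurableSet_Ioi

lemma lintegral_ww : ∫⁻ x, ENNReal.ofReal (ww N x) = 1 := by
  rw [← lintegral_gammaPDF_eq_one (a := ((N : ℝ) + 1) / 2) (r := 1) (by positivity) one_pos]
  refine lintegral_congr_ae ?_
  have : ∀ᵐ x : ℝ, x ≠ 0 := by simp [ae_iff, measure_singleton]
  filter_upwards [this] with x hx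
  unfold ww gammaPDF
  by_cases h : 0 < x
  · rw [Set.indicator_of_mem (by exact h)]
  · rw [Set.indicator_of_notMem (by exact h), gammaPDFReal, if_neg (by
      intro h2; exact h (lt_of_le_of_ne h2 hx.symm))]

lemma integrable_ww : Integrable (ww N) := by
  refine ⟨measurable_ww.aestronglyMeasurable, ?_⟩
  rw [hasFiniteIntegral_iff_ofReal (Filter.Eventually.of_forall ww_nonneg), lintegral_ww]
  exact ENNReal.one_lt_top

/-- factors of the auxiliary density -/
def fJ (N : ℕ) : JJ N → ℝ → ℝ :=
  Sum.elim (Fin.cons (ww N) (fun _ => gaussianPDFReal 0 1))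
    (Fin.cons (ww N) (fun _ => gaussianPDFReal 0 1))

lemma fJ_ind {p : (ℝ → ℝ) → Prop} (h1 : p (ww N)) (h2 : p (gaussianPDFReal 0 1)) (j : JJ N) :
    p (fJ N j) := by
  rcases j with j | j <;> refine Fin.cases ?_ (fun k => ?_) j <;> simpa [fJ]

/-- the auxiliary density -/
def rhoJ (N : ℕ) (h : JJ N → ℝ) : ℝ≥0∞ := ∏ j, ENNReal.ofReal (fJ N j (h j))

lemma measurable_rhoJ : Measurable (rhoJ N) := by
  unfold rhoJ
  refine Finset.measurable_fun_prod _ fun j _ => ENNReal.measurable_ofReal.comp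
    (Measurable.comp ?_ (measurable_pi_apply j))
  exact fJ_ind (p := fun f => Measurable f) measurable_ww (measurable_gaussianPDFReal 0 1) j

lemma lintegral_rhoJ : ∫⁻ h, rhoJ N h = 1 := by
  unfold rhoJ
  rw [lintegral_pi_prod (fJ N)
    (fun j => fJ_ind (p := fun f => ∀ x, 0 ≤ f x) ww_nonneg (gaussianPDFReal_nonneg 0 1) j)
    (fun j => fJ_ind (p := fun f => Integrable f) integrable_ww (integrable_gaussianPDFReal 0 1) j)]
  refine Finset.prod_eq_one fun j _ => ?_
  refine fJ_ind (p := fun f => ∫⁻ x, ENNReal.ofReal (f x) = 1) lintegral_ww ?_ j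
  exact lintegral_gaussianPDF_eq_one 0 one_ne_zero

lemma rhoJ_ne_top (h : JJ N → ℝ) : rhoJ N h ≠ ⊤ :=
  ENNReal.prod_ne_top fun j _ => ENNReal.ofReal_ne_top

lemma rhoJ_pos {h : JJ N → ℝ} (hh : rhoJ N h ≠ 0) : 0 < h (Sum.inl 0) ∧ 0 < h (Sum.inr 0) := by
  unfold rhoJ at hh
  rw [Finset.prod_ne_zero_iff] at hh
  have key : ∀ x, ENNReal.ofReal (ww N x) ≠ 0 → 0 < x := by
    intro x hx
    by_contra h0
    apply hx
    rw [ww, Set.indicator_of_notMem (by exact h0)]; simp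
  exact ⟨key _ (by simpa [fJ] using hh (Sum.inl 0) (Finset.mem_univ _)),
    key _ (by simpa [fJ] using hh (Sum.inr 0) (Finset.mem_univ _))⟩

lemma measurable_rr : Measurable (rr (N := N)) := by
  unfold rr dotProduct
  refine Finset.measurable_fun_sum _ fun i _ => ?_
  exact ((measurable_pi_apply i).comp (measurable_hat.comp continuous_zx.measurable)).mul
    ((measurable_pi_apply i).comp (measurable_hat.comp continuous_zy.measurable))

lemma measurable_oo (j : JJ N) : Measurable (oo N d a j) := by
  have hx := fun k => (measurable_Gv (d := d) (a := a) k).comp (continuous_zx (N := N)).measurable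
  have hy := fun k => (measurable_Gv (d := d) (a := a) k).comp (continuous_zy (N := N)).measurable
  have hxi := fun k => (contDiff_xi (d k) (a k)).continuous.measurable.comp (measurable_rr (N := N))
  rcases j with j | j <;> refine Fin.cases ?_ (fun k => ?_) j
  · exact measurable_const
  · exact (hx k).const_smul ((Real.sqrt (xi (d k) (a k) 1))⁻¹)
  · exact measurable_const
  · change Measurable (oY N d a k)
    unfold oY sg
    have m1 : Measurable fun z : JJ N → ℝ => Gv N d a k (zx z) := hx k
    have m2 : Measurable fun z : JJ N → ℝ => Gv N d a k (zy z) := hy k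
    have m3 : Measurable fun z : JJ N → ℝ => xi (d k) (a k) (rr z) := hxi k
    fun_prop

lemma measurable_nn (j : JJ N) : Measurable (nn N j) :=
  (Differentiable.continuous fun z => diff_nn z j).measurable

lemma hausdorff_zero_le_encard {X : Type*} [EMetricSpace X] [MeasurableSpace X] [BorelSpace X]
    (A : Set X) : μH[0] A ≤ (A.encard : ℝ≥0∞) := by
  by_cases hA : A.Finite
  · calc μH[0] A = μH[0] (⋃ x ∈ hA.toFinset, {x}) := by congr 1; ext; simp
      _ ≤ ∑ x ∈ hA.toFinset, μH[0] {x} := measure_biUnion_finset_le _ _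
      _ = (A.encard : ℝ≥0∞) := by
        simp only [Measure.hausdorffMeasure_zero_singleton]
        rw [hA.encard_eq_coe_toFinset_card]; simp
  · rw [Set.not_finite.mp hA |>.encard_eq]; simp

/-- configurations with correlation in `I` -/
def SS (N : ℕ) (I : Set ℝ) : Set (JJ N → ℝ) := {z | z ∈ UU N ∧ rr z ∈ I}

lemma measurableSet_SS {I : Set ℝ} (hI : MeasurableSet I) : MeasurableSet (SS N I) :=
  isOpen_UU.measurableSet.inter (measurable_rr hI)

lemma hat_smul_unit {n : ℕ} {x : Fin n → ℝ} (hx : x ⬝ᵥ x = 1) {c : ℝ} (hc : 0 < c) :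
    hat (c • x) = x := by
  unfold hat nrm
  rw [smul_dotProduct, dotProduct_smul, hx, smul_eq_mul, smul_eq_mul, mul_one,
    Real.sqrt_mul_self hc.le, smul_smul, inv_mul_cancel₀ hc.ne', one_smul]

lemma count_le {I : Set ℝ} (hI : I ⊆ Set.Ioo (-1) 1) (g : GIdx N N d → ℝ) (h : JJ N → ℝ)
    (hh : rhoJ N h ≠ 0) :
    Znk2 N N d a g I ≤ ({z ∈ SS N I | ∀ j, g ⬝ᵥ oo N d a j z = 0 ∧
      (kk N j = 0 → nn N j z = h j)}.encard : ℝ≥0∞) := by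
  obtain ⟨hs, ht⟩ := rhoJ_pos hh
  unfold Znk2
  rw [sub_self, mul_zero]
  refine (hausdorff_zero_le_encard _).trans ?_
  set s := h (Sum.inl 0)
  set t := h (Sum.inr 0)
  have hs2 : 0 < Real.sqrt (2 * s) := by positivity
  have ht2 : 0 < Real.sqrt (2 * t) := by positivity
  let Φ : PairSpace N → JJ N → ℝ := fun z => Sum.elim
    (Real.sqrt (2 * s) • fun i => (WithLp.equiv 2 _ z).1 i)
    (Real.sqrt (2 * t) • fun i => (WithLp.equiv 2 _ z).2 i)
  have hΦ : Function.Injective Φ := by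
    intro z z' hz
    apply (WithLp.equiv 2 _).injective
    refine Prod.ext ?_ ?_
    · ext i
      have := congrFun hz (Sum.inl i)
      simpa [Φ, (Real.sqrt_pos.2 hs).ne'] using this
    · ext i
      have := congrFun hz (Sum.inr i)
      simpa [Φ, (Real.sqrt_pos.2 ht).ne'] using this
  rw [← hΦ.injOn.encard_image]
  norm_cast
  refine Set.encard_le_encard ?_
  rintro _ ⟨z, hz, rfl⟩
  obtain ⟨hx, hy, hr, hf⟩ := hz
  set x : Fin (N + 1) → ℝ := fun i => (WithLp.equiv 2 _ z).1 i with hxd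
  set y : Fin (N + 1) → ℝ := fun i => (WithLp.equiv 2 _ z).2 i with hyd
  have hx1 : x ⬝ᵥ x = 1 := by
    rw [EuclideanSpace.norm_eq, Real.sqrt_eq_one] at hx
    rw [← hx]; simp [dotProduct, hxd, sq]
  have hy1 : y ⬝ᵥ y = 1 := by
    rw [EuclideanSpace.norm_eq, Real.sqrt_eq_one] at hy
    rw [← hy]; simp [dotProduct, hyd, sq]
  have ezx : zx (Φ z) = Real.sqrt (2 * s) • x := rfl
  have ezy : zy (Φ z) = Real.sqrt (2 * t) • y := rfl
  have ehx : hat (zx (Φ z)) = x := by rw [ezx, hat_smul_unit hx1 hs2]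
  have ehy : hat (zy (Φ z)) = y := by rw [ezy, hat_smul_unit hy1 ht2]
  have er : rr (Φ z) ∈ I := by rw [rr, ehx, ehy]; exact hr
  have hx0 : x ≠ 0 := by rintro h0; rw [h0] at hx1; simp at hx1
  have hy0 : y ≠ 0 := by rintro h0; rw [h0] at hy1; simp at hy1
  have gX : ∀ k, g ⬝ᵥ Gv N d a k (zx (Φ z)) = 0 := fun k => by
    rw [Gv, ehx, ← rf_eq_dot]; exact (hf k).1
  have gY : ∀ k, g ⬝ᵥ Gv N d a k (zy (Φ z)) = 0 := fun k => by
    rw [Gv, ehy, ← rf_eq_dot]; exact (hf k).2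
  refine ⟨⟨⟨?_, ?_, ?_⟩, er⟩, fun j => ?_⟩
  · rw [ezx]; exact smul_ne_zero hs2.ne' hx0
  · rw [ezy]; exact smul_ne_zero ht2.ne' hy0
  · have := hI er
    nlinarith [this.1, this.2]
  · rcases j with j | j <;> refine Fin.cases ?_ (fun k => ?_) j
    · refine ⟨by simp [oo], fun _ => ?_⟩
      simp only [nn, Sum.elim_inl, Fin.cons_zero]
      rw [ezx, smul_dotProduct, dotProduct_smul, hx1, smul_eq_mul, smul_eq_mul, mul_one,
        Real.mul_self_sqrt (by positivity)]
      change 2 * s / 2 = s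
      ring
    · refine ⟨?_, fun h0 => by simp [kk] at h0⟩
      simp [oo, oX, gX]
    · refine ⟨by simp [oo], fun _ => ?_⟩
      simp only [nn, Sum.elim_inr, Fin.cons_zero]
      rw [ezy, smul_dotProduct, dotProduct_smul, hy1, smul_eq_mul, smul_eq_mul, mul_one,
        Real.mul_self_sqrt (by positivity)]
      change 2 * t / 2 = t
      ring
    · refine ⟨?_, fun h0 => by simp [kk] at h0⟩
      simp [oo, oY, gX, gY, dotProduct_sub]

lemma dens_eq (ha : ∀ k, ∃ p ∈ Finset.Icc 2 (d k), a k p ≠ 0) {z : JJ N → ℝ} (hz : z ∈ UU N)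
    (g : GIdx N N d → ℝ) :
    gPdf _ (krP (fun j => oo N d a j z) g) * rhoJ N (fun j => g ⬝ᵥ oo N d a j z + nn N j z) =
      ENNReal.ofReal ((2 * Real.pi)⁻¹ ^ N *
        (ww N ((zx z ⬝ᵥ zx z) / 2) * ww N ((zy z ⬝ᵥ zy z) / 2))) * gPdf _ g := by
  rw [gPdf_eq, gPdf_eq, krP_dot _ (kk N) (oo_orth ha hz) (kk_oo z)]
  unfold rhoJ
  rw [Fintype.prod_sum_type, Fin.prod_univ_succ, Fin.prod_univ_succ,
    Fintype.sum_sum_type, Fin.sum_univ_succ, Fin.sum_univ_succ]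
  have e1 : ∀ k : Fin N, nn N (Sum.inl k.succ) z = 0 := fun k => rfl
  have e2 : ∀ k : Fin N, nn N (Sum.inr k.succ) z = 0 := fun k => rfl
  have e3 : oo N d a (Sum.inl 0) z = 0 := rfl
  have e4 : oo N d a (Sum.inr 0) z = 0 := rfl
  have e5 : nn N (Sum.inl 0) z = (zx z ⬝ᵥ zx z) / 2 := rfl
  have e6 : nn N (Sum.inr 0) z = (zy z ⬝ᵥ zy z) / 2 := rfl
  have e7 : fJ N (Sum.inl 0) = ww N := rfl
  have e8 : fJ N (Sum.inr 0) = ww N := rfl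
  have e9 : ∀ k : Fin N, fJ N (Sum.inl k.succ) = gaussianPDFReal 0 1 := fun k => rfl
  have e10 : ∀ k : Fin N, fJ N (Sum.inr k.succ) = gaussianPDFReal 0 1 := fun k => rfl
  simp only [e1, e2, e3, e4, e5, e6, e7, e8, e9, e10, add_zero, zero_add, dotProduct_zero, zero_mul]
  rw [← ENNReal.ofReal_prod_of_nonneg fun i _ => gaussianPDFReal_nonneg 0 1 _,
    ← ENNReal.ofReal_prod_of_nonneg fun i _ => gaussianPDFReal_nonneg 0 1 _]
  have hp : ∀ v : Fin N → ℝ, ∏ i, gaussianPDFReal 0 1 (v i) =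
      (Real.sqrt (2 * Real.pi))⁻¹ ^ N * Real.exp (-(∑ i, v i * v i) / 2) := by
    intro v
    unfold gaussianPDFReal
    rw [Finset.prod_mul_distrib, Finset.prod_const, ← Real.exp_sum]
    simp only [Finset.card_univ, Fintype.card_fin, NNReal.coe_one, mul_one, sub_zero]
    congr 2
    rw [← Finset.sum_div, Finset.sum_neg_distrib]
    simp only [sq]
  rw [hp, hp]
  have w1 := ww_nonneg (N := N) ((zx z ⬝ᵥ zx z) / 2)
  have w2 := ww_nonneg (N := N) ((zy z ⬝ᵥ zy z) / 2)
  set A := ∑ i : Fin N, g ⬝ᵥ oo N d a (Sum.inl i.succ) z * g ⬝ᵥ oo N d a (Sum.inl i.succ) z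
  set B := ∑ i : Fin N, g ⬝ᵥ oo N d a (Sum.inr i.succ) z * g ⬝ᵥ oo N d a (Sum.inr i.succ) z
  rw [← ENNReal.ofReal_mul w1, ← ENNReal.ofReal_mul w2, ← ENNReal.ofReal_mul (by positivity),
    ← ENNReal.ofReal_mul (by positivity), ← ENNReal.ofReal_mul (by positivity)]
  congr 1
  have hsq : (2 * Real.pi)⁻¹ = (Real.sqrt (2 * Real.pi))⁻¹ * (Real.sqrt (2 * Real.pi))⁻¹ := by
    rw [← mul_inv, Real.mul_self_sqrt (by positivity)]
  have hex : Real.exp (-(g ⬝ᵥ g) / 2) = Real.exp (-(g ⬝ᵥ g - (A + B)) / 2) * Real.exp (-A / 2) *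
      Real.exp (-B / 2) := by
    rw [← Real.exp_add, ← Real.exp_add]; congr 1; ring
  rw [hsq, hex, mul_pow]
  ring

/-- Kac-Rice upper bound -/
lemma kr_bound (hN : 1 ≤ N) (ha : ∀ k, ∃ p ∈ Finset.Icc 2 (d k), a k p ≠ 0) {I : Set ℝ}
    (hIm : MeasurableSet I) (hI : I ⊆ Set.Ioo (-1) 1) :
    ∫⁻ g, Znk2 N N d a g I ∂(GaussP N N d) ≤ 2 * ∫⁻ z in SS N I,
      ENNReal.ofReal ((2 * Real.pi)⁻¹ ^ N *
        (ww N ((zx z ⬝ᵥ zx z) / 2) * ww N ((zy z ⬝ᵥ zy z) / 2))) *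
      (ENNReal.ofReal ((∏ k, (Real.sqrt (xi (d k) (a k) 1 ^ 2 - xi (d k) (a k) (rr z) ^ 2))⁻¹) *
        (nrm (zx z) * (nrm (zx z))⁻¹ ^ N * (nrm (zy z) * (nrm (zy z))⁻¹ ^ N))) *
      ENNReal.ofReal (((N - 1).factorial : ℝ) *
        ((∑ k, lam (d k) (a k) (rr z)) * ∏ k, xi' (d k) (a k) 1))) := by
  classical
  have hgt : ∀ g, gPdf (GIdx N N d) g ≠ ⊤ := fun g => by rw [gPdf_eq]; exact ENNReal.ofReal_ne_top
  have hconv : ∀ f : (GIdx N N d → ℝ) → ℝ≥0∞, ∫⁻ g, f g ∂(GaussP N N d) =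
      ∫⁻ g, gPdf _ g * f g := by
    intro f
    rw [GaussP, pi_gauss, lintegral_withDensity_eq_lintegral_mul_non_measurable _
      (measurable_gPdf _) (Filter.Eventually.of_forall fun g => (hgt g).lt_top)]
    rfl
  have key := kac_rice (o := oo N d a) (n := nn N) (o' := fun z j => fderiv ℝ (oo N d a j) z)
    (n' := fun z j => fderiv ℝ (nn N j) z) (κ := kk N) (S := SS N I) (measurableSet_SS hIm)
    measurable_oo measurable_nn (fun z hz j => (diff_oo ha hz.1 j).hasFDerivAt)
    (fun z hz j => (diff_nn z j).hasFDerivAt) (fun z hz => oo_orth ha hz.1)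
    (fun z hz => oo_skew ha hz.1) (by
      intro j
      rcases j with j | j <;> refine Fin.cases ?_ (fun k => ?_) j
      · left; rfl
      · right; exact ⟨rfl, fun z => rfl, fun z => (fderiv_nn z 0).2.2.1 k⟩
      · left; rfl
      · right; exact ⟨rfl, fun z => rfl, fun z => (fderiv_nn z 0).2.2.2 k⟩)
    (measurable_gPdf _) hgt measurable_rhoJ rhoJ_ne_top (fun g => Znk2 N N d a g I)
    (fun g h hh => count_le hI g h hh)
  rw [lintegral_rhoJ, one_mul, ← hconv] at key
  refine key.trans ?_
  refine mul_le_mul_right (setLIntegral_mono' (measurableSet_SS hIm) fun z hz => ?_) _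
  simp_rw [dens_eq ha hz.1, mul_assoc (ENNReal.ofReal ((2 * Real.pi)⁻¹ ^ N * _))]
  rw [lintegral_const_mul' _ _ ENNReal.ofReal_ne_top]
  refine mul_le_mul_right ?_ _
  rw [← hconv]
  exact moment_bound hN ha hz.1
end

section
open scoped Matrix
set_option linter.all false

lemma vec_int {N : ℕ} (hN : 1 ≤ N) {b : ℝ} (hb : 0 < b) :
    ∫⁻ v : Fin N → ℝ, ENNReal.ofReal (nrm v * Real.exp (-b * (v ⬝ᵥ v))) =
      ENNReal.ofReal (N * (Real.sqrt Real.pi ^ N / Real.Gamma (N / 2 + 1)) *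
        (b ^ (-((N : ℝ) + 1) / 2) * (1 / 2) * Real.Gamma (((N : ℝ) + 1) / 2))) := by
  haveI : Nonempty (Fin N) := ⟨⟨0, hN⟩⟩
  have e1 : ∀ v : EuclideanSpace ℝ (Fin N), nrm (WithLp.ofLp v) = ‖v‖ := by
    intro v
    rw [EuclideanSpace.norm_eq, nrm]
    simp [dotProduct, sq]
  have hmp := PiLp.volume_preserving_ofLp (Fin N)
  rw [← hmp.lintegral_comp_emb (MeasurableEquiv.toLp 2 (Fin N → ℝ)).symm.measurableEmbedding]
  have e2 : ∀ v : EuclideanSpace ℝ (Fin N), nrm (WithLp.ofLp v) *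
      Real.exp (-b * (WithLp.ofLp v ⬝ᵥ WithLp.ofLp v)) =
      (fun r : ℝ => r * Real.exp (-b * r ^ 2)) ‖v‖ := by
    intro v
    simp only
    rw [← e1, nrm_sq]
  simp_rw [e2]
  have hfr : Module.finrank ℝ (EuclideanSpace ℝ (Fin N)) = N := by simp
  have hpow : ∀ y ∈ Set.Ioi (0 : ℝ), y ^ (N - 1) • (y * Real.exp (-b * y ^ 2)) =
      y ^ (N : ℝ) * Real.exp (-b * y ^ (2 : ℝ)) := by
    intro y hy
    rw [Real.rpow_natCast, smul_eq_mul, ← mul_assoc, ← pow_succ, Nat.sub_add_cancel hN,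
      show (2 : ℝ) = ((2 : ℕ) : ℝ) by norm_num, Real.rpow_natCast]
  have hInt : Integrable (fun v : EuclideanSpace ℝ (Fin N) =>
      (fun r : ℝ => r * Real.exp (-b * r ^ 2)) ‖v‖) := by
    refine (integrable_fun_norm_addHaar volume (f := fun r : ℝ => r * Real.exp (-b * r ^ 2))).2 ?_
    rw [hfr]
    refine (integrableOn_congr_fun (fun y hy => ?_) measurableSet_Ioi).2
      (integrableOn_rpow_mul_exp_neg_mul_sq hb (s := N) (by
        have : (0 : ℝ) ≤ N := by positivity
        linarith))
    rw [hpow y hy, Real.rpow_two]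
  rw [← ofReal_integral_eq_lintegral_ofReal hInt (Filter.Eventually.of_forall fun v => by
    simp only [Pi.zero_apply]; positivity)]
  have hpol := integral_fun_norm_addHaar (volume : Measure (EuclideanSpace ℝ (Fin N)))
    (fun r : ℝ => r * Real.exp (-b * r ^ 2))
  rw [hpol, hfr, setIntegral_congr_fun measurableSet_Ioi hpow,
    integral_rpow_mul_exp_neg_mul_rpow (by norm_num) (by
        have : (0 : ℝ) ≤ N := by positivity
        linarith) hb, measureReal_def, EuclideanSpace.volume_ball]
  simp only [Fintype.card_fin, ENNReal.ofReal_one, one_pow, one_mul]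
  have hG : 0 < Real.Gamma (N / 2 + 1) := Real.Gamma_pos_of_pos (by positivity)
  rw [ENNReal.toReal_ofReal (by positivity)]
  simp only [smul_eq_mul, nsmul_eq_mul]
  congr 1
  ring

lemma line_int {s : ℝ} (hs : 0 < s) (φ : ℝ → ℝ≥0∞) :
    ∫⁻ t : ℝ, ENNReal.ofReal (Real.exp (-(t ^ 2 + s ^ 2) / 2)) * φ (t / Real.sqrt (t ^ 2 + s ^ 2)) =
      ∫⁻ r in Set.Ioo (-1 : ℝ) 1, ENNReal.ofReal ((Real.sqrt (1 - r ^ 2) ^ 3)⁻¹) *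
        (ENNReal.ofReal (s * Real.exp (-(1 / (2 * (1 - r ^ 2))) * s ^ 2)) * φ r) := by
  set f : ℝ → ℝ := fun r => s * (r * (Real.sqrt (1 - r ^ 2))⁻¹) with hf
  have hq : ∀ r ∈ Set.Ioo (-1 : ℝ) 1, 0 < 1 - r ^ 2 := fun r hr => by nlinarith [hr.1, hr.2]
  have hfs : ∀ r ∈ Set.Ioo (-1 : ℝ) 1, f r ^ 2 + s ^ 2 = s ^ 2 * (1 - r ^ 2)⁻¹ := by
    intro r hr
    have h1 := hq r hr
    rw [hf]; simp only
    rw [mul_pow, mul_pow, inv_pow, Real.sq_sqrt h1.le]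
    field_simp
    ring
  have hfr : ∀ r ∈ Set.Ioo (-1 : ℝ) 1, f r / Real.sqrt (f r ^ 2 + s ^ 2) = r := by
    intro r hr
    have h1 := hq r hr
    rw [hfs r hr, Real.sqrt_mul (by positivity), Real.sqrt_sq hs.le, Real.sqrt_inv]
    have h2 : 0 < Real.sqrt (1 - r ^ 2) := Real.sqrt_pos.2 h1
    rw [hf]; simp only
    field_simp
  have hinj : Set.InjOn f (Set.Ioo (-1) 1) := by
    intro r hr r' hr' h
    rw [← hfr r hr, ← hfr r' hr', h]
  have himg : f '' Set.Ioo (-1) 1 = Set.univ := by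
    refine Set.eq_univ_of_forall fun t => ⟨t / Real.sqrt (t ^ 2 + s ^ 2), ?_, ?_⟩
    · have h1 : 0 < t ^ 2 + s ^ 2 := by positivity
      have : |t| < Real.sqrt (t ^ 2 + s ^ 2) := by
        rw [← Real.sqrt_sq_eq_abs]
        exact Real.sqrt_lt_sqrt (sq_nonneg _) (by nlinarith)
      have h3 := Real.sqrt_pos.2 h1
      rw [abs_lt] at this
      constructor
      · rw [lt_div_iff₀ h3]; linarith
      · rw [div_lt_iff₀ h3]; linarith
    · have h1 : 0 < t ^ 2 + s ^ 2 := by positivity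
      have h3 := Real.sqrt_pos.2 h1
      have : 1 - (t / Real.sqrt (t ^ 2 + s ^ 2)) ^ 2 = s ^ 2 / (t ^ 2 + s ^ 2) := by
        rw [div_pow, Real.sq_sqrt h1.le]; field_simp; ring
      rw [hf]; simp only
      rw [this, Real.sqrt_div (sq_nonneg _), Real.sqrt_sq hs.le]
      field_simp
  have hder : ∀ r ∈ Set.Ioo (-1 : ℝ) 1,
      HasDerivWithinAt f (s * (Real.sqrt (1 - r ^ 2) ^ 3)⁻¹) (Set.Ioo (-1) 1) r := by
    intro r hr
    have h1 := hq r hr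
    have h2 : 0 < Real.sqrt (1 - r ^ 2) := Real.sqrt_pos.2 h1
    have d1 : HasDerivAt (fun r : ℝ => 1 - r ^ 2) (-(2 * r)) r := by
      simpa using (hasDerivAt_pow 2 r).const_sub 1
    have d2 := ((hasDerivAt_id r).mul ((d1.sqrt h1.ne').fun_inv h2.ne')).const_mul s
    refine HasDerivAt.hasDerivWithinAt ?_
    refine d2.congr_deriv ?_
    congr 1
    have h3 : Real.sqrt (1 - r ^ 2) ^ 2 = 1 - r ^ 2 := Real.sq_sqrt h1.le
    set q := Real.sqrt (1 - r ^ 2)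
    simp only [id]
    field_simp
    nlinarith
  have key := lintegral_image_eq_lintegral_abs_deriv_mul measurableSet_Ioo hder hinj
    (fun t => ENNReal.ofReal (Real.exp (-(t ^ 2 + s ^ 2) / 2)) * φ (t / Real.sqrt (t ^ 2 + s ^ 2)))
  rw [himg, setLIntegral_univ] at key
  rw [key]
  refine setLIntegral_congr_fun measurableSet_Ioo fun r hr => ?_
  have h1 := hq r hr
  rw [hfr r hr, hfs r hr, ← mul_assoc, ← mul_assoc]
  congr 1
  have h2 : 0 < Real.sqrt (1 - r ^ 2) := Real.sqrt_pos.2 h1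
  rw [abs_of_pos (by positivity), ← ENNReal.ofReal_mul (by positivity),
    ← ENNReal.ofReal_mul (by positivity)]
  congr 1
  have : -(s ^ 2 * (1 - r ^ 2)⁻¹) / 2 = -(1 / (2 * (1 - r ^ 2))) * s ^ 2 := by
    field_simp
  rw [this]; ring

/-- radial constant -/
def DN (N : ℕ) : ℝ := N * (Real.sqrt Real.pi ^ N / Real.Gamma (N / 2 + 1)) *
  (Real.sqrt 2 ^ (N + 1) * (1 / 2) * Real.Gamma (((N : ℝ) + 1) / 2))

lemma slice_int {N : ℕ} (hN : 1 ≤ N) {φ : ℝ → ℝ≥0∞} (hφ : Measurable φ) :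
    ∫⁻ u : Fin (N + 1) → ℝ, ENNReal.ofReal (Real.exp (-(u ⬝ᵥ u) / 2)) * φ (u 0 / nrm u) =
      ENNReal.ofReal (DN N) * ∫⁻ r in Set.Ioo (-1 : ℝ) 1,
        ENNReal.ofReal (Real.sqrt (1 - r ^ 2) ^ N / (1 - r ^ 2)) * φ r := by
  have hmp := (volume_preserving_piFinSuccAbove (fun _ : Fin (N + 1) => ℝ) 0).symm
  rw [← hmp.lintegral_comp_emb (MeasurableEquiv.measurableEmbedding _)]
  have hdot : ∀ p : ℝ × (Fin N → ℝ), (Fin.cons p.1 p.2 : Fin (N + 1) → ℝ) ⬝ᵥ Fin.cons p.1 p.2 =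
      p.1 ^ 2 + nrm p.2 ^ 2 := by
    intro p
    rw [nrm_sq]
    simp [dotProduct, Fin.sum_univ_succ, sq]
  have hsymm : ∀ p : ℝ × (Fin N → ℝ),
      (MeasurableEquiv.piFinSuccAbove (fun _ : Fin (N + 1) => ℝ) 0).symm p = Fin.cons p.1 p.2 := by
    intro p
    simp [MeasurableEquiv.piFinSuccAbove, Fin.insertNthEquiv]
  have e1 : ∀ p : ℝ × (Fin N → ℝ), ENNReal.ofReal (Real.exp
      (-((MeasurableEquiv.piFinSuccAbove (fun _ : Fin (N + 1) => ℝ) 0).symm p ⬝ᵥ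
        (MeasurableEquiv.piFinSuccAbove (fun _ : Fin (N + 1) => ℝ) 0).symm p) / 2)) *
      φ ((MeasurableEquiv.piFinSuccAbove (fun _ : Fin (N + 1) => ℝ) 0).symm p 0 /
        nrm ((MeasurableEquiv.piFinSuccAbove (fun _ : Fin (N + 1) => ℝ) 0).symm p)) =
      ENNReal.ofReal (Real.exp (-(p.1 ^ 2 + nrm p.2 ^ 2) / 2)) *
        φ (p.1 / Real.sqrt (p.1 ^ 2 + nrm p.2 ^ 2)) := by
    intro p
    have hn : nrm (Fin.cons p.1 p.2 : Fin (N + 1) → ℝ) = Real.sqrt (p.1 ^ 2 + nrm p.2 ^ 2) := by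
      rw [← hdot]; rfl
    rw [hsymm, hdot, hn, Fin.cons_zero]
  simp_rw [e1]
  have hmn := measurable_nrm (n := N)
  have hmeas : Measurable fun p : ℝ × (Fin N → ℝ) =>
      ENNReal.ofReal (Real.exp (-(p.1 ^ 2 + nrm p.2 ^ 2) / 2)) *
        φ (p.1 / Real.sqrt (p.1 ^ 2 + nrm p.2 ^ 2)) := by fun_prop
  change ∫⁻ p : ℝ × (Fin N → ℝ), _ ∂(volume.prod volume) = _
  rw [lintegral_prod_symm _ hmeas.aemeasurable]
  haveI : Nonempty (Fin N) := ⟨⟨0, hN⟩⟩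
  have hae : ∀ᵐ v : Fin N → ℝ, v ≠ 0 := by simp [ae_iff, measure_singleton]
  have step : ∫⁻ v : Fin N → ℝ, ∫⁻ t : ℝ, ENNReal.ofReal (Real.exp (-(t ^ 2 + nrm v ^ 2) / 2)) *
        φ (t / Real.sqrt (t ^ 2 + nrm v ^ 2)) =
      ∫⁻ v : Fin N → ℝ, ∫⁻ r in Set.Ioo (-1 : ℝ) 1, ENNReal.ofReal ((Real.sqrt (1 - r ^ 2) ^ 3)⁻¹) *
        (ENNReal.ofReal (nrm v * Real.exp (-(1 / (2 * (1 - r ^ 2))) * nrm v ^ 2)) * φ r) := by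
    refine lintegral_congr_ae ?_
    filter_upwards [hae] with v hv
    exact line_int (nrm_pos hv) φ
  rw [step, lintegral_lintegral_swap (Measurable.aemeasurable (by fun_prop)),
    ← lintegral_const_mul _ (by fun_prop)]
  refine setLIntegral_congr_fun measurableSet_Ioo fun r hr => ?_
  have h1 : 0 < 1 - r ^ 2 := by nlinarith [hr.1, hr.2]
  have h2 : 0 < Real.sqrt (1 - r ^ 2) := Real.sqrt_pos.2 h1
  rw [lintegral_const_mul _ (by fun_prop), lintegral_mul_const _ (by fun_prop), ← mul_assoc,
    ← mul_assoc]
  congr 1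
  simp_rw [nrm_sq]
  rw [vec_int hN (by positivity)]
  have hD : 0 ≤ DN N := by
    have := Real.Gamma_pos_of_pos (s := (N : ℝ) / 2 + 1) (by positivity)
    have := Real.Gamma_pos_of_pos (s := ((N : ℝ) + 1) / 2) (by positivity)
    unfold DN; positivity
  rw [← ENNReal.ofReal_mul (by positivity), ← ENNReal.ofReal_mul hD]
  congr 1
  have hb : (1 / (2 * (1 - r ^ 2))) ^ (-((N : ℝ) + 1) / 2) =
      Real.sqrt 2 ^ (N + 1) * Real.sqrt (1 - r ^ 2) ^ (N + 1) := by
    have e : 1 / (2 * (1 - r ^ 2)) = (Real.sqrt 2 * Real.sqrt (1 - r ^ 2)) ^ (-2 : ℝ) := by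
      rw [Real.rpow_neg (by positivity), show (2 : ℝ) = ((2 : ℕ) : ℝ) by norm_num,
        Real.rpow_natCast, mul_pow, Real.sq_sqrt h1.le]
      norm_num
    rw [e, ← Real.rpow_mul (by positivity), ← mul_pow,
      ← Real.rpow_natCast (Real.sqrt 2 * Real.sqrt (1 - r ^ 2)) (N + 1)]
    congr 1
    push_cast
    ring
  rw [hb, DN]
  have h3 : Real.sqrt (1 - r ^ 2) ^ 2 = 1 - r ^ 2 := Real.sq_sqrt h1.le
  rw [← h3]
  rw [Real.sqrt_sq h2.le]
  set q := Real.sqrt (1 - r ^ 2)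
  have hq : (q ^ 3)⁻¹ * q ^ (N + 1) = q ^ N / q ^ 2 := by
    field_simp
    ring
  linear_combination (N * (Real.sqrt Real.pi ^ N / Real.Gamma (N / 2 + 1)) *
    (Real.sqrt 2 ^ (N + 1) * (1 / 2) * Real.Gamma (((N : ℝ) + 1) / 2))) * hq
end

section
open scoped Matrix
set_option linter.all false
variable {N : ℕ} {d : Fin N → ℕ} {a : Fin N → ℕ → ℝ}

lemma exists_frame (hN : 1 ≤ N) {x : Fin (N + 1) → ℝ} (hx : x ⬝ᵥ x = 1) :
    ∃ b : Fin (N + 1) → Fin (N + 1) → ℝ, (∀ i j, b i ⬝ᵥ b j = if i = j then 1 else 0) ∧ b 0 = x := by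
  obtain ⟨M, rfl⟩ : ∃ M, N = M + 1 := ⟨N - 1, by omega⟩
  have hle : x 0 * x 0 + x 1 * x 1 ≤ 1 := by
    rw [← hx, dotProduct, Fin.sum_univ_succ, Fin.sum_univ_succ]
    have : 0 ≤ ∑ i : Fin M, x i.succ.succ * x i.succ.succ :=
      Finset.sum_nonneg fun i _ => mul_self_nonneg _
    have e : (Fin.succ 0 : Fin (M + 1 + 1)) = 1 := rfl
    rw [e]
    linarith
  by_cases h0 : x 0 ^ 2 < 1
  · obtain ⟨b, hb, hb0, -⟩ := basis_exists hN x (Pi.single 0 1) hx (by simp) (by simpa using h0)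
    exact ⟨b, hb, hb0⟩
  · obtain ⟨b, hb, hb0, -⟩ := basis_exists hN x (Pi.single 1 1) hx (by simp) (by
      simp only [dotProduct_single, mul_one]; nlinarith)
    exact ⟨b, hb, hb0⟩

lemma rot_int (hN : 1 ≤ N) {x : Fin (N + 1) → ℝ} (hx : x ⬝ᵥ x = 1) {φ : ℝ → ℝ≥0∞}
    (hφ : Measurable φ) :
    ∫⁻ y : Fin (N + 1) → ℝ, ENNReal.ofReal (Real.exp (-(y ⬝ᵥ y) / 2)) * φ (x ⬝ᵥ hat y) =
      ENNReal.ofReal (DN N) * ∫⁻ r in Set.Ioo (-1 : ℝ) 1,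
        ENNReal.ofReal (Real.sqrt (1 - r ^ 2) ^ N / (1 - r ^ 2)) * φ r := by
  obtain ⟨b, hb, hb0⟩ := exists_frame hN hx
  set Q : Matrix (Fin (N + 1)) (Fin (N + 1)) ℝ := Matrix.of b with hQ
  have hQQ : Q * Qᵀ = 1 := by
    ext i j
    rw [Matrix.mul_apply_eq_vecMul, Matrix.one_apply, ← hb i j]
    rfl
  have hQQ' : Qᵀ * Q = 1 := mul_eq_one_comm.1 hQQ
  have hdet : Q.det * Q.det = 1 := by
    have := congrArg Matrix.det hQQ
    rwa [Matrix.det_mul, Matrix.det_transpose, Matrix.det_one] at this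
  have hdet0 : Q.det ≠ 0 := by rintro h; rw [h] at hdet; simp at hdet
  have habs : |Q.det⁻¹| = 1 := by
    rw [abs_inv, inv_eq_one]
    rw [← abs_mul_abs_self] at hdet
    nlinarith [abs_nonneg Q.det]
  have hmap := Real.map_matrix_volume_pi_eq_smul_volume_pi hdet0
  rw [habs, ENNReal.ofReal_one, one_smul] at hmap
  have hdot : ∀ y, Matrix.toLin' Q y ⬝ᵥ Matrix.toLin' Q y = y ⬝ᵥ y := by
    intro y
    rw [Matrix.toLin'_apply, Matrix.dotProduct_mulVec, Matrix.vecMul_mulVec, ← Matrix.mulVec_transpose,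
      Matrix.transpose_mul, Matrix.transpose_transpose, hQQ', Matrix.one_mulVec]
  rw [← slice_int hN hφ]
  conv_rhs => rw [← hmap]
  have hmn := measurable_nrm (n := N + 1)
  rw [lintegral_map]
  · refine lintegral_congr fun y => ?_
    rw [hdot, nrm, hdot]
    congr 2
    rw [Matrix.toLin'_apply]
    change _ = (b 0 ⬝ᵥ y) / nrm y
    rw [hb0, hat, dotProduct_smul, smul_eq_mul]
    field_simp
  · unfold dotProduct; fun_prop
  · exact (LinearMap.continuous_of_finiteDimensional _).measurable

lemma gauss_total (n : ℕ) : ∫⁻ x : Fin n → ℝ, ENNReal.ofReal (Real.exp (-(x ⬝ᵥ x) / 2)) =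
    ENNReal.ofReal (Real.sqrt (2 * Real.pi) ^ n) := by
  have h1 : ∫⁻ x : Fin n → ℝ, gPdf (Fin n) x = 1 := by
    have : (volume.withDensity (gPdf (Fin n))) Set.univ = 1 := by
      rw [← pi_gauss]; exact measure_univ
    rwa [withDensity_apply _ MeasurableSet.univ, setLIntegral_univ] at this
  simp_rw [gPdf_eq] at h1
  have hp : 0 < Real.sqrt (2 * Real.pi) := by positivity
  simp_rw [ENNReal.ofReal_mul (p := (Real.sqrt (2 * Real.pi))⁻¹ ^ Fintype.card (Fin n)) (by positivity)] at h1
  rw [lintegral_const_mul' _ _ ENNReal.ofReal_ne_top, Fintype.card_fin] at h1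
  calc _ = ENNReal.ofReal (Real.sqrt (2 * Real.pi) ^ n) * (ENNReal.ofReal ((Real.sqrt (2 * Real.pi))⁻¹ ^ n) *
      ∫⁻ x : Fin n → ℝ, ENNReal.ofReal (Real.exp (-(x ⬝ᵥ x) / 2))) := by
        rw [← mul_assoc, ← ENNReal.ofReal_mul (by positivity), ← mul_pow, mul_inv_cancel₀ hp.ne']
        simp
    _ = _ := by rw [h1, mul_one]

lemma joint_int (hN : 1 ≤ N) {φ : ℝ → ℝ≥0∞} (hφ : Measurable φ) :
    ∫⁻ z : JJ N → ℝ, ENNReal.ofReal (Real.exp (-(zx z ⬝ᵥ zx z) / 2)) *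
      (ENNReal.ofReal (Real.exp (-(zy z ⬝ᵥ zy z) / 2)) * φ (rr z)) =
    ENNReal.ofReal (Real.sqrt (2 * Real.pi) ^ (N + 1)) * (ENNReal.ofReal (DN N) *
      ∫⁻ r in Set.Ioo (-1 : ℝ) 1, ENNReal.ofReal (Real.sqrt (1 - r ^ 2) ^ N / (1 - r ^ 2)) * φ r) := by
  have hmp := volume_measurePreserving_sumPiEquivProdPi_symm (fun _ : JJ N => ℝ)
  rw [← hmp.lintegral_comp_emb (MeasurableEquiv.measurableEmbedding _)]
  change ∫⁻ p : (Fin (N + 1) → ℝ) × (Fin (N + 1) → ℝ),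
    ENNReal.ofReal (Real.exp (-(p.1 ⬝ᵥ p.1) / 2)) *
      (ENNReal.ofReal (Real.exp (-(p.2 ⬝ᵥ p.2) / 2)) * φ (hat p.1 ⬝ᵥ hat p.2)) ∂(volume.prod volume) = _
  have hmh := measurable_hat (n := N + 1)
  have hmeas : Measurable fun p : (Fin (N + 1) → ℝ) × (Fin (N + 1) → ℝ) =>
    ENNReal.ofReal (Real.exp (-(p.1 ⬝ᵥ p.1) / 2)) *
      (ENNReal.ofReal (Real.exp (-(p.2 ⬝ᵥ p.2) / 2)) * φ (hat p.1 ⬝ᵥ hat p.2)) := by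
    unfold dotProduct; fun_prop
  rw [lintegral_prod _ hmeas.aemeasurable, ← gauss_total]
  rw [← lintegral_mul_const _ (by unfold dotProduct; fun_prop)]
  refine lintegral_congr_ae ?_
  have hae : ∀ᵐ v : Fin (N + 1) → ℝ, v ≠ 0 := by simp [ae_iff, measure_singleton]
  filter_upwards [hae] with x hx
  rw [lintegral_const_mul' _ _ ENNReal.ofReal_ne_top, rot_int hN (hat_dot hx) hφ]

/-- normalising constant -/
def cN (N : ℕ) : ℝ := Real.sqrt 2 ^ (N - 1) * Real.Gamma (((N : ℝ) + 1) / 2)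

lemma cN_pos : 0 < cN N := by
  have := Real.Gamma_pos_of_pos (s := ((N : ℝ) + 1) / 2) (by positivity)
  unfold cN; positivity

lemma ww_eq (hN : 1 ≤ N) {x : Fin (N + 1) → ℝ} (hx : x ≠ 0) :
    ww N ((x ⬝ᵥ x) / 2) * (nrm x * (nrm x)⁻¹ ^ N) = (cN N)⁻¹ * Real.exp (-(x ⬝ᵥ x) / 2) := by
  have hp := dot_self_pos hx
  have hn := nrm_pos hx
  obtain ⟨M, rfl⟩ : ∃ M, N = M + 1 := ⟨N - 1, by omega⟩
  rw [ww, Set.indicator_of_mem (by exact half_pos hp), gammaPDFReal, if_pos (half_pos hp).le, cN]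
  have e : ((x ⬝ᵥ x) / 2) ^ ((((M + 1 : ℕ) : ℝ) + 1) / 2 - 1) = (nrm x / Real.sqrt 2) ^ M := by
    have e1 : (x ⬝ᵥ x) / 2 = (nrm x / Real.sqrt 2) ^ (2 : ℝ) := by
      rw [Real.rpow_two, div_pow, nrm_sq]; norm_num
    rw [e1, ← Real.rpow_mul (by positivity), ← Real.rpow_natCast]
    congr 1; push_cast; ring
  rw [e]
  have hG := Real.Gamma_pos_of_pos (s := (((M + 1 : ℕ) : ℝ) + 1) / 2) (by positivity)
  rw [Real.one_rpow, one_mul, neg_div, div_pow, pow_succ (nrm x)⁻¹, inv_pow]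
  simp only [Nat.add_sub_cancel]
  field_simp

lemma const_eq (hN : 1 ≤ N) : 2 * ((2 * Real.pi)⁻¹ ^ N * ((N - 1).factorial : ℝ) * ((cN N)⁻¹ * (cN N)⁻¹) *
    (Real.sqrt (2 * Real.pi) ^ (N + 1) * DN N)) = 4 := by
  obtain ⟨M, rfl⟩ : ∃ M, N = M + 1 := ⟨N - 1, by omega⟩
  have hdup := Real.Gamma_mul_Gamma_add_half ((((M + 1 : ℕ) : ℝ) + 1) / 2)
  rw [show (((M + 1 : ℕ) : ℝ) + 1) / 2 + 1 / 2 = ((M + 1 : ℕ) : ℝ) / 2 + 1 by ring,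
    show 2 * ((((M + 1 : ℕ) : ℝ) + 1) / 2) = ((M + 1 : ℕ) : ℝ) + 1 by ring,
    Real.Gamma_nat_eq_factorial, show (1 : ℝ) - (((M + 1 : ℕ) : ℝ) + 1) = -((M + 1 : ℕ) : ℝ) by ring,
    Real.rpow_neg (by norm_num), Real.rpow_natCast] at hdup
  have hG1 := Real.Gamma_pos_of_pos (s := (((M + 1 : ℕ) : ℝ) + 1) / 2) (by positivity)
  have hG2 := Real.Gamma_pos_of_pos (s := ((M + 1 : ℕ) : ℝ) / 2 + 1) (by positivity)
  unfold DN cN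
  set G1 := Real.Gamma ((((M + 1 : ℕ) : ℝ) + 1) / 2)
  set G2 := Real.Gamma (((M + 1 : ℕ) : ℝ) / 2 + 1)
  rw [Real.sqrt_mul (by norm_num)]
  have hA : Real.sqrt 2 ^ 2 = 2 := Real.sq_sqrt (by norm_num)
  have hB : Real.sqrt Real.pi ^ 2 = Real.pi := Real.sq_sqrt Real.pi_pos.le
  have hA0 : 0 < Real.sqrt 2 := by positivity
  have hB0 : 0 < Real.sqrt Real.pi := Real.sqrt_pos.2 Real.pi_pos
  set A := Real.sqrt 2
  set B := Real.sqrt Real.pi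
  have hF : (((M + 1).factorial : ℕ) : ℝ) = ((M + 1 : ℕ) : ℝ) * (M.factorial : ℝ) := by
    rw [Nat.factorial_succ]; push_cast; ring
  rw [hF] at hdup
  simp only [Nat.add_sub_cancel]
  have hf0 : (0 : ℝ) < M.factorial := by positivity
  have hM0 : (0 : ℝ) < ((M + 1 : ℕ) : ℝ) := by positivity
  have hG2' : ((M + 1 : ℕ) : ℝ) * (M.factorial : ℝ) * B = G1 * G2 * 2 ^ (M + 1) := by
    rw [hdup]; field_simp
  calc _ = 2 * ((A ^ 2 * B ^ 2)⁻¹ ^ (M + 1) * ((A ^ M)⁻¹ * (A ^ M)⁻¹) * (A ^ (M + 2) * B ^ (M + 2)) *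
        (B ^ M * (A ^ (M + 2) * (1 / 2)))) * ((((M + 1 : ℕ) : ℝ) * (M.factorial : ℝ) * B) / (G1 * G2)) := by
        rw [hA, hB]; field_simp; ring
    _ = 2 * ((A ^ 2 * B ^ 2)⁻¹ ^ (M + 1) * ((A ^ M)⁻¹ * (A ^ M)⁻¹) * (A ^ (M + 2) * B ^ (M + 2)) *
        (B ^ M * (A ^ (M + 2) * (1 / 2)))) * (A ^ 2) ^ (M + 1) := by
        rw [hG2', hA]; field_simp
    _ = A ^ 2 * A ^ 2 := by
        rw [mul_inv, mul_pow, inv_pow, inv_pow]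
        have : ∀ n : ℕ, A ^ n ≠ 0 := fun n => by positivity
        have : ∀ n : ℕ, B ^ n ≠ 0 := fun n => by positivity
        field_simp
        ring
    _ = 4 := by rw [hA]; norm_num

/-- one dimensional integrand -/
def FF (N : ℕ) (d : Fin N → ℕ) (a : Fin N → ℕ → ℝ) (r : ℝ) : ℝ≥0∞ :=
  ENNReal.ofReal (∏ k, (Real.sqrt (xi (d k) (a k) 1 ^ 2 - xi (d k) (a k) r ^ 2))⁻¹) *
    ENNReal.ofReal ((∑ k, lam (d k) (a k) r) * ∏ k, xi' (d k) (a k) 1)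

lemma measurable_FF : Measurable (FF N d a) := by
  have h1 : ∀ k, Measurable (xi (d k) (a k)) := fun k => (contDiff_xi (d k) (a k)).continuous.measurable
  have h2 : ∀ k, Measurable (xi' (d k) (a k)) := fun k => measurable_deriv _
  unfold FF lam
  fun_prop

lemma one_dim (hN : 1 ≤ N) (ha : ∀ k, ∃ p ∈ Finset.Icc 2 (d k), a k p ≠ 0) {I : Set ℝ}
    (hIm : MeasurableSet I) (hI : I ⊆ Set.Ioo (-1) 1) :
    ∫⁻ g, Znk2 N N d a g I ∂(GaussP N N d) ≤ 4 * ∫⁻ r in I,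
      ENNReal.ofReal (Real.sqrt (1 - r ^ 2) ^ N / (1 - r ^ 2)) * FF N d a r := by
  set K0 : ℝ := (2 * Real.pi)⁻¹ ^ N * ((N - 1).factorial : ℝ) * ((cN N)⁻¹ * (cN N)⁻¹) with hK0
  have hcN := cN_pos (N := N)
  have hK0p : 0 ≤ K0 := by positivity
  have hφ : Measurable (I.indicator (FF N d a)) := measurable_FF.indicator hIm
  have hDN : 0 ≤ DN N := by
    have := Real.Gamma_pos_of_pos (s := (N : ℝ) / 2 + 1) (by positivity)
    have := Real.Gamma_pos_of_pos (s := ((N : ℝ) + 1) / 2) (by positivity)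
    unfold DN; positivity
  refine (kr_bound hN ha hIm hI).trans ?_
  have hpt : ∀ z ∈ SS N I, ENNReal.ofReal ((2 * Real.pi)⁻¹ ^ N *
        (ww N ((zx z ⬝ᵥ zx z) / 2) * ww N ((zy z ⬝ᵥ zy z) / 2))) *
      (ENNReal.ofReal ((∏ k, (Real.sqrt (xi (d k) (a k) 1 ^ 2 - xi (d k) (a k) (rr z) ^ 2))⁻¹) *
        (nrm (zx z) * (nrm (zx z))⁻¹ ^ N * (nrm (zy z) * (nrm (zy z))⁻¹ ^ N))) *
      ENNReal.ofReal (((N - 1).factorial : ℝ) *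
        ((∑ k, lam (d k) (a k) (rr z)) * ∏ k, xi' (d k) (a k) 1))) =
      ENNReal.ofReal K0 * (ENNReal.ofReal (Real.exp (-(zx z ⬝ᵥ zx z) / 2)) *
      (ENNReal.ofReal (Real.exp (-(zy z ⬝ᵥ zy z) / 2)) * I.indicator (FF N d a) (rr z))) := by
    intro z hz
    obtain ⟨⟨hx, hy, hr⟩, hzI⟩ := hz
    have w1 := ww_nonneg (N := N) ((zx z ⬝ᵥ zx z) / 2)
    have w2 := ww_nonneg (N := N) ((zy z ⬝ᵥ zy z) / 2)
    have n1 := nrm_pos hx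
    have n2 := nrm_pos hy
    have hP : 0 ≤ ∏ k, (Real.sqrt (xi (d k) (a k) 1 ^ 2 - xi (d k) (a k) (rr z) ^ 2))⁻¹ :=
      Finset.prod_nonneg fun k _ => by positivity
    rw [Set.indicator_of_mem hzI, FF]
    set P := ∏ k, (Real.sqrt (xi (d k) (a k) 1 ^ 2 - xi (d k) (a k) (rr z) ^ 2))⁻¹
    set L := (∑ k, lam (d k) (a k) (rr z)) * ∏ k, xi' (d k) (a k) 1
    rw [ENNReal.ofReal_mul (p := ((N - 1).factorial : ℝ)) (by positivity)]
    simp only [← mul_assoc]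
    congr 1
    rw [← ENNReal.ofReal_mul (by positivity), ← ENNReal.ofReal_mul (by positivity),
      ← ENNReal.ofReal_mul (by positivity), ← ENNReal.ofReal_mul (by positivity),
      ← ENNReal.ofReal_mul (by positivity)]
    congr 1
    have k1 := ww_eq hN hx
    have k2 := ww_eq hN hy
    calc _ = (2 * Real.pi)⁻¹ ^ N * ((N - 1).factorial : ℝ) *
        ((ww N ((zx z ⬝ᵥ zx z) / 2) * (nrm (zx z) * (nrm (zx z))⁻¹ ^ N)) *
          (ww N ((zy z ⬝ᵥ zy z) / 2) * (nrm (zy z) * (nrm (zy z))⁻¹ ^ N))) * P := by ring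
      _ = _ := by rw [k1, k2, hK0]; ring
  rw [setLIntegral_congr_fun (measurableSet_SS hIm) hpt]
  refine (mul_le_mul_right (setLIntegral_le_lintegral _ _) 2).trans ?_
  rw [lintegral_const_mul' _ _ ENNReal.ofReal_ne_top, joint_int hN hφ]
  have hind : ∫⁻ r in Set.Ioo (-1 : ℝ) 1, ENNReal.ofReal (Real.sqrt (1 - r ^ 2) ^ N / (1 - r ^ 2)) *
      I.indicator (FF N d a) r = ∫⁻ r in I,
      ENNReal.ofReal (Real.sqrt (1 - r ^ 2) ^ N / (1 - r ^ 2)) * FF N d a r := by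
    have : ∀ r, ENNReal.ofReal (Real.sqrt (1 - r ^ 2) ^ N / (1 - r ^ 2)) *
      I.indicator (FF N d a) r = I.indicator (fun r =>
      ENNReal.ofReal (Real.sqrt (1 - r ^ 2) ^ N / (1 - r ^ 2)) * FF N d a r) r := by
      intro r
      by_cases h : r ∈ I <;> simp [h]
    simp_rw [this]
    rw [setLIntegral_indicator hIm, Set.inter_eq_left.2 hI]
  rw [hind]
  have h4 : (4 : ℝ≥0∞) = 2 * (ENNReal.ofReal K0 * (ENNReal.ofReal (Real.sqrt (2 * Real.pi) ^ (N + 1)) *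
      ENNReal.ofReal (DN N))) := by
    rw [← ENNReal.ofReal_mul (by positivity), ← ENNReal.ofReal_mul (by positivity),
      show (2 : ℝ≥0∞) = ENNReal.ofReal 2 by simp, ← ENNReal.ofReal_mul (by positivity),
      const_eq hN]
    simp
  rw [h4]
  simp only [mul_assoc]
  exact le_rfl
end

section
open scoped Matrix
set_option linter.all false

lemma xi_conv {d : ℕ} {a : ℕ → ℝ} {r : ℝ} (h0 : 0 ≤ r) (h1 : r ≤ 1) :
    xi d a 1 - xi d a r ≤ xi' d a 1 * (1 - r) := by
  rw [xi'_eq]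
  unfold xi
  rw [← Finset.sum_sub_distrib, Finset.sum_mul]
  refine Finset.sum_le_sum fun p _ => ?_
  have := one_add_mul_le_pow (a := r - 1) (by linarith) p
  rw [add_sub_cancel] at this
  simp only [one_pow, mul_one]
  nlinarith [sq_nonneg (a p)]

lemma xi_nonneg' {d : ℕ} {a : ℕ → ℝ} {r : ℝ} (h0 : 0 ≤ r) : 0 ≤ xi d a r :=
  Finset.sum_nonneg fun p _ => by positivity

lemma xi'_ge {d : ℕ} {a : ℕ → ℝ} {r : ℝ} (h0 : 0 ≤ r) (h1 : r ≤ 1) :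
    r ^ (d - 1) * xi' d a 1 ≤ xi' d a r := by
  rw [xi'_eq, xi'_eq, Finset.mul_sum]
  refine Finset.sum_le_sum fun p hp => ?_
  have hpd := (Finset.mem_Icc.1 hp).2
  have : r ^ (d - 1) ≤ r ^ (p - 1) := pow_le_pow_of_le_one h0 h1 (by omega)
  calc _ = (a p ^ 2 * p) * r ^ (d - 1) := by simp; ring
    _ ≤ (a p ^ 2 * p) * r ^ (p - 1) := by gcongr
    _ = _ := by ring

lemma lam_le_one {d : ℕ} {a : ℕ → ℝ} (ha : ∃ p ∈ Finset.Icc 2 d, a p ≠ 0) {r : ℝ} (hr : r ^ 2 < 1) :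
    lam d a r ≤ 1 := by
  unfold lam
  have h1 := xi_one_pos ha
  have h2 := xi'_one_pos ha
  have h3 := xi_sq_lt ha hr
  have h4 : 0 ≤ 1 - r ^ 2 := by linarith
  have : 0 ≤ xi' d a r ^ 2 * (1 - r ^ 2) * xi d a 1 / ((xi d a 1 ^ 2 - xi d a r ^ 2) * xi' d a 1) := by
    positivity
  linarith

lemma lam_le_d {d : ℕ} {a : ℕ → ℝ} (ha : ∃ p ∈ Finset.Icc 2 d, a p ≠ 0) {r : ℝ}
    (h0 : 0 ≤ r) (hr1 : r < 1) : lam d a r ≤ 2 * d * (1 - r) := by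
  have hr : r ^ 2 < 1 := by nlinarith
  have h1 := xi_one_pos ha
  have h2 := xi'_one_pos ha
  have h3 := xi_sq_lt ha hr
  have h4 := xi_conv (d := d) (a := a) h0 hr1.le
  have h5 := xi'_ge (d := d) (a := a) h0 hr1.le
  have h6 := xi_nonneg' (d := d) (a := a) h0
  have h7 := xi_abs_le (d := d) (a := a) hr.le
  have hd : 2 ≤ d := by
    obtain ⟨p, hp, _⟩ := ha
    have := Finset.mem_Icc.1 hp
    omega
  unfold lam
  set A := xi d a 1
  set X := xi d a r
  set B := xi' d a 1
  set Y := xi' d a r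
  have hXA : X ≤ A := by
    have := le_abs_self X
    nlinarith
  have h8 : A ^ 2 - X ^ 2 ≤ 2 * A * (B * (1 - r)) := by
    have : A ^ 2 - X ^ 2 = (A + X) * (A - X) := by ring
    rw [this]
    refine mul_le_mul (by linarith) h4 (by linarith) (by linarith)
  have hq : r ^ (2 * d) ≤ Y ^ 2 * (1 - r ^ 2) * A / ((A ^ 2 - X ^ 2) * B) := by
    rw [le_div_iff₀ (by positivity)]
    have hY : (r ^ (d - 1) * B) ^ 2 ≤ Y ^ 2 := by gcongr
    have hrr : r ^ (2 * d) ≤ r ^ (2 * (d - 1)) * ((1 + r) / 2) := by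
      have : r ^ (2 * d) = r ^ (2 * (d - 1)) * (r * r) := by
        rw [← pow_two, ← pow_add]; congr 1; omega
      rw [this]
      gcongr
      nlinarith
    calc r ^ (2 * d) * ((A ^ 2 - X ^ 2) * B)
        ≤ (r ^ (2 * (d - 1)) * ((1 + r) / 2)) * ((2 * A * (B * (1 - r))) * B) := by gcongr
      _ = (r ^ (d - 1) * B) ^ 2 * (1 - r ^ 2) * A := by rw [mul_pow, ← pow_mul, mul_comm 2 (d-1)]; ring
      _ ≤ _ := by
        have : 0 ≤ 1 - r ^ 2 := by linarith
        gcongr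
  have hb := one_add_mul_le_pow (a := r - 1) (by linarith) (2 * d)
  rw [add_sub_cancel] at hb
  push_cast at hb
  linarith

/-- the pointwise bound -/
def bb (D ε r : ℝ) : ℝ := if r ≤ 0 then 1 / ε else if r ≤ 1 - 1 / (2 * D) then (1 - r)⁻¹ else 2 * D

lemma lam_bb {d : ℕ} {a : ℕ → ℝ} (ha : ∃ p ∈ Finset.Icc 2 d, a p ≠ 0) {r ε D : ℝ} (hε : 0 < ε)
    (h0 : -1 + ε < r) (hr1 : r < 1) (hD : (d : ℝ) ≤ D) : lam d a r / (1 - r ^ 2) ≤ bb D ε r := by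
  have hr : r ^ 2 < 1 := by nlinarith
  have h4 : 0 < 1 - r ^ 2 := by linarith
  have l1 := lam_le_one ha hr
  unfold bb
  split_ifs with c1 c2
  · refine (div_le_div_of_nonneg_right l1 h4.le).trans ?_
    exact one_div_le_one_div_of_le hε (by nlinarith)
  · refine (div_le_div_of_nonneg_right l1 h4.le).trans ?_
    rw [← one_div]
    exact one_div_le_one_div_of_le (by linarith) (by nlinarith)
  · push Not at c1
    have l2 := lam_le_d ha c1.le hr1
    rw [div_le_iff₀ h4]
    have hd0 : (0 : ℝ) ≤ d := by positivity
    have : 2 * (d : ℝ) * (1 - r) ≤ 2 * D * (1 - r ^ 2) := by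
      refine mul_le_mul (by linarith) (by nlinarith) (by linarith) (by linarith)
    linarith

lemma int_bb {D ε : ℝ} (hD : 2 ≤ D) (h0 : 0 < ε) (h1 : ε < 1) :
    ∫⁻ r in Set.Ioo (-1 + ε) 1, ENNReal.ofReal (bb D ε r) ≤ ENNReal.ofReal (6 / ε * Real.log D) := by
  have hδ : 1 / (2 * D) ≤ 1 / 4 := one_div_le_one_div_of_le (by norm_num) (by linarith)
  have hδ0 : 0 < 1 / (2 * D) := by positivity
  set δ := 1 / (2 * D) with hδd
  have hsub : Set.Ioo (-1 + ε) 1 ⊆ Set.Ioc (-1) 0 ∪ (Set.Ioc 0 (1 - δ) ∪ Set.Ioc (1 - δ) 1) := by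
    intro r hr
    rcases le_or_gt r 0 with h | h
    · left; exact ⟨by linarith [hr.1], h⟩
    · right
      rcases le_or_gt r (1 - δ) with h' | h'
      · left; exact ⟨h, h'⟩
      · right; exact ⟨h', hr.2.le⟩
  refine (lintegral_mono_set hsub).trans ((lintegral_union_le _ _ _).trans
    (add_le_add le_rfl (lintegral_union_le _ _ _)) |>.trans ?_)
  have e1 : ∫⁻ r in Set.Ioc (-1 : ℝ) 0, ENNReal.ofReal (bb D ε r) = ENNReal.ofReal (1 / ε) := by
    rw [setLIntegral_congr_fun measurableSet_Ioc (g := fun _ => ENNReal.ofReal (1 / ε))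
      (fun r hr => by simp only [bb, if_pos hr.2])]
    simp
  have e3 : ∫⁻ r in Set.Ioc (1 - δ) 1, ENNReal.ofReal (bb D ε r) = ENNReal.ofReal 1 := by
    rw [setLIntegral_congr_fun measurableSet_Ioc (g := fun _ => ENNReal.ofReal (2 * D))
      (fun r hr => by
        simp only [bb]
        rw [if_neg (by linarith [hr.1]), if_neg (by rw [← hδd]; linarith [hr.1])])]
    rw [setLIntegral_const, Real.volume_Ioc, ← ENNReal.ofReal_mul (by linarith)]
    congr 1
    rw [hδd]; field_simp; ring
  have hle : (0 : ℝ) ≤ 1 - δ := by linarith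
  have e2 : ∫⁻ r in Set.Ioc 0 (1 - δ), ENNReal.ofReal (bb D ε r) = ENNReal.ofReal (Real.log (2 * D)) := by
    rw [setLIntegral_congr_fun measurableSet_Ioc (g := fun r => ENNReal.ofReal ((1 - r)⁻¹))
      (fun r hr => by
        simp only [bb]
        rw [if_neg (by linarith [hr.1]), if_pos hr.2])]
    have hc : ContinuousOn (fun r : ℝ => (1 - r)⁻¹) (Set.uIcc 0 (1 - δ)) := by
      refine ContinuousOn.inv₀ (by fun_prop) fun r hr => ?_
      rw [Set.uIcc_of_le hle] at hr
      linarith [hr.2]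
    have hi := hc.intervalIntegrable (μ := volume)
    rw [← ofReal_integral_eq_lintegral_ofReal
      ((intervalIntegrable_iff_integrableOn_Ioc_of_le hle).1 hi)]
    · rw [← intervalIntegral.integral_of_le hle,
        intervalIntegral.integral_comp_sub_left (fun x => x⁻¹) 1, integral_inv]
      · congr 2
        rw [hδd]; simp
      · rw [Set.uIcc_of_le (by linarith)]
        intro h; linarith [h.1]
    · refine (ae_restrict_iff' measurableSet_Ioc).2 (Filter.Eventually.of_forall fun r hr => ?_)
      have : 0 < 1 - r := by linarith [hr.2]
      simp only [Pi.zero_apply]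
      positivity
  rw [e1, e2, e3]
  have hl2 := Real.log_two_gt_d9
  have hlD : Real.log 2 ≤ Real.log D := Real.log_le_log (by norm_num) hD
  have hl : Real.log (2 * D) = Real.log 2 + Real.log D := Real.log_mul (by norm_num) (by linarith)
  rw [← ENNReal.ofReal_add (by rw [hl]; linarith) (by norm_num),
    ← ENNReal.ofReal_add (by positivity) (by rw [hl]; linarith)]
  refine ENNReal.ofReal_le_ofReal ?_
  rw [hl]
  have hi1 : 1 ≤ 1 / ε := by rw [le_div_iff₀ h0]; linarith
  have : 6 / ε * Real.log D = 1 / ε * (6 * Real.log D) := by ring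
  rw [this]
  nlinarith

lemma ptw {N : ℕ} (hN : 1 ≤ N) {d : Fin N → ℕ} {a : Fin N → ℕ → ℝ}
    (ha : ∀ k, ∃ p ∈ Finset.Icc 2 (d k), a k p ≠ 0) {r : ℝ} (hr : r ^ 2 < 1) :
    ENNReal.ofReal (Real.sqrt (1 - r ^ 2) ^ N / (1 - r ^ 2)) * FF N d a r =
      ENNReal.ofReal (∏ k, Real.sqrt (xi' (d k) (a k) 1 ^ 2 * (1 - r ^ 2) /
                (xi (d k) (a k) 1 ^ 2 - xi (d k) (a k) r ^ 2))) *
      ENNReal.ofReal (∑ k, lam (d k) (a k) r / (1 - r ^ 2)) := by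
  have h4 : 0 < 1 - r ^ 2 := by linarith
  have hp : ∏ k, Real.sqrt (xi' (d k) (a k) 1 ^ 2 * (1 - r ^ 2) /
                (xi (d k) (a k) 1 ^ 2 - xi (d k) (a k) r ^ 2)) =
      (∏ k, xi' (d k) (a k) 1) * Real.sqrt (1 - r ^ 2) ^ N *
      ∏ k, (Real.sqrt (xi (d k) (a k) 1 ^ 2 - xi (d k) (a k) r ^ 2))⁻¹ := by
    have : Real.sqrt (1 - r ^ 2) ^ N = ∏ k : Fin N, Real.sqrt (1 - r ^ 2) := by simp
    rw [this, ← Finset.prod_mul_distrib, ← Finset.prod_mul_distrib]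
    refine Finset.prod_congr rfl fun k _ => ?_
    have h2 := xi'_one_pos (ha k)
    rw [Real.sqrt_div (by positivity), Real.sqrt_mul (by positivity), Real.sqrt_sq h2.le]
    rfl
  have hP0 : 0 ≤ ∏ k, (Real.sqrt (xi (d k) (a k) 1 ^ 2 - xi (d k) (a k) r ^ 2))⁻¹ :=
    Finset.prod_nonneg fun k _ => by positivity
  have hQ0 : 0 ≤ ∏ k, xi' (d k) (a k) 1 := Finset.prod_nonneg fun k _ => (xi'_one_pos (ha k)).le
  unfold FF
  rw [hp, ← ENNReal.ofReal_mul (by positivity), ← ENNReal.ofReal_mul (by positivity),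
    ← ENNReal.ofReal_mul (by positivity), ← Finset.sum_div]
  congr 1
  ring

lemma bdd {N : ℕ} {d : Fin N → ℕ} {a : Fin N → ℕ → ℝ}
    (ha : ∀ k, ∃ p ∈ Finset.Icc 2 (d k), a k p ≠ 0) {I : Set ℝ} (hI : I ⊆ Set.Ioo (-1) 1) :
    BddAbove ((fun r => ∏ k, Real.sqrt (xi' (d k) (a k) 1 ^ 2 * (1 - r ^ 2) /
                (xi (d k) (a k) 1 ^ 2 - xi (d k) (a k) r ^ 2))) '' I) := by
  refine ⟨∏ k, Real.sqrt (xi' (d k) (a k) 1 ^ 2 / xi (d k) (a k) 1 ^ 2), ?_⟩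
  rintro _ ⟨r, hr, rfl⟩
  have h := hI hr
  have hr2 : r ^ 2 < 1 := by nlinarith [h.1, h.2]
  refine Finset.prod_le_prod (fun k _ => Real.sqrt_nonneg _) fun k _ => Real.sqrt_le_sqrt ?_
  have h1 := xi_one_pos (ha k)
  have h3 := xi_sq_lt (ha k) hr2
  have h5 := xi_sq_le (d := d k) (a := a k) hr2.le
  rw [div_le_div_iff₀ h3 (by positivity)]
  nlinarith [sq_nonneg (xi' (d k) (a k) 1)]

theorem main7 :
    ∃ c : ℝ, 0 < c ∧ ∀ N : ℕ, 1 ≤ N →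
      ∀ (d : Fin N → ℕ) (a : Fin N → ℕ → ℝ),
        (∀ k, 2 ≤ d k) → (∀ k, ∃ p ∈ Finset.Icc 2 (d k), a k p ≠ 0) →
        ∀ ε : ℝ, ε ∈ Set.Ioo (0 : ℝ) 1 →
        ∀ I : Set ℝ, I.OrdConnected → I ⊆ Set.Ioo (-1 + ε) 1 →
        ∫⁻ g, Znk2 N N d a g I ∂(GaussP N N d)
          ≤ ENNReal.ofReal (c * N / ε * Real.log (Finset.univ.sup d : ℕ) *
              sSup ((fun r => ∏ k, Real.sqrt (xi' (d k) (a k) 1 ^ 2 * (1 - r ^ 2) /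
                (xi (d k) (a k) 1 ^ 2 - xi (d k) (a k) r ^ 2))) '' I)) := by
  refine ⟨24, by norm_num, ?_⟩
  intro N hN d a hd ha ε hε I hIc hI
  have hI' : I ⊆ Set.Ioo (-1) 1 := fun r hr => ⟨by linarith [(hI hr).1, hε.1], (hI hr).2⟩
  have hIm := hIc.measurableSet
  refine (one_dim hN ha hIm hI').trans ?_
  set D : ℕ := Finset.univ.sup d with hDd
  have hdD : ∀ k, d k ≤ D := fun k => Finset.le_sup (Finset.mem_univ k)
  have hD : 2 ≤ D := (hd ⟨0, hN⟩).trans (hdD _)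
  set S := sSup ((fun r => ∏ k, Real.sqrt (xi' (d k) (a k) 1 ^ 2 * (1 - r ^ 2) /
                (xi (d k) (a k) 1 ^ 2 - xi (d k) (a k) r ^ 2))) '' I) with hS
  have hS0 : 0 ≤ S := by
    refine Real.sSup_nonneg ?_
    rintro _ ⟨r, hr, rfl⟩
    exact Finset.prod_nonneg fun k _ => Real.sqrt_nonneg _
  have hpt : ∀ r ∈ I, ENNReal.ofReal (Real.sqrt (1 - r ^ 2) ^ N / (1 - r ^ 2)) * FF N d a r ≤
      ENNReal.ofReal (S * N) * ENNReal.ofReal (bb D ε r) := by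
    intro r hr
    have h := hI' hr
    have hr2 : r ^ 2 < 1 := by nlinarith [h.1, h.2]
    rw [ptw hN ha hr2, ENNReal.ofReal_mul hS0, mul_assoc, ← ENNReal.ofReal_mul (p := (N : ℝ)) (by positivity)]
    refine mul_le_mul' (ENNReal.ofReal_le_ofReal (le_csSup (bdd ha hI') ⟨r, hr, rfl⟩))
      (ENNReal.ofReal_le_ofReal ?_)
    calc _ ≤ ∑ k : Fin N, bb D ε r := Finset.sum_le_sum fun k _ =>
          lam_bb (ha k) hε.1 (hI hr).1 (hI hr).2 (by exact_mod_cast hdD k)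
      _ = _ := by simp
  have hJint : ∫⁻ r in I, ENNReal.ofReal (Real.sqrt (1 - r ^ 2) ^ N / (1 - r ^ 2)) * FF N d a r ≤
      ENNReal.ofReal (S * N) * ENNReal.ofReal (6 / ε * Real.log D) := by
    refine (setLIntegral_mono' hIm hpt).trans ?_
    rw [lintegral_const_mul' _ _ ENNReal.ofReal_ne_top]
    exact mul_le_mul_right ((lintegral_mono_set hI).trans
      (int_bb (by exact_mod_cast hD) hε.1 hε.2)) _
  refine (mul_le_mul_right hJint _).trans (le_of_eq ?_)
  rw [show (4 : ℝ≥0∞) = ENNReal.ofReal 4 by simp, ← ENNReal.ofReal_mul (by positivity),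
    ← ENNReal.ofReal_mul (by norm_num)]
  congr 1
  ring
end

/-- **Corollary 6 (logarithmic bound, `K = N`).**
There is a universal `c > 0` such that for every `N ≥ 1`, every admissible system with
`K = N`, every `ε ∈ (0,1)` and every interval `I ⊆ (−1+ε, 1)`,
`E[𝒵²_{N,N}(g, I)] ≤ (cN/ε) log(max_k d_k) sup_{r∈I} ∏_k (ξ_k'(1)²(1−r²)/(ξ_k(1)²−ξ_k(r)²))^{1/2}`. -/
theorem stmt7 :
    ∃ c : ℝ, 0 < c ∧ ∀ N : ℕ, 1 ≤ N →
      ∀ (d : Fin N → ℕ) (a : Fin N → ℕ → ℝ),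
        (∀ k, 2 ≤ d k) → (∀ k, ∃ p ∈ Finset.Icc 2 (d k), a k p ≠ 0) →
        ∀ ε : ℝ, ε ∈ Set.Ioo (0 : ℝ) 1 →
        ∀ I : Set ℝ, I.OrdConnected → I ⊆ Set.Ioo (-1 + ε) 1 →
        ∫⁻ g, Znk2 N N d a g I ∂(GaussP N N d)
          ≤ ENNReal.ofReal (c * N / ε * Real.log (Finset.univ.sup d : ℕ) *
              sSup ((fun r => ∏ k, Real.sqrt (xi' (d k) (a k) 1 ^ 2 * (1 - r ^ 2) /
                (xi (d k) (a k) 1 ^ 2 - xi (d k) (a k) r ^ 2))) '' I)) := by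
  exact main7

end
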